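/- Let K be an algebraically closed field and let (τ_n) be a Zariski geometry on K such that every Zariski-closed subset of K^n is τ_n-closed. If for some n there exists a τ_n-closed subset of K^n that is not Zariski-closed, then there exists a τ_2-closed irreducible subset C of K² of dimension 1 that is not contained in the zero set of any nonzero polynomial in K[X,Y] (equivalently, C is Zariski-dense in K²). -/

import Mathlib

open Topology

/-- A subset of `K^n` is *Zariski-closed* (an affine algebraic set) if it is the common
zero set of a set of polynomials in `n` variables. -/
def ZariskiClosedSet (K : Type*) [Field K] {n : ℕ} (C : Set (Fin n → K)) : Prop :=
  ∃ S : Set (MvPolynomial (Fin n) K), C = {x | ∀ f ∈ S, MvPolynomial.eval x f = 0}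

/-- The Zariski topology on `K^n`: the topology whose closed sets are the affine
algebraic sets. -/
def zariskiTopology (K : Type*) [Field K] (n : ℕ) : TopologicalSpace (Fin n → K) :=
  TopologicalSpace.generateFrom {U | ZariskiClosedSet K Uᶜ}

/-- The dimension of a subset `S` of a topological space: the topological Krull
dimension of `S` with the subspace topology (the maximal length of a chain of
irreducible closed subsets). -/
noncomputable def setKrullDim {X : Type*} (t : TopologicalSpace X) (S : Set X) : WithBot ℕ∞ :=
  @topologicalKrullDim S (t.induced Subtype.val)

/-- `T` is an irreducible component of `S` (w.r.t. the topology `t`) if `T` is a maximal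
irreducible subset of `S`. -/
def IsIrredComponentOf {X : Type*} (t : TopologicalSpace X) (T S : Set X) : Prop :=
  Maximal (fun T => T ⊆ S ∧ @IsIrreducible X t T) T

/-- A *Zariski geometry* on a set `X`: a Noetherian topology on each Cartesian power
`X^n` satisfying axioms (Z0)-(Z3). -/
structure ZariskiGeometry (X : Type*) where
  τ : ∀ n : ℕ, TopologicalSpace (Fin n → X)
  noetherian : ∀ n, @TopologicalSpace.NoetherianSpace (Fin n → X) (τ n)
  /-- (Z0): every map `X^n → X^m` each of whose coordinates is a constant or a
  coordinate projection is continuous. -/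
  Z0_cont : ∀ (n m : ℕ) (g : Fin m → (Fin n ⊕ X)),
    Continuous[τ n, τ m] (fun x i => Sum.elim (fun j => x j) id (g i))
  /-- (Z0): the diagonals are closed. -/
  Z0_diag : ∀ (n : ℕ) (i j : Fin n), IsClosed[τ n] {x | x i = x j}
  /-- (Z1): for a (nonempty) closed `C ⊆ X^n` and a coordinate projection
  `π : X^n → X^k`, there is a proper closed subset `F` of `cl(π C)` with
  `cl(π C) \ F ⊆ π C`. -/
  Z1 : ∀ (n k : ℕ) (h : k ≤ n) (C : Set (Fin n → X)), IsClosed[τ n] C → C.Nonempty →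
    ∃ F : Set (Fin k → X), IsClosed[τ k] F ∧
      F ⊂ closure[τ k] ((fun x => x ∘ Fin.castLE h) '' C) ∧
      closure[τ k] ((fun x => x ∘ Fin.castLE h) '' C) \ F ⊆ (fun x => x ∘ Fin.castLE h) '' C
  /-- (Z2): `X` is irreducible. -/
  Z2_irred : @IrreducibleSpace (Fin 1 → X) (τ 1)
  /-- (Z2): uniform one-dimensionality. -/
  Z2 : ∀ (n : ℕ) (C : Set (Fin (n + 1) → X)), IsClosed[τ (n + 1)] C →
    ∃ m : ℕ, ∀ a : Fin n → X, {b : X | Fin.snoc a b ∈ C} = Set.univ ∨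
      ({b : X | Fin.snoc a b ∈ C}.Finite ∧ {b : X | Fin.snoc a b ∈ C}.ncard ≤ m)
  /-- (Z3) (Dimension theorem): every irreducible component of the intersection of a
  closed irreducible `U ⊆ X^n` with a diagonal has dimension `≥ dim U - 1`. -/
  Z3 : ∀ (n : ℕ) (U : Set (Fin n → X)) (i j : Fin n), IsClosed[τ n] U →
    @IsIrreducible _ (τ n) U →
    ∀ T : Set (Fin n → X), IsIrredComponentOf (τ n) T (U ∩ {x | x i = x j}) →
      setKrullDim (τ n) U ≤ setKrullDim (τ n) T + 1


set_option linter.all false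
open Topology

class ZG (K : Type*) [Field K] where
  geo : ZariskiGeometry K
  refines : ∀ (n : ℕ) (C : Set (Fin n → K)), ZariskiClosedSet K C → IsClosed[geo.τ n] C

namespace ZG
open Set
variable {K : Type*} [Field K] [ZG K]

variable (K) in
abbrev gt (n : ℕ) : TopologicalSpace (Fin n → K) := (geo (K := K)).τ n

noncomputable instance zgTop (ι : Type) [Finite ι] : TopologicalSpace (ι → K) :=
  TopologicalSpace.induced (fun x => x ∘ (Finite.equivFin ι).symm) (gt K (Nat.card ι))

lemma cont_fin {n m : ℕ} (s : Fin m → Fin n) :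
    Continuous[gt K n, gt K m] (fun x => x ∘ s) :=
  (geo (K := K)).Z0_cont n m (fun i => Sum.inl (s i))

lemma zgTop_fin (n : ℕ) : (zgTop (K := K) (Fin n)) = gt K n := by
  apply le_antisymm
  · have h1 : Continuous[zgTop (K := K) (Fin n), gt K (Nat.card (Fin n))]
        (fun x => x ∘ (Finite.equivFin (Fin n)).symm) := continuous_induced_dom
    have h2 := @Continuous.comp _ _ _ (zgTop (K := K) (Fin n)) (gt K (Nat.card (Fin n))) (gt K n)
      _ _ (cont_fin (K := K) (Finite.equivFin (Fin n))) h1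
    have h3 : ((fun x : Fin (Nat.card (Fin n)) → K => x ∘ (Finite.equivFin (Fin n))) ∘
      (fun x : Fin n → K => x ∘ (Finite.equivFin (Fin n)).symm)) = id := by
      funext x; ext i; simp
    rw [h3] at h2
    exact continuous_id_iff_le.1 h2
  · exact continuous_iff_le_induced.1 (cont_fin (K := K) (Finite.equivFin (Fin n)).symm)

lemma zgTop_fin' (n : ℕ) : (zgTop (K := K) (Fin n)) = (geo (K := K)).τ n := zgTop_fin n

variable {ι κ μ : Type} [Finite ι] [Finite κ] [Finite μ]

lemma continuous_coord {f : (ι → K) → (κ → K)}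
    (hf : ∀ k, (∃ i, ∀ x, f x k = x i) ∨ (∃ c, ∀ x, f x k = c)) : Continuous f := by
  have hg : ∀ k, ∃ g : ι ⊕ K, ∀ x, f x k = Sum.elim x id g := by
    intro k
    rcases hf k with ⟨i, hi⟩ | ⟨c, hc⟩
    · exact ⟨Sum.inl i, hi⟩
    · exact ⟨Sum.inr c, hc⟩
  choose g hg using hg
  refine continuous_induced_rng.2 ?_
  have h1 : Continuous[zgTop (K := K) ι, gt K (Nat.card ι)]
        (fun x => x ∘ (Finite.equivFin ι).symm) := continuous_induced_dom
  have h0 := (geo (K := K)).Z0_cont (Nat.card ι) (Nat.card κ)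
    (fun i => Sum.map (Finite.equivFin ι) id (g ((Finite.equivFin κ).symm i)))
  have h2 := @Continuous.comp _ _ _ (zgTop (K := K) ι) (gt K (Nat.card ι)) (gt K (Nat.card κ))
      _ _ h0 h1
  convert h2 using 1
  funext x; ext i
  simp only [Function.comp, hg]
  rcases g ((Finite.equivFin κ).symm i) with j | c <;> simp

lemma continuous_re (g : κ → ι) : Continuous (fun x : ι → K => x ∘ g) :=
  continuous_coord (fun k => Or.inl ⟨g k, fun _ => rfl⟩)

noncomputable def reHomeo (e : κ ≃ ι) : (ι → K) ≃ₜ (κ → K) where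
  toFun x := x ∘ e
  invFun x := x ∘ e.symm
  left_inv x := by ext; simp
  right_inv x := by ext; simp
  continuous_toFun := continuous_re _
  continuous_invFun := continuous_re _

instance noeth : TopologicalSpace.NoetherianSpace (ι → K) := by
  have : TopologicalSpace.NoetherianSpace (Fin (Nat.card ι) → K) := by
    rw [zgTop_fin]; exact (geo (K := K)).noetherian _
  exact (reHomeo (K := K) (Finite.equivFin ι).symm).isInducing.noetherianSpace

lemma isClosed_diag (i j : ι) : IsClosed {x : ι → K | x i = x j} := by
  have h : IsClosed {x : Fin (Nat.card ι) → K | x (Finite.equivFin ι i) = x (Finite.equivFin ι j)} := by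
    rw [zgTop_fin]; exact (geo (K := K)).Z0_diag _ _ _
  have := h.preimage (reHomeo (K := K) (Finite.equivFin ι).symm).continuous
  convert this using 1
  ext x; simp [reHomeo]

lemma isClosed_alg (p : MvPolynomial ι K) : IsClosed {x : ι → K | MvPolynomial.eval x p = 0} := by
  have h : IsClosed {x : Fin (Nat.card ι) → K |
      MvPolynomial.eval x (MvPolynomial.rename (Finite.equivFin ι) p) = 0} := by
    rw [zgTop_fin]
    exact refines _ _ ⟨{MvPolynomial.rename (Finite.equivFin ι) p}, by ext; simp⟩
  have := h.preimage (reHomeo (K := K) (Finite.equivFin ι).symm).continuous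
  convert this using 1
  ext x
  simp only [mem_ofPred_eq, mem_preimage, MvPolynomial.eval_rename]
  have : ((reHomeo (Finite.equivFin ι).symm) x ∘ (Finite.equivFin ι)) = x := by
    ext; simp [reHomeo]
  rw [this]

lemma isClosed_coord (i : ι) (c : K) : IsClosed {x : ι → K | x i = c} := by
  have := isClosed_alg (K := K) (MvPolynomial.X i - MvPolynomial.C c : MvPolynomial ι K)
  simpa [sub_eq_zero] using this

/-- projection form of (Z1) -/
lemma Z1' (g : κ → ι) (C : Set (ι → K)) (hC : IsClosed C) (hne : C.Nonempty) :
    ∃ F : Set (κ → K), IsClosed F ∧ F ⊂ closure ((fun x => x ∘ g) '' C) ∧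
      closure ((fun x => x ∘ g) '' C) \ F ⊆ (fun x => x ∘ g) '' C := by
  set n := Nat.card ι
  set k := Nat.card κ
  set ei := Finite.equivFin ι
  set ek := Finite.equivFin κ
  let C' : Set (Fin (k + n) → K) := {z | (fun i => z (Fin.natAdd k (ei i))) ∈ C ∧
    ∀ j, z (Fin.castAdd n (ek j)) = z (Fin.natAdd k (ei (g j)))}
  have hC' : IsClosed C' := by
    apply IsClosed.inter
    · exact hC.preimage (continuous_re (fun i => (Fin.natAdd k (ei i))))
    · have : {z : Fin (k + n) → K | ∀ j, z (Fin.castAdd n (ek j)) = z (Fin.natAdd k (ei (g j)))}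
        = ⋂ j, {z : Fin (k + n) → K | z (Fin.castAdd n (ek j)) = z (Fin.natAdd k (ei (g j)))} := by
        ext; simp
      rw [show (fun z : Fin (k + n) → K =>
        ∀ j, z (Fin.castAdd n (ek j)) = z (Fin.natAdd k (ei (g j)))) = _ from this]
      exact isClosed_iInter fun j => isClosed_diag _ _
  have hle : k ≤ k + n := Nat.le_add_right k n
  have himg : (fun x : Fin (k + n) → K => x ∘ Fin.castLE hle) '' C' =
      (reHomeo (K := K) ek.symm) '' ((fun x => x ∘ g) '' C) := by
    ext y
    constructor
    · rintro ⟨z, ⟨hz1, hz2⟩, rfl⟩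
      refine ⟨_, ⟨_, hz1, rfl⟩, ?_⟩
      ext i
      have := hz2 (ek.symm i)
      simp only [Equiv.apply_symm_apply] at this
      simp only [reHomeo, Homeomorph.homeomorph_mk_coe, Equiv.coe_fn_mk, Function.comp]
      rw [← this]; rfl
    · rintro ⟨_, ⟨x, hx, rfl⟩, rfl⟩
      refine ⟨Fin.addCases (fun i => x (g (ek.symm i))) (fun i => x (ei.symm i)), ⟨?_, ?_⟩, ?_⟩
      · simpa using hx
      · intro j; simp
      · ext i
        have : Fin.castLE hle i = Fin.castAdd n i := rfl
        simp only [Function.comp, this, Fin.addCases_left, reHomeo, Homeomorph.homeomorph_mk_coe, Equiv.coe_fn_mk]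
  have hne' : C'.Nonempty := by
    have : ((fun x : Fin (k + n) → K => x ∘ Fin.castLE hle) '' C').Nonempty := by
      rw [himg]; exact (hne.image _).image _
    exact this.of_image
  have key : ∃ F : Set (Fin k → K), IsClosed F ∧
      F ⊂ closure ((fun x => x ∘ Fin.castLE hle) '' C') ∧
      closure ((fun x => x ∘ Fin.castLE hle) '' C') \ F ⊆ (fun x => x ∘ Fin.castLE hle) '' C' := by
    have := (geo (K := K)).Z1 (k + n) k hle C'
    rw [← zgTop_fin', ← zgTop_fin'] at this
    exact this hC' hne'
  rw [himg, ← (reHomeo (K := K) ek.symm).image_closure] at key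
  obtain ⟨F, hF, hF1, hF2⟩ := key
  refine ⟨(reHomeo (K := K) ek.symm) ⁻¹' F, hF.preimage (Homeomorph.continuous _), ?_, ?_⟩
  · rw [← (reHomeo (K := K) ek.symm).surjective.image_preimage F] at hF1
    constructor
    · exact (image_subset_image_iff (reHomeo (K := K) ek.symm).injective).1 hF1.1
    · intro h; exact hF1.2 (image_mono h)
  · rintro x ⟨hx1, hx2⟩
    have := hF2 ⟨mem_image_of_mem _ hx1, hx2⟩
    obtain ⟨y, hy, hyx⟩ := this
    rw [(reHomeo (K := K) ek.symm).injective hyx] at hy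
    exact hy

/-- adjoin a coordinate -/
def xc {ι K : Type*} (a : ι → K) (b : K) : Option ι → K := fun o => o.elim b a

@[simp] lemma xc_none {ι K : Type*} (a : ι → K) (b : K) : xc a b none = b := rfl
@[simp] lemma xc_some {ι K : Type*} (a : ι → K) (b : K) (i : ι) : xc a b (some i) = a i := rfl

lemma Z2' (C : Set (Option ι → K)) (hC : IsClosed C) :
    ∃ m : ℕ, ∀ a : ι → K, {b : K | xc a b ∈ C} = univ ∨
      ({b : K | xc a b ∈ C}.Finite ∧ {b : K | xc a b ∈ C}.ncard ≤ m) := by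
  set n := Nat.card ι
  set ei := Finite.equivFin ι
  let φ : (Fin (n+1) → K) → (Option ι → K) := fun z o => o.elim (z (Fin.last n)) (fun i => z (Fin.castSucc (ei i)))
  have hφ : Continuous φ := by
    apply continuous_coord
    rintro (_ | i)
    · exact Or.inl ⟨Fin.last n, fun _ => rfl⟩
    · exact Or.inl ⟨Fin.castSucc (ei i), fun _ => rfl⟩
  have h := (geo (K := K)).Z2 n (φ ⁻¹' C) (by
    have := hC.preimage hφ
    rwa [zgTop_fin] at this)
  obtain ⟨m, hm⟩ := h
  refine ⟨m, fun a => ?_⟩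
  have h2 := hm (a ∘ ei.symm)
  have h3 : ∀ b, φ (Fin.snoc (α := fun _ => K) (a ∘ ei.symm) b) = xc a b := by
    intro b
    funext o
    rcases o with _ | i
    · simp [φ, xc]
    · simp [φ, xc]
  simpa only [mem_preimage, h3] using h2

instance irred1 : IrreducibleSpace (Fin 1 → K) := by
  rw [zgTop_fin]; exact (geo (K := K)).Z2_irred

/-- Krull dimension of a subset. -/
noncomputable def kd {X : Type*} [t : TopologicalSpace X] (S : Set X) : WithBot ℕ∞ :=
  topologicalKrullDim S

lemma kd_homeo {X Y : Type*} [TopologicalSpace X] [TopologicalSpace Y] (e : X ≃ₜ Y) (S : Set X) :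
    kd (e '' S) = kd S :=
  (IsHomeomorph.topologicalKrullDim_eq _ (e.image S).isHomeomorph).symm

lemma homeo_irred {X Y : Type*} [TopologicalSpace X] [TopologicalSpace Y] (e : X ≃ₜ Y) (S : Set X) :
    IsIrreducible (e '' S) ↔ IsIrreducible S := by
  constructor
  · intro h
    have := h.image e.symm e.symm.continuous.continuousOn
    rwa [← image_comp, e.symm_comp_self, image_id] at this
  · intro h
    exact h.image e e.continuous.continuousOn

lemma Z3' (U : Set (ι → K)) (i j : ι) (hU : IsClosed U) (hUi : IsIrreducible U)
    (T : Set (ι → K)) (hT : IsIrredComponentOf inferInstance T (U ∩ {x | x i = x j})) :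
    kd U ≤ kd T + 1 := by
  set e := Finite.equivFin ι
  set h := reHomeo (K := K) e.symm
  rw [← kd_homeo h U, ← kd_homeo h T]
  have := (geo (K := K)).Z3 (Nat.card ι) (h '' U) (e i) (e j)
  rw [← zgTop_fin'] at this
  refine this (h.isClosedMap _ hU) ((homeo_irred _ _).2 hUi) (h '' T) ?_
  have hset : h '' U ∩ {x | x (e i) = x (e j)} = h '' (U ∩ {x | x i = x j}) := by
    ext y
    constructor
    · rintro ⟨⟨x, hx, rfl⟩, hy⟩
      refine ⟨x, ⟨hx, ?_⟩, rfl⟩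
      simpa [h, reHomeo] using hy
    · rintro ⟨x, ⟨hx, hy⟩, rfl⟩
      refine ⟨⟨x, hx, rfl⟩, ?_⟩
      simpa [h, reHomeo] using hy
  rw [hset]
  refine ⟨⟨image_mono hT.1.1, (homeo_irred _ _).2 hT.1.2⟩, ?_⟩
  intro S hS hTS
  have h1 : h.symm '' S ⊆ U ∩ {x | x i = x j} := by
    rintro _ ⟨s, hs, rfl⟩
    obtain ⟨x, hx, rfl⟩ := hS.1 hs
    simpa using hx
  have h2 : T ⊆ h.symm '' S := by
    intro t ht
    exact ⟨h t, hTS ⟨t, ht, rfl⟩, by simp⟩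
  have h3 := hT.2 ⟨h1, (homeo_irred _ _).2 hS.2⟩ h2
  intro s hs
  exact ⟨h.symm s, h3 ⟨s, hs, rfl⟩, by simp⟩

end ZG

set_option linter.all false
open Topology
namespace ZG
open Set

section gen
variable {X Y : Type*} [TopologicalSpace X] [TopologicalSpace Y]

lemma kd_mono_strict {T C : Set X} (hT : IsClosed T) (hTi : IsIrreducible T)
    (hCi : IsIrreducible C) (hTC : T ⊂ C) : kd T + 1 ≤ kd C := by
  have iT : IrreducibleSpace T := isIrreducible_iff_irreducibleSpace.1 hTi
  have iC : IrreducibleSpace C := isIrreducible_iff_irreducibleSpace.1 hCi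
  let tT : TopologicalSpace.IrreducibleCloseds T :=
    ⟨univ, iT.isIrreducible_univ, isClosed_univ⟩
  let tC : TopologicalSpace.IrreducibleCloseds C :=
    ⟨univ, iC.isIrreducible_univ, isClosed_univ⟩
  letI : OrderTop (TopologicalSpace.IrreducibleCloseds T) :=
    { top := tT, le_top := fun a x _ => mem_univ x }
  letI : OrderTop (TopologicalSpace.IrreducibleCloseds C) :=
    { top := tC, le_top := fun a x _ => mem_univ x }
  have hind : IsInducing (Set.inclusion hTC.1) := (IsEmbedding.inclusion hTC.1).isInducing
  have hm := TopologicalSpace.IrreducibleCloseds.map_strictMono_of_isInducing hind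
  unfold kd topologicalKrullDim
  rw [← Order.height_top_eq_krullDim, ← Order.height_top_eq_krullDim]
  have h1 := Order.height_le_height_apply_of_strictMono _ hm tT
  have h2 : (TopologicalSpace.IrreducibleCloseds.map _ hind.continuous tT) < tC := by
    refine lt_of_le_not_ge (fun x _ => mem_univ x) ?_
    intro hle
    obtain ⟨x, hxC, hxT⟩ := exists_of_ssubset hTC
    have h3 : (⟨x, hxC⟩ : C) ∈ closure (range (Set.inclusion hTC.1)) := by
      have := hle (mem_univ (⟨x, hxC⟩ : C))
      have h6 : (⟨x, hxC⟩ : C) ∈ closure (Set.inclusion hTC.1 '' univ) := this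
      rwa [image_univ] at h6
    have h4 : IsClosed (Subtype.val ⁻¹' T : Set C) := hT.preimage continuous_subtype_val
    have h5 : range (Set.inclusion hTC.1) ⊆ (Subtype.val ⁻¹' T : Set C) := by
      rintro _ ⟨y, rfl⟩; exact y.2
    exact hxT (closure_minimal h5 h4 h3)
  have h3 := Order.height_add_one_le h2
  have h4 : Order.height tT + 1 ≤ Order.height tC := le_trans (by gcongr) h3
  exact_mod_cast h4

lemma kd_image {f : X → Y} (hf : IsEmbedding f) (S : Set X) : kd (f '' S) = kd S :=
  (IsHomeomorph.topologicalKrullDim_eq _ (hf.homeomorphImage S).isHomeomorph).symm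

lemma kd_nonneg {S : Set X} (hS : S.Nonempty) : 0 ≤ kd S := by
  obtain ⟨x, hx⟩ := hS
  have : Nonempty (TopologicalSpace.IrreducibleCloseds S) :=
    ⟨⟨closure {⟨x, hx⟩}, isIrreducible_singleton.closure, isClosed_closure⟩⟩
  exact Order.krullDim_nonneg

lemma irred_sub {T : Set X} (hT : IsIrreducible T) (F : Set (Set X)) (hF : F.Finite)
    (hc : ∀ A ∈ F, IsClosed A) (hs : T ⊆ ⋃₀ F) : ∃ A ∈ F, T ⊆ A := by
  lift F to Finset (Set X) using hF
  exact isIrreducible_iff_sUnion_isClosed.1 hT F hc hs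

lemma irred_sub_iUnion {T : Set X} (hT : IsIrreducible T) {α : Type*} [Finite α] (F : α → Set X)
    (hc : ∀ a, IsClosed (F a)) (hs : T ⊆ ⋃ a, F a) : ∃ a, T ⊆ F a := by
  obtain ⟨A, ⟨a, rfl⟩, h⟩ := irred_sub hT (range F) (finite_range F) (by rintro _ ⟨a, rfl⟩; exact hc a)
    (by rwa [sUnion_range])
  exact ⟨a, h⟩

lemma irred_sub_union {T : Set X} (hT : IsIrreducible T) {A B : Set X}
    (hA : IsClosed A) (hB : IsClosed B) (hs : T ⊆ A ∪ B) : T ⊆ A ∨ T ⊆ B :=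
  isPreirreducible_iff_isClosed_union_isClosed.1 hT.2 A B hA hB hs

lemma finite_decomp [TopologicalSpace.NoetherianSpace X] {S : Set X} (hS : IsClosed S) :
    ∃ F : Set (Set X), F.Finite ∧ (∀ t ∈ F, IsClosed t) ∧ (∀ t ∈ F, IsIrreducible t) ∧ S = ⋃₀ F :=
  TopologicalSpace.NoetherianSpace.exists_finite_set_isClosed_irreducible hS

lemma comp_closed {S T : Set X} (hS : IsClosed S) (hT : IsIrredComponentOf inferInstance T S) :
    IsClosed T := by
  have h := hT.2 (y := closure T) ⟨closure_minimal hT.1.1 hS, hT.1.2.closure⟩ subset_closure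
  exact isClosed_of_closure_subset h

lemma exists_comp [TopologicalSpace.NoetherianSpace X] {S : Set X} (hS : IsClosed S) {p : X}
    (hp : p ∈ S) : ∃ T, IsIrredComponentOf inferInstance T S ∧ p ∈ T := by
  obtain ⟨F, hF, hc, hi, rfl⟩ := finite_decomp hS
  have hne : ({A ∈ F | p ∈ A}).Nonempty := by
    obtain ⟨A, hA, hpA⟩ := hp
    exact ⟨A, hA, hpA⟩
  obtain ⟨T, hT⟩ := (hF.subset (sep_subset F (fun A => p ∈ A))).exists_maximal hne
  refine ⟨T, ⟨⟨subset_sUnion_of_mem hT.1.1, hi _ hT.1.1⟩, ?_⟩, hT.1.2⟩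
  rintro S ⟨hS1, hS2⟩ hTS
  obtain ⟨A, hA, hSA⟩ := irred_sub hS2 F hF hc hS1
  exact hSA.trans (hT.2 ⟨hA, hSA (hTS hT.1.2)⟩ (hTS.trans hSA))

end gen

variable {K : Type*} [Field K] [ZG K]
variable {ι κ μ : Type} [Finite ι] [Finite κ] [Finite μ]

instance : T1Space (ι → K) := ⟨fun p => by
  have : ({p} : Set (ι → K)) = ⋂ i, {x | x i = p i} := by
    ext x; simp [funext_iff]
  rw [this]
  exact isClosed_iInter fun i => isClosed_coord i _⟩

/-- product sets -/
def pr {ι κ K : Type*} (A : Set (ι → K)) (B : Set (κ → K)) : Set (ι ⊕ κ → K) :=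
  {z | z ∘ Sum.inl ∈ A ∧ z ∘ Sum.inr ∈ B}

@[simp] lemma elim_mem_pr {ι κ K : Type*} {A : Set (ι → K)} {B : Set (κ → K)} {a : ι → K} {b : κ → K} :
    Sum.elim a b ∈ pr A B ↔ a ∈ A ∧ b ∈ B := by simp [pr]

lemma pr_closed {A : Set (ι → K)} {B : Set (κ → K)} (hA : IsClosed A) (hB : IsClosed B) :
    IsClosed (pr A B) :=
  (hA.preimage (continuous_re _)).inter (hB.preimage (continuous_re _))

lemma cont_elim_left (b : κ → K) : Continuous (fun a : ι → K => Sum.elim a b) :=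
  continuous_coord (by
    rintro (i | k)
    · exact Or.inl ⟨i, fun _ => rfl⟩
    · exact Or.inr ⟨b k, fun _ => rfl⟩)

lemma cont_elim_right (a : ι → K) : Continuous (fun b : κ → K => Sum.elim a b) :=
  continuous_coord (by
    rintro (i | k)
    · exact Or.inr ⟨a i, fun _ => rfl⟩
    · exact Or.inl ⟨k, fun _ => rfl⟩)

lemma pr_irred {A : Set (ι → K)} {B : Set (κ → K)} (hA : IsIrreducible A) (hB : IsIrreducible B) :
    IsIrreducible (pr A B) := by
  constructor
  · obtain ⟨a, ha⟩ := hA.1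
    obtain ⟨b, hb⟩ := hB.1
    exact ⟨Sum.elim a b, by simp [ha, hb]⟩
  · rw [isPreirreducible_iff_isClosed_union_isClosed]
    intro Z1 Z2 h1 h2 hs
    have hcl : ∀ Z : Set (ι ⊕ κ → K), IsClosed Z → IsClosed {a | ∀ b ∈ B, Sum.elim a b ∈ Z} := by
      intro Z hZ
      have : {a : ι → K | ∀ b ∈ B, Sum.elim a b ∈ Z} = ⋂ b ∈ B, (fun a => Sum.elim a b) ⁻¹' Z := by
        ext; simp
      rw [this]
      exact isClosed_biInter fun b _ => hZ.preimage (cont_elim_left b)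
    have key : A ⊆ {a | ∀ b ∈ B, Sum.elim a b ∈ Z1} ∪ {a | ∀ b ∈ B, Sum.elim a b ∈ Z2} := by
      intro a ha
      exact irred_sub_union hB (h1.preimage (cont_elim_right a)) (h2.preimage (cont_elim_right a))
        (fun b hb => hs (by simp [ha, hb]))
    have : ∀ Z : Set (ι ⊕ κ → K), A ⊆ {a | ∀ b ∈ B, Sum.elim a b ∈ Z} → pr A B ⊆ Z := by
      rintro Z h z ⟨hz1, hz2⟩
      have := h hz1 _ hz2
      rwa [Sum.elim_comp_inl_inr] at this
    rcases irred_sub_union hA (hcl _ h1) (hcl _ h2) key with h | h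
    · exact Or.inl (this _ h)
    · exact Or.inr (this _ h)

lemma irred_of_surj {X Y : Type*} [TopologicalSpace X] [TopologicalSpace Y] [h : IrreducibleSpace X]
    (f : X → Y) (hf : Continuous f) (hs : Function.Surjective f) : IrreducibleSpace Y := by
  have h1 := h.isIrreducible_univ.image f hf.continuousOn
  rw [image_univ, hs.range_eq] at h1
  exact { toNonempty := ⟨h1.1.some⟩, isPreirreducible_univ := h1.2 }

instance irred_univ : IrreducibleSpace (ι → K) := by
  have key : ∀ n : ℕ, IrreducibleSpace (Fin n → K) := by
    intro n
    induction n with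
    | zero =>
      have h : IsIrreducible (univ : Set (Fin 0 → K)) := by
        rw [Set.univ_unique]; exact isIrreducible_singleton
      exact { toNonempty := ⟨h.1.some⟩, isPreirreducible_univ := h.2 }
    | succ n ih =>
      have h := pr_irred (A := (univ : Set (Fin n → K))) (B := (univ : Set (Fin 1 → K)))
        ih.isIrreducible_univ irred1.isIrreducible_univ
      have h2 : pr (univ : Set (Fin n → K)) (univ : Set (Fin 1 → K)) = univ := by
        ext; simp [pr]
      rw [h2] at h
      have : IrreducibleSpace (Fin n ⊕ Fin 1 → K) :=
        { toNonempty := ⟨h.1.some⟩, isPreirreducible_univ := h.2 }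
      exact irred_of_surj _ (reHomeo (K := K) finSumFinEquiv.symm).continuous
        (reHomeo (K := K) finSumFinEquiv.symm).surjective
  have := key (Nat.card ι)
  exact irred_of_surj _ (reHomeo (K := K) (Finite.equivFin ι)).continuous
        (reHomeo (K := K) (Finite.equivFin ι)).surjective

lemma iunion_proper {α : Type*} [Finite α] (F : α → Set (ι → K)) (hF : ∀ a, IsClosed (F a))
    (hne : ∀ a, F a ≠ univ) : (⋃ a, F a) ≠ univ := by
  intro h
  obtain ⟨a, ha⟩ := irred_sub_iUnion (irred_univ (K := K) (ι := ι)).isIrreducible_univ F hF h.ge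
  exact hne a (univ_subset_iff.1 ha)

lemma union_proper {A B : Set (ι → K)} (hA : IsClosed A) (hB : IsClosed B)
    (hA' : A ≠ univ) (hB' : B ≠ univ) : A ∪ B ≠ univ := by
  intro h
  rcases irred_sub_union (irred_univ (K := K) (ι := ι)).isIrreducible_univ hA hB h.ge with h | h
  · exact hA' (univ_subset_iff.1 h)
  · exact hB' (univ_subset_iff.1 h)

lemma dense_of_compl {A F : Set (ι → K)} (hF : IsClosed F) (hne : F ≠ univ) (h : ∀ x, x ∉ F → x ∈ A) :
    Dense A := by
  rw [dense_iff_closure_eq]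
  by_contra hcl
  refine union_proper hF isClosed_closure hne hcl ?_
  ext x
  simp only [mem_union, mem_univ, iff_true]
  by_cases hx : x ∈ F
  · exact Or.inl hx
  · exact Or.inr (subset_closure (h x hx))

lemma cont_xc (c : K) : Continuous (fun a : ι → K => xc a c) :=
  continuous_coord (by
    rintro (_ | i)
    · exact Or.inr ⟨c, fun _ => rfl⟩
    · exact Or.inl ⟨i, fun _ => rfl⟩)

lemma xc_fin_or_univ {C : Set (Option ι → K)} (hC : IsClosed C) (a : ι → K) :
    {b : K | xc a b ∈ C} = univ ∨ {b : K | xc a b ∈ C}.Finite := by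
  obtain ⟨m, hm⟩ := Z2' C hC
  exact (hm a).imp id And.left

lemma allfib_closed {C : Set (Option ι → K)} (hC : IsClosed C) : IsClosed {a : ι → K | ∀ b, xc a b ∈ C} := by
  have : {a : ι → K | ∀ b, xc a b ∈ C} = ⋂ b, (fun a => xc a b) ⁻¹' C := by ext; simp
  rw [this]
  exact isClosed_iInter fun b => hC.preimage (cont_xc b)

lemma xc_surj {ι K : Type*} (z : Option ι → K) : ∃ a b, z = xc a b :=
  ⟨fun i => z (some i), z none, by funext o; cases o <;> rfl⟩

lemma allfib_proper {C : Set (Option ι → K)} (hne : C ≠ univ) : {a : ι → K | ∀ b, xc a b ∈ C} ≠ univ := by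
  intro h
  apply hne
  ext z
  obtain ⟨a, b, rfl⟩ := xc_surj z
  have : a ∈ {a : ι → K | ∀ b, xc a b ∈ C} := h ▸ mem_univ a
  simpa using this b

/-- one-parameter version -/
lemma line_fin_or_univ {C : Set (κ → K)} (hC : IsClosed C) (φ : K → (κ → K))
    (hφ : ∀ k, (∀ b, φ b k = b) ∨ ∃ c, ∀ b, φ b k = c) :
    {b : K | φ b ∈ C} = univ ∨ {b : K | φ b ∈ C}.Finite := by
  have : Continuous (fun z : Option Empty → K => φ (z none)) := by
    apply continuous_coord
    intro k
    rcases hφ k with h | ⟨c, h⟩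
    · exact Or.inl ⟨none, fun x => h _⟩
    · exact Or.inr ⟨c, fun x => h _⟩
  exact xc_fin_or_univ (hC.preimage this) Empty.elim

/-- domination -/
def Dom (g : κ → ι) (A : Set (ι → K)) : Prop := Dense ((fun x => x ∘ g) '' A)

lemma Dom.mono {g : κ → ι} {A B : Set (ι → K)} (h : Dom g A) (hAB : A ⊆ B) : Dom g B :=
  Dense.mono (image_mono hAB) h

lemma dom_closure {g : κ → ι} {A : Set (ι → K)} : Dom g (closure A) ↔ Dom g A := by
  constructor
  · intro h
    have := (image_closure_subset_closure_image (continuous_re (K := K) g) (s := A))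
    have h2 := Dense.mono this h
    exact dense_closure.1 h2
  · intro h; exact h.mono subset_closure

lemma re_surj {ι κ K : Type*} [Nonempty K] (g : κ → ι) (hg : Function.Injective g) :
    Function.Surjective (fun x : ι → K => x ∘ g) := by
  intro y
  obtain ⟨c⟩ := ‹Nonempty K›
  refine ⟨Function.extend g y (fun _ => c), ?_⟩
  funext k
  simp [hg.extend_apply]

lemma Dom.comp {g : κ → ι} {A : Set (ι → K)} (h : Dom g A) (s : μ → κ) (hs : Function.Injective s) :
    Dom (g ∘ s) A := by
  have hd : DenseRange (fun x : κ → K => x ∘ s) := (re_surj s hs).denseRange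
  have := hd.dense_image (continuous_re (K := K) s) h
  rw [← image_comp] at this
  exact this

lemma Dom.iUnion {α : Type*} [Finite α] {g : κ → ι} {F : α → Set (ι → K)} (h : Dom g (⋃ a, F a)) :
    ∃ a, Dom g (F a) := by
  by_contra hcon
  push Not at hcon
  have := iunion_proper (fun a => closure ((fun x => x ∘ g) '' F a)) (fun a => isClosed_closure)
    (fun a ha => hcon a (dense_iff_closure_eq.2 ha))
  rw [← closure_iUnion_of_finite, ← image_iUnion] at this
  exact this (dense_iff_closure_eq.1 h)

lemma Dom.sUnion {g : κ → ι} {F : Set (Set (ι → K))} (hF : F.Finite) (h : Dom g (⋃₀ F)) :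
    ∃ A ∈ F, Dom g A := by
  have := hF.to_subtype
  rw [sUnion_eq_iUnion] at h
  obtain ⟨a, ha⟩ := h.iUnion
  exact ⟨a, a.2, ha⟩

lemma Dom.inj {g : κ → ι} {A : Set (ι → K)} (h : Dom g A) : Function.Injective g := by
  intro i j hij
  by_contra hne
  have h1 : closure ((fun x => x ∘ g) '' A) ⊆ {y | y i = y j} := by
    apply closure_minimal _ (isClosed_diag i j)
    rintro _ ⟨x, _, rfl⟩
    simp [hij]
  rw [dense_iff_closure_eq.1 h] at h1
  obtain ⟨a, b, hab⟩ := exists_pair_ne K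
  classical
  have := h1 (mem_univ (fun k => if k = i then a else b))
  simp [Ne.symm hne, hab] at this

lemma Dom.open {g : κ → ι} {A : Set (ι → K)} (hA : IsClosed A) (h : Dom g A) :
    ∃ F : Set (κ → K), IsClosed F ∧ F ≠ univ ∧ ∀ y, y ∉ F → ∃ x ∈ A, x ∘ g = y := by
  have hne : A.Nonempty := by
    have : ((fun x => x ∘ g) '' A).Nonempty := Dense.nonempty h
    exact this.of_image
  obtain ⟨F, h1, h2, h3⟩ := Z1' g A hA hne
  rw [dense_iff_closure_eq.1 h] at h2 h3
  exact ⟨F, h1, h2.ne, fun y hy => h3 ⟨mem_univ _, hy⟩⟩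

lemma dom_equiv {g : κ → ι} {A : Set (ι → K)} (e : μ ≃ κ) : Dom (g ∘ e) A ↔ Dom g A := by
  constructor
  · intro h
    have := h.comp e.symm e.symm.injective
    simpa [Function.comp_assoc] using this
  · intro h; exact h.comp e e.injective

noncomputable def dim (A : Set (ι → K)) : ℕ := sSup {n | ∃ g : Fin n → ι, Dom g A}

lemma dim_bdd (A : Set (ι → K)) : BddAbove {n | ∃ g : Fin n → ι, Dom g A} := by
  refine ⟨Nat.card ι, ?_⟩
  rintro n ⟨g, hg⟩
  have := Nat.card_le_card_of_injective g hg.inj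
  simpa using this

lemma Dom.le_dim {g : κ → ι} {A : Set (ι → K)} (h : Dom g A) : Nat.card κ ≤ dim A :=
  le_csSup (dim_bdd A) ⟨g ∘ (Finite.equivFin κ).symm, (dom_equiv _).2 h⟩

lemma exists_dom {A : Set (ι → K)} (hA : A.Nonempty) : ∃ g : Fin (dim A) → ι, Dom g A := by
  have : ({n | ∃ g : Fin n → ι, Dom g A}).Nonempty := by
    refine ⟨0, Fin.elim0, ?_⟩
    have : (fun x : ι → K => x ∘ (Fin.elim0 : Fin 0 → ι)) '' A = univ := by
      apply Set.Nonempty.eq_univ; exact hA.image _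
    unfold Dom; rw [this]; exact dense_univ
  exact Nat.sSup_mem this (dim_bdd A)

lemma exists_dom' {A : Set (ι → K)} (hA : A.Nonempty) :
    ∃ (n : ℕ) (g : Fin n → ι), dim A = n ∧ Dom g A := by
  obtain ⟨g, hg⟩ := exists_dom hA
  exact ⟨_, g, rfl, hg⟩

lemma exists_dom_le {A : Set (ι → K)} (hA : A.Nonempty) {n : ℕ} (hn : n ≤ dim A) :
    ∃ g : Fin n → ι, Dom g A := by
  obtain ⟨g, hg⟩ := exists_dom hA
  exact ⟨_, hg.comp (Fin.castLE hn) (Fin.castLE_injective hn)⟩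

lemma dim_empty : dim (∅ : Set (ι → K)) = 0 := by
  have : {n | ∃ g : Fin n → ι, Dom g (∅ : Set (ι → K))} = ∅ := by
    ext n
    simp only [mem_ofPred_eq, mem_empty_iff_false, iff_false]
    rintro ⟨g, hg⟩
    have : (((fun x => x ∘ g) '' (∅ : Set (ι → K)))).Nonempty := Dense.nonempty hg
    simp at this
  unfold dim
  rw [this]; simp

lemma dim_mono {A B : Set (ι → K)} (h : A ⊆ B) : dim A ≤ dim B := by
  rcases A.eq_empty_or_nonempty with rfl | hA
  · rw [dim_empty]; exact Nat.zero_le _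
  · obtain ⟨g, hg⟩ := exists_dom hA
    simpa using (hg.mono h).le_dim

lemma dim_closure (A : Set (ι → K)) : dim (closure A) = dim A := by
  unfold dim; simp only [dom_closure]

lemma dim_le_card (A : Set (ι → K)) : dim A ≤ Nat.card ι := by
  rcases A.eq_empty_or_nonempty with rfl | hA
  · rw [dim_empty]; exact Nat.zero_le _
  · obtain ⟨g, hg⟩ := exists_dom hA
    simpa using Nat.card_le_card_of_injective g hg.inj

lemma dim_of_dense {A : Set (ι → K)} (hA : Dense A) : dim A = Nat.card ι := by
  refine le_antisymm (dim_le_card A) ?_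
  have : Dom (id : ι → ι) A := by
    unfold Dom; simpa using hA
  exact this.le_dim

lemma dim_univ : dim (univ : Set (ι → K)) = Nat.card ι := dim_of_dense dense_univ

lemma dense_of_dim {A : Set (ι → K)} (hne : A.Nonempty) (hA : dim A = Nat.card ι) : Dense A := by
  obtain ⟨g, hg⟩ := exists_dom hne
  have hb : Function.Bijective g := by
    cases nonempty_fintype ι
    rw [Fintype.bijective_iff_injective_and_card]
    exact ⟨hg.inj, by simp [hA]⟩
  have := (dom_equiv (Equiv.ofBijective g hb)).1 (show Dom (id ∘ g) A from hg)
  unfold Dom at this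
  simpa using this

lemma exists_comp_dim {S : Set (ι → K)} (hS : IsClosed S) (hne : S.Nonempty) :
    ∃ T ⊆ S, IsClosed T ∧ IsIrreducible T ∧ dim T = dim S := by
  obtain ⟨n, g, hn, hg⟩ := exists_dom' hne
  obtain ⟨F, hF, hc, hi, hSF⟩ := finite_decomp hS
  rw [hSF] at hg
  obtain ⟨A, hA, hdA⟩ := hg.sUnion hF
  have hsub : A ⊆ S := hSF ▸ subset_sUnion_of_mem hA
  refine ⟨A, hsub, hc A hA, hi A hA, le_antisymm (dim_mono hsub) ?_⟩
  rw [hn]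
  simpa using hdA.le_dim

lemma exists_comp_dom {S : Set (ι → K)} (hS : IsClosed S) {g : κ → ι} (hg : Dom g S) :
    ∃ T ⊆ S, IsClosed T ∧ IsIrreducible T ∧ Dom g T := by
  obtain ⟨F, hF, hc, hi, rfl⟩ := finite_decomp hS
  obtain ⟨A, hA, hdA⟩ := hg.sUnion hF
  exact ⟨A, subset_sUnion_of_mem hA, hc A hA, hi A hA, hdA⟩

lemma dim_union (A B : Set (ι → K)) : dim (A ∪ B) = max (dim A) (dim B) := by
  apply le_antisymm
  · rcases (A ∪ B).eq_empty_or_nonempty with h | h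
    · rw [h, dim_empty]; exact Nat.zero_le _
    · obtain ⟨n, g, hn, hg⟩ := exists_dom' h
      rw [union_eq_iUnion] at hg
      obtain ⟨b, hb⟩ := hg.iUnion
      have := hb.le_dim
      rw [Nat.card_fin, ← hn] at this
      cases b
      · exact le_max_of_le_right this
      · exact le_max_of_le_left this
  · exact max_le (dim_mono subset_union_left) (dim_mono subset_union_right)

end ZG

set_option linter.all false
open Topology
namespace ZG
open Set

variable {K : Type*} [Field K] [ZG K]
variable {ι κ μ : Type} [Finite ι] [Finite κ] [Finite μ]

lemma xc_emb (c : K) : IsEmbedding (fun a : ι → K => xc a c) :=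
  Function.LeftInverse.isEmbedding (f := fun z : Option ι → K => z ∘ some) (fun a => rfl)
    (continuous_re _) (cont_xc c)

lemma xc_image (c : K) (U : Set (ι → K)) :
    (fun a : ι → K => xc a c) '' U = {z | z ∘ some ∈ U ∧ z none = c} := by
  ext z
  constructor
  · rintro ⟨a, ha, rfl⟩; exact ⟨ha, rfl⟩
  · rintro ⟨h1, h2⟩
    refine ⟨z ∘ some, h1, ?_⟩
    funext o
    cases o
    · exact h2.symm
    · rfl

lemma Z3c (U : Set (ι → K)) (i : ι) (c : K) (hU : IsClosed U) (hUi : IsIrreducible U)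
    (T : Set (ι → K)) (hT : IsIrredComponentOf inferInstance T (U ∩ {x | x i = c})) :
    kd U ≤ kd T + 1 := by
  rw [← kd_image (xc_emb c) U, ← kd_image (xc_emb c) T]
  have hset : (fun a : ι → K => xc a c) '' U ∩ {x | x (some i) = x none} =
      (fun a : ι → K => xc a c) '' (U ∩ {x | x i = c}) := by
    rw [xc_image, xc_image]
    ext z
    simp only [mem_inter_iff, mem_ofPred_eq, Function.comp]
    constructor
    · rintro ⟨⟨h1, h2⟩, h3⟩; exact ⟨⟨h1, h3.trans h2⟩, h2⟩
    · rintro ⟨⟨h1, h2⟩, h3⟩; exact ⟨⟨h1, h3⟩, h2.trans h3.symm⟩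
  apply Z3' _ (some i) none
  · rw [xc_image]
    exact (hU.preimage (continuous_re _)).inter (isClosed_coord _ _)
  · exact hUi.image _ (cont_xc c).continuousOn
  · rw [hset]
    refine ⟨⟨image_mono hT.1.1, hT.1.2.image _ (cont_xc c).continuousOn⟩, ?_⟩
    rintro S ⟨hS1, hS2⟩ hTS
    have h1 : (fun z : Option ι → K => z ∘ some) '' S ⊆ U ∩ {x | x i = c} := by
      rintro _ ⟨s, hs, rfl⟩
      obtain ⟨x, hx, rfl⟩ := hS1 hs
      exact hx
    have h2 : T ⊆ (fun z : Option ι → K => z ∘ some) '' S := by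
      intro t ht
      exact ⟨xc t c, hTS ⟨t, ht, rfl⟩, rfl⟩
    have h3 := hT.2 ⟨h1, hS2.image _ (continuous_re _).continuousOn⟩ h2
    intro s hs
    obtain ⟨x, hx, rfl⟩ := hS1 hs
    exact ⟨x, h3 ⟨_, hs, rfl⟩, rfl⟩

lemma kd_lower : ∀ (n : ℕ) (C : Set (ι → K)) (g : Fin n → ι), IsClosed C → IsIrreducible C →
    Dom g C → (n : WithBot ℕ∞) ≤ kd C := by
  intro n
  induction n with
  | zero => intro C g _ hi _; simpa using kd_nonneg hi.1
  | succ n ih =>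
    intro C g hC hi hg
    obtain ⟨F, hF, hFne, hFi⟩ := hg.open hC
    obtain ⟨y0, hy0⟩ := (ne_univ_iff_exists_notMem F).1 hFne
    set c := y0 (Fin.last n)
    let ψ : (Fin n → K) → (Fin (n+1) → K) := fun y => Fin.snoc (α := fun _ => K) y c
    have hψ : Continuous ψ := by
      apply continuous_coord
      intro k
      induction k using Fin.lastCases with
      | last => exact Or.inr ⟨c, fun x => by simp [ψ]⟩
      | cast k => exact Or.inl ⟨k, fun x => by simp [ψ]⟩
    have hdom : Dom (g ∘ Fin.castSucc) (C ∩ {x | x (g (Fin.last n)) = c}) := by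
      refine dense_of_compl (hF.preimage hψ) ?_ ?_
      · rw [ne_univ_iff_exists_notMem]
        refine ⟨fun i => y0 i.castSucc, ?_⟩
        have hs : (Fin.snoc (fun i => y0 i.castSucc) (y0 (Fin.last n)) : Fin (n + 1) → K) = y0 :=
          Fin.snoc_init_self y0
        simpa [ψ, c, hs] using hy0
      · intro y hy
        obtain ⟨x, hx, hxy⟩ := hFi _ hy
        refine ⟨x, ⟨hx, ?_⟩, ?_⟩
        · have := congrFun hxy (Fin.last n)
          simpa [ψ] using this
        · funext k
          have := congrFun hxy (Fin.castSucc k)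
          simpa [ψ] using this
    obtain ⟨T, hTs, hTc, hTi, hTd⟩ := exists_comp_dom (hC.inter (isClosed_coord _ _)) hdom
    have h1 := ih T _ hTc hTi hTd
    have h2 : T ⊂ C := by
      refine ⟨hTs.trans inter_subset_left, ?_⟩
      intro hCT
      have h3 : closure ((fun x => x ∘ g) '' C) ⊆ {y | y (Fin.last n) = c} := by
        apply closure_minimal _ (isClosed_coord _ _)
        rintro _ ⟨x, hx, rfl⟩
        exact (hTs (hCT hx)).2
      rw [dense_iff_closure_eq.1 hg] at h3
      have := h3 (mem_univ (fun _ => c + 1))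
      simp at this
    calc ((n + 1 : ℕ) : WithBot ℕ∞) = (n : WithBot ℕ∞) + 1 := by push_cast; rfl
      _ ≤ kd T + 1 := by gcongr
      _ ≤ kd C := kd_mono_strict hTc hTi hi h2

lemma kd_cut : ∀ (n : ℕ) (C : Set (ι → K)) (g : Fin n → ι) (p : ι → K), IsClosed C →
    IsIrreducible C → p ∈ C → (C ∩ {x | x ∘ g = p ∘ g}).Finite → kd C ≤ (n : WithBot ℕ∞) := by
  intro n
  induction n with
  | zero =>
    intro C g p hC hi hp hf
    have : C ∩ {x | x ∘ g = p ∘ g} = C := by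
      apply inter_eq_left.2
      intro x _
      funext k; exact k.elim0
    rw [this] at hf
    have := hf.to_subtype
    have h0 := topologicalKrullDim_zero_of_discreteTopology C
    exact_mod_cast h0
  | succ n ih =>
    intro C g p hC hi hp hf
    obtain ⟨T, hT, hpT⟩ := exists_comp (hC.inter (isClosed_coord (g (Fin.last n)) (p (g (Fin.last n)))))
      (p := p) ⟨hp, rfl⟩
    have hTc := comp_closed (hC.inter (isClosed_coord _ _)) hT
    have h1 := ih T (g ∘ Fin.castSucc) p hTc hT.1.2 hpT (hf.subset (by
      rintro x ⟨hx, hx2⟩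
      have := hT.1.1 hx
      refine ⟨this.1, ?_⟩
      funext k
      induction k using Fin.lastCases with
      | last => exact this.2
      | cast k => exact congrFun hx2 k))
    calc kd C ≤ kd T + 1 := Z3c C _ _ hC hi T hT
      _ ≤ (n : WithBot ℕ∞) + 1 := by gcongr
      _ = ((n + 1 : ℕ) : WithBot ℕ∞) := by push_cast; rfl

/-- generic finiteness -/
lemma generic_fin {A : Set (ι → K)} (hA : IsClosed A) {g : κ → ι} (hg : Dom g A)
    (hd : dim A ≤ Nat.card κ) :
    ∃ N : Set (κ → K), IsClosed N ∧ N ≠ univ ∧ ∀ y, y ∉ N →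
      (A ∩ {x | x ∘ g = y}).Nonempty ∧ (A ∩ {x | x ∘ g = y}).Finite := by
  obtain ⟨F, hF, hFne, hFi⟩ := hg.open hA
  let gi : ι → Option κ → ι := fun i o => o.elim i g
  let E : ι → Set (Option κ → K) := fun i => closure ((fun x => x ∘ gi i) '' A)
  have hE : ∀ i, E i ≠ univ := by
    intro i hi
    have : Dom (gi i) A := dense_iff_closure_eq.2 hi
    have := this.le_dim
    rw [Finite.card_option] at this
    omega
  refine ⟨F ∪ ⋃ i, {a | ∀ b, xc a b ∈ E i}, hF.union (isClosed_iUnion_of_finite fun i =>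
    allfib_closed isClosed_closure), union_proper hF (isClosed_iUnion_of_finite fun i =>
    allfib_closed isClosed_closure) hFne (iunion_proper _ (fun i => allfib_closed isClosed_closure)
      fun i => allfib_proper (hE i)), ?_⟩
  intro y hy
  rw [mem_union, not_or] at hy
  obtain ⟨hy1, hy2⟩ := hy
  obtain ⟨x, hx, hxy⟩ := hFi y hy1
  refine ⟨⟨x, hx, hxy⟩, ?_⟩
  have hfin : ∀ i, {b | xc y b ∈ E i}.Finite := by
    intro i
    rcases xc_fin_or_univ (isClosed_closure : IsClosed (E i)) y with h | h
    · exfalso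
      apply hy2
      rw [mem_iUnion]
      exact ⟨i, fun b => by
        have : b ∈ {b | xc y b ∈ E i} := h ▸ mem_univ b
        exact this⟩
    · exact h
  refine (Set.Finite.pi' hfin).subset ?_
  rintro x ⟨hx, hxy⟩ i
  apply subset_closure
  refine ⟨x, hx, ?_⟩
  funext o
  cases o
  · rfl
  · exact congrFun hxy _

lemma kd_eq_dim {C : Set (ι → K)} (hC : IsClosed C) (hi : IsIrreducible C) : kd C = (dim C : WithBot ℕ∞) := by
  obtain ⟨g, hg⟩ := exists_dom hi.1
  apply le_antisymm
  · obtain ⟨N, hN, hNe, h⟩ := generic_fin hC hg (by simp)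
    obtain ⟨y, hy⟩ := (ne_univ_iff_exists_notMem N).1 hNe
    obtain ⟨⟨p, hp1, hp2⟩, hf⟩ := h y hy
    apply kd_cut _ C g p hC hi hp1
    convert hf using 5
    exact hp2
  · exact kd_lower _ C g hC hi hg

lemma dim_cut {C : Set (ι → K)} (hC : IsClosed C) (hi : IsIrreducible C) (g : κ → ι) {p : ι → K}
    (hp : p ∈ C) (hf : (C ∩ {x | x ∘ g = p ∘ g}).Finite) : dim C ≤ Nat.card κ := by
  have := kd_cut (Nat.card κ) C (g ∘ (Finite.equivFin κ).symm) p hC hi hp (hf.subset (by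
    rintro x ⟨hx, hx2⟩
    refine ⟨hx, ?_⟩
    funext k
    simpa using congrFun hx2 (Finite.equivFin κ k)))
  rw [kd_eq_dim hC hi] at this
  exact_mod_cast this

lemma eq_of_dim {A T : Set (ι → K)} (hA : IsClosed A) (hne : A.Nonempty) (hT : IsClosed T)
    (hTi : IsIrreducible T) (hAT : A ⊆ T) (hd : dim T ≤ dim A) : A = T := by
  obtain ⟨A', hA's, hA'c, hA'i, hA'd⟩ := exists_comp_dim hA hne
  by_contra hne'
  have h1 : A' ⊂ T := by
    refine ⟨hA's.trans hAT, fun h => hne' (hAT.antisymm (h.trans hA's))⟩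
  have := kd_mono_strict hA'c hA'i hTi h1
  rw [kd_eq_dim hA'c hA'i, kd_eq_dim hT hTi] at this
  have h2 : dim A' + 1 ≤ dim T := by exact_mod_cast this
  omega

lemma dim_lt {A T : Set (ι → K)} (hA : IsClosed A) (hT : IsClosed T)
    (hTi : IsIrreducible T) (hAT : A ⊂ T) (hne : A.Nonempty) : dim A < dim T := by
  by_contra h
  exact hAT.ne (eq_of_dim hA hne hT hTi hAT.1 (by omega))

lemma z3_diag {T : Set (ι → K)} (hT : IsClosed T) (hTi : IsIrreducible T) {p : ι → K} (hp : p ∈ T)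
    (i j : ι) (hij : p i = p j) : ∃ T' ⊆ T, IsClosed T' ∧ IsIrreducible T' ∧ p ∈ T' ∧
      (∀ x ∈ T', x i = x j) ∧ dim T ≤ dim T' + 1 := by
  obtain ⟨T', hT', hpT'⟩ := exists_comp (hT.inter (isClosed_diag i j)) (p := p) ⟨hp, hij⟩
  have hc := comp_closed (hT.inter (isClosed_diag i j)) hT'
  have := Z3' T i j hT hTi T' hT'
  rw [kd_eq_dim hT hTi, kd_eq_dim hc hT'.1.2] at this
  exact ⟨T', fun x hx => (hT'.1.1 hx).1, hc, hT'.1.2, hpT', fun x hx => (hT'.1.1 hx).2, by exact_mod_cast this⟩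

lemma z3_const {T : Set (ι → K)} (hT : IsClosed T) (hTi : IsIrreducible T) {p : ι → K} (hp : p ∈ T)
    (i : ι) (c : K) (hij : p i = c) : ∃ T' ⊆ T, IsClosed T' ∧ IsIrreducible T' ∧ p ∈ T' ∧
      (∀ x ∈ T', x i = c) ∧ dim T ≤ dim T' + 1 := by
  obtain ⟨T', hT', hpT'⟩ := exists_comp (hT.inter (isClosed_coord i c)) (p := p) ⟨hp, hij⟩
  have hc := comp_closed (hT.inter (isClosed_coord i c)) hT'
  have := Z3c T i c hT hTi T' hT'
  rw [kd_eq_dim hT hTi, kd_eq_dim hc hT'.1.2] at this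
  exact ⟨T', fun x hx => (hT'.1.1 hx).1, hc, hT'.1.2, hpT', fun x hx => (hT'.1.1 hx).2, by exact_mod_cast this⟩

/-- coordinate projections do not raise dimension -/
lemma dim_re_le (A : Set (ι → K)) (g : κ → ι) : dim ((fun x => x ∘ g) '' A) ≤ dim A := by
  rcases A.eq_empty_or_nonempty with rfl | hA
  · rw [image_empty, dim_empty]; exact Nat.zero_le _
  obtain ⟨n, h, hn, hh⟩ := exists_dom' (hA.image (fun x => x ∘ g))
  rw [hn]
  have : Dom (g ∘ h) A := by
    unfold Dom at hh ⊢
    rwa [← image_comp] at hh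
  simpa using this.le_dim

lemma dim_fib {A : Set (ι → K)} (hA : IsClosed A) (g : κ → ι)
    (hf : ∀ y, (A ∩ {x | x ∘ g = y}).Finite) : dim A ≤ dim ((fun x => x ∘ g) '' A) := by
  rcases A.eq_empty_or_nonempty with rfl | hne
  · rw [dim_empty]; exact Nat.zero_le _
  obtain ⟨T, hTs, hTc, hTi, hTd⟩ := exists_comp_dim hA hne
  rw [← hTd]
  refine le_trans ?_ (dim_mono (image_mono hTs))
  rw [← dim_closure ((fun x => x ∘ g) '' T)]
  set B := closure ((fun x => x ∘ g) '' T)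
  have hBne : B.Nonempty := (hTi.1.image _).mono subset_closure
  obtain ⟨n, h, hn, hh⟩ := exists_dom' hBne
  rw [hn]
  obtain ⟨N, hN, hNe, hgen⟩ := generic_fin isClosed_closure hh (by rw [Nat.card_fin]; exact hn.le)
  have hh2 : Dom (g ∘ h) T := by
    have := dom_closure.1 hh
    unfold Dom at this ⊢
    rwa [← image_comp] at this
  obtain ⟨N', hN', hNe', hN'i⟩ := hh2.open hTc
  obtain ⟨y, hy⟩ := (ne_univ_iff_exists_notMem _).1 (union_proper hN hN' hNe hNe')
  rw [mem_union, not_or] at hy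
  obtain ⟨p, hp, hpy⟩ := hN'i y hy.2
  have := dim_cut hTc hTi (g ∘ h) hp ?_
  · simpa using this
  · have hfin := (hgen y hy.1).2
    refine (hfin.biUnion (t := fun z => A ∩ {x | x ∘ g = z}) (fun z _ => hf z)).subset ?_
    rintro x ⟨hx, hx2⟩
    simp only [mem_iUnion]
    refine ⟨x ∘ g, ⟨subset_closure ⟨x, hx, rfl⟩, ?_⟩, hTs hx, rfl⟩
    rw [mem_ofPred_eq] at hx2
    change (x ∘ g ∘ h) = y
    rw [hx2, hpy]

lemma dim_re_inj {A : Set (ι → K)} (hA : IsClosed A) (g : κ → ι)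
    (hf : ∀ x ∈ A, ∀ x' ∈ A, x ∘ g = x' ∘ g → x = x') : dim ((fun x => x ∘ g) '' A) = dim A := by
  refine le_antisymm (dim_re_le A g) (dim_fib hA g ?_)
  intro y
  apply Set.Subsingleton.finite
  rintro x ⟨hx, hxy⟩ x' ⟨hx', hxy'⟩
  exact hf x hx x' hx' (hxy.trans hxy'.symm)

lemma finite_of_dim_zero {A : Set (ι → K)} (hA : IsClosed A) (hd : dim A = 0) : A.Finite := by
  rcases A.eq_empty_or_nonempty with rfl | hne
  · exact finite_empty
  obtain ⟨g, hg⟩ := exists_dom hne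
  obtain ⟨N, hN, hNe, h⟩ := generic_fin hA hg (by simp)
  obtain ⟨y, hy⟩ := (ne_univ_iff_exists_notMem N).1 hNe
  refine (h y hy).2.subset ?_
  intro x hx
  refine ⟨hx, ?_⟩
  have : IsEmpty (Fin (dim A)) := by rw [hd]; infer_instance
  exact Subsingleton.elim _ _

lemma irred_finite {T : Set (ι → K)} (hi : IsIrreducible T) (hf : T.Finite) :
    ∃ p, T = {p} := by
  obtain ⟨p, hp⟩ := hi.1
  refine ⟨p, ?_⟩
  have h := irred_sub hi ((fun x => {x}) '' T) (hf.image _) (by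
    rintro _ ⟨x, _, rfl⟩; exact isClosed_singleton) (fun x hx => ⟨{x}, ⟨x, hx, rfl⟩, rfl⟩)
  obtain ⟨_, ⟨x, hx, rfl⟩, hs⟩ := h
  have : p = x := hs hp
  subst this
  exact hs.antisymm (by simpa using hp)

lemma dim_finite {A : Set (ι → K)} (hf : A.Finite) : dim A = 0 := by
  rcases A.eq_empty_or_nonempty with rfl | hne
  · exact dim_empty
  obtain ⟨T, hTs, hTc, hTi, hTd⟩ := exists_comp_dim hf.isClosed hne
  rw [← hTd]
  have := dim_cut hTc hTi (Empty.elim : Empty → ι) hTi.1.some_mem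
    ((hf.subset hTs).subset inter_subset_left)
  simpa using this

lemma dim_pr_ge {A : Set (ι → K)} {B : Set (κ → K)} (hA : A.Nonempty) (hB : B.Nonempty) :
    dim A + dim B ≤ dim (pr A B) := by
  obtain ⟨g, hg⟩ := exists_dom hA
  obtain ⟨h, hh⟩ := exists_dom hB
  have : Dom (Sum.map g h) (pr A B) := by
    unfold Dom
    have himg : (fun x => x ∘ Sum.map g h) '' pr A B =
        pr ((fun x => x ∘ g) '' A) ((fun x => x ∘ h) '' B) := by
      ext z
      constructor
      · rintro ⟨x, ⟨h1, h2⟩, rfl⟩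
        exact ⟨⟨_, h1, rfl⟩, ⟨_, h2, rfl⟩⟩
      · rintro ⟨⟨a, ha, hza⟩, ⟨b, hb, hzb⟩⟩
        refine ⟨Sum.elim a b, by simp [ha, hb], ?_⟩
        funext o
        rcases o with k | k
        · exact congrFun hza k
        · exact congrFun hzb k
    rw [himg, dense_iff_closure_eq]
    set P := (fun x => x ∘ g) '' A
    set Q := (fun x => x ∘ h) '' B
    have h1 : ∀ a ∈ P, ∀ b, Sum.elim a b ∈ closure (pr P Q) := by
      intro a ha b
      have hc : IsClosed ((fun b => Sum.elim a b) ⁻¹' (closure (pr P Q))) :=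
        isClosed_closure.preimage (cont_elim_right a)
      have : closure Q ⊆ ((fun b => Sum.elim a b) ⁻¹' (closure (pr P Q))) :=
        closure_minimal (fun b hb => subset_closure (by simp [ha, hb])) hc
      exact this (by rw [dense_iff_closure_eq.1 hh]; exact mem_univ b)
    have h2 : ∀ a b, Sum.elim a b ∈ closure (pr P Q) := by
      intro a b
      have hc : IsClosed ((fun a => Sum.elim a b) ⁻¹' (closure (pr P Q))) :=
        isClosed_closure.preimage (cont_elim_left b)
      have : closure P ⊆ ((fun a => Sum.elim a b) ⁻¹' (closure (pr P Q))) :=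
        closure_minimal (fun a ha => h1 a ha b) hc
      exact this (by rw [dense_iff_closure_eq.1 hg]; exact mem_univ a)
    ext z
    simp only [mem_univ, iff_true]
    have := h2 (z ∘ Sum.inl) (z ∘ Sum.inr)
    rwa [Sum.elim_comp_inl_inr] at this
  simpa using this.le_dim

lemma pr_mono {ι κ K : Type*} {A A' : Set (ι → K)} {B B' : Set (κ → K)} (hA : A ⊆ A') (hB : B ⊆ B') :
    pr A B ⊆ pr A' B' := fun _ hz => ⟨hA hz.1, hB hz.2⟩

lemma dim_pr_le_aux {A : Set (ι → K)} {B : Set (κ → K)} (hA : IsClosed A) (hB : IsClosed B)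
    (hAi : IsIrreducible A) (hBi : IsIrreducible B) :
    dim (pr A B) ≤ dim A + dim B := by
  obtain ⟨g, hg⟩ := exists_dom hAi.1
  obtain ⟨h, hh⟩ := exists_dom hBi.1
  obtain ⟨N, hN, hNe, hgen⟩ := generic_fin hA hg (by simp)
  obtain ⟨y, hy⟩ := (ne_univ_iff_exists_notMem N).1 hNe
  obtain ⟨N', hN', hNe', hgen'⟩ := generic_fin hB hh (by simp)
  obtain ⟨y', hy'⟩ := (ne_univ_iff_exists_notMem N').1 hNe'
  obtain ⟨⟨p, hp1, hp2⟩, hf⟩ := hgen y hy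
  obtain ⟨⟨p', hp1', hp2'⟩, hf'⟩ := hgen' y' hy'
  have := dim_cut (pr_closed hA hB) (pr_irred hAi hBi) (Sum.map g h) (p := Sum.elim p p')
    (by simp [hp1, hp1']) ?_
  · simpa using this
  · refine ((hf.prod hf').image (fun q => Sum.elim q.1 q.2)).subset ?_
    rintro z ⟨⟨hz1, hz2⟩, hz3⟩
    refine ⟨(z ∘ Sum.inl, z ∘ Sum.inr), ⟨⟨hz1, ?_⟩, ⟨hz2, ?_⟩⟩, by simp⟩
    · funext k
      have := congrFun hz3 (Sum.inl k)
      have h2 := congrFun hp2 k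
      simp only [Function.comp, Sum.map_inl, Sum.elim_inl] at this h2 ⊢
      rw [this, h2]
    · funext k
      have := congrFun hz3 (Sum.inr k)
      have h2 := congrFun hp2' k
      simp only [Function.comp, Sum.map_inr, Sum.elim_inr] at this h2 ⊢
      rw [this, h2]

lemma dim_pr_le (A : Set (ι → K)) (B : Set (κ → K)) : dim (pr A B) ≤ dim A + dim B := by
  rcases (pr A B).eq_empty_or_nonempty with h | h
  · rw [h, dim_empty]; exact Nat.zero_le _
  obtain ⟨FA, hFA, hFAc, hFAi, hA⟩ := finite_decomp (isClosed_closure (s := A))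
  obtain ⟨FB, hFB, hFBc, hFBi, hB⟩ := finite_decomp (isClosed_closure (s := B))
  obtain ⟨n, g, hn, hg⟩ := exists_dom' h
  have hsub : pr A B ⊆ ⋃₀ ((fun q : Set (ι → K) × Set (κ → K) => pr q.1 q.2) '' (FA ×ˢ FB)) := by
    rintro z ⟨hz1, hz2⟩
    have h1 := hA ▸ subset_closure hz1
    have h2 := hB ▸ subset_closure hz2
    obtain ⟨P, hP, hzP⟩ := h1
    obtain ⟨Q, hQ, hzQ⟩ := h2
    exact ⟨_, ⟨(P, Q), ⟨hP, hQ⟩, rfl⟩, hzP, hzQ⟩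
  obtain ⟨_, ⟨⟨P, Q⟩, ⟨hP, hQ⟩, rfl⟩, hd⟩ := (hg.mono hsub).sUnion ((hFA.prod hFB).image _)
  have h1 := hd.le_dim
  have h2 := dim_pr_le_aux (hFAc P hP) (hFBc Q hQ) (hFAi P hP) (hFBi Q hQ)
  have h3 : dim P ≤ dim A := by
    rw [← dim_closure A]; exact dim_mono (hA ▸ subset_sUnion_of_mem hP)
  have h4 : dim Q ≤ dim B := by
    rw [← dim_closure B]; exact dim_mono (hB ▸ subset_sUnion_of_mem hQ)
  simp only [Nat.card_fin] at h1
  omega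

lemma dim_pr {A : Set (ι → K)} {B : Set (κ → K)} (hA : A.Nonempty) (hB : B.Nonempty) :
    dim (pr A B) = dim A + dim B := le_antisymm (dim_pr_le A B) (dim_pr_ge hA hB)

end ZG

set_option linter.all false
open Topology
namespace ZG
open Set

variable {K : Type*} [Field K] [ZG K]
variable {ι κ μ : Type} [Finite ι] [Finite κ] [Finite μ]

lemma z3_diags (L : List (ι × ι)) : ∀ {T : Set (ι → K)} (hT : IsClosed T) (hTi : IsIrreducible T)
    {p : ι → K} (hp : p ∈ T) (hij : ∀ q ∈ L, p q.1 = p q.2),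
    ∃ T' ⊆ T, IsClosed T' ∧ IsIrreducible T' ∧ p ∈ T' ∧
      (∀ q ∈ L, ∀ x ∈ T', x q.1 = x q.2) ∧ dim T ≤ dim T' + L.length := by
  induction L with
  | nil => intro T hT hTi p hp _; exact ⟨T, Subset.rfl, hT, hTi, hp, by simp, by simp⟩
  | cons q L ih =>
    intro T hT hTi p hp h
    obtain ⟨T1, h1, h2, h3, h4, h5, h6⟩ := z3_diag hT hTi hp q.1 q.2 (h q (by simp))
    obtain ⟨T2, g1, g2, g3, g4, g5, g6⟩ := ih h2 h3 h4 (fun q hq => h q (by simp [hq]))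
    refine ⟨T2, g1.trans h1, g2, g3, g4, ?_, ?_⟩
    · intro q' hq' x hx
      rcases List.mem_cons.1 hq' with rfl | hq'
      · exact h5 x (g1 hx)
      · exact g5 q' hq' x hx
    · simp only [List.length_cons]; omega

lemma cl_image_irred {T : Set (ι → K)} (hT : IsIrreducible T) (g : κ → ι) :
    IsIrreducible (closure ((fun x => x ∘ g) '' T)) :=
  (hT.image _ (continuous_re g).continuousOn).closure

lemma dom_of_dim {A : Set (ι → K)} (hA : IsClosed A) (hne : A.Nonempty) (g : κ → ι)
    (hinj : ∀ x ∈ A, ∀ x' ∈ A, x ∘ g = x' ∘ g → x = x') (hd : Nat.card κ ≤ dim A) : Dom g A := by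
  apply dense_of_dim (hne.image _)
  apply le_antisymm (dim_le_card _)
  rw [dim_re_inj hA g hinj]; exact hd

lemma uniq_comp {V A B : Set (ι → K)} (g : κ → ι)
    (hinj : ∀ x ∈ V, ∀ x' ∈ V, x ∘ g = x' ∘ g → x = x')
    (hA : IsClosed A) (hAi : IsIrreducible A) (hAV : A ⊆ V) (hAd : Nat.card κ ≤ dim A)
    (hB : IsClosed B) (hBi : IsIrreducible B) (hBV : B ⊆ V) (hBd : Nat.card κ ≤ dim B) : A = B := by
  have hdA : Dom g A := dom_of_dim hA hAi.1 g (fun x hx x' hx' => hinj x (hAV hx) x' (hAV hx')) hAd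
  have hdB : Dom g B := dom_of_dim hB hBi.1 g (fun x hx x' hx' => hinj x (hBV hx) x' (hBV hx')) hBd
  obtain ⟨F, hF, hFn, hFi⟩ := hdA.open hA
  obtain ⟨F', hF', hFn', hFi'⟩ := hdB.open hB
  have hd : Dom g (A ∩ B) := by
    refine dense_of_compl (hF.union hF') (union_proper hF hF' hFn hFn') ?_
    intro y hy
    rw [mem_union, not_or] at hy
    obtain ⟨x, hx, hxy⟩ := hFi y hy.1
    obtain ⟨x', hx', hxy'⟩ := hFi' y hy.2
    have := hinj x (hAV hx) x' (hBV hx') (hxy.trans hxy'.symm)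
    exact ⟨x, ⟨hx, this ▸ hx'⟩, hxy⟩
  have hne : (A ∩ B).Nonempty := by
    have : ((fun x => x ∘ g) '' (A ∩ B)).Nonempty := Dense.nonempty hd
    exact this.of_image
  have hle := hd.le_dim
  have hda : dim A ≤ Nat.card κ := by
    rw [← dim_re_inj hA g (fun x hx x' hx' => hinj x (hAV hx) x' (hAV hx'))]; exact dim_le_card _
  have hdb : dim B ≤ Nat.card κ := by
    rw [← dim_re_inj hB g (fun x hx x' hx' => hinj x (hBV hx) x' (hBV hx'))]; exact dim_le_card _
  have e1 := eq_of_dim (hA.inter hB) hne hA hAi inter_subset_left (hda.trans hle)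
  have e2 := eq_of_dim (hA.inter hB) hne hB hBi inter_subset_right (hdb.trans hle)
  exact e1.symm.trans e2

/-- removing one coordinate -/
lemma dim_remove {A : Set (ι → K)} (hA : IsClosed A) (g : κ → ι) (i : ι)
    (hinj : ∀ x ∈ A, ∀ x' ∈ A, x ∘ g = x' ∘ g → x i = x' i → x = x') :
    dim A ≤ dim ((fun x => x ∘ g) '' A) + 1 := by
  have h1 := dim_re_inj hA (Sum.elim g (fun _ : Unit => i)) (by
    intro x hx x' hx' h
    refine hinj x hx x' hx' ?_ ?_
    · funext k; exact congrFun h (Sum.inl k)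
    · exact congrFun h (Sum.inr ()))
  rw [← h1]
  have h2 : (fun x => x ∘ (Sum.elim g (fun _ : Unit => i))) '' A ⊆
      pr ((fun x => x ∘ g) '' A) univ := by
    rintro _ ⟨x, hx, rfl⟩
    exact ⟨⟨x, hx, rfl⟩, mem_univ _⟩
  have h3 := (dim_mono h2).trans (dim_pr_le _ _)
  rw [dim_univ] at h3
  simpa using h3

lemma proper_unit_finite {F : Set (Unit → K)} (hF : IsClosed F) (hne : F ≠ univ) :
    {u : K | (fun _ => u) ∈ F}.Finite := by
  rcases line_fin_or_univ hF (fun u _ => u) (fun k => Or.inl fun b => rfl) with h | h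
  · exfalso; apply hne
    ext x
    have : x () ∈ {u : K | (fun _ => u) ∈ F} := h ▸ mem_univ _
    simpa using this
  · exact h

lemma dom_unit_cofinite {A : Set (ι → K)} (hA : IsClosed A) (i : ι) (h : Dom (fun _ : Unit => i) A) :
    {u : K | ¬ ∃ x ∈ A, x i = u}.Finite := by
  obtain ⟨F, hF, hFn, hFi⟩ := h.open hA
  refine (proper_unit_finite hF hFn).subset ?_
  intro u hu
  by_contra hc
  obtain ⟨x, hx, hxy⟩ := hFi _ hc
  exact hu ⟨x, hx, congrFun hxy ()⟩

lemma closed_all_of_generic {F C : Set (ι → K)} (hF : IsClosed F) (hFn : F ≠ univ) (hC : IsClosed C)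
    (h : ∀ x, x ∉ F → x ∈ C) : C = univ := by
  have := dense_iff_closure_eq.1 (dense_of_compl hF hFn h)
  rwa [hC.closure_eq] at this

section add
variable [IsAlgClosed K]

/-- dominant component -/
lemma exists_dom_comp {V : Set (ι → K)} (hV : IsClosed V) (g : κ → ι) (hg : ∀ y, ∃ x ∈ V, x ∘ g = y) :
    ∃ V1 ⊆ V, IsClosed V1 ∧ IsIrreducible V1 ∧ Dom g V1 := by
  apply exists_comp_dom hV
  have : (fun x => x ∘ g) '' V = univ := by
    ext y; simpa using hg y
  unfold Dom; rw [this]; exact dense_univ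

lemma add_graph_irred : IsIrreducible {x : Fin 3 → K | x 2 = x 0 + x 1} := by
  set G : Set (Fin 3 → K) := {x | x 2 = x 0 + x 1} with hGdef
  set V : Set (Fin 4 → K) := {x | x 0 + x 1 = x 2 + x 3} with hVdef
  have hG : IsClosed G := by
    have := isClosed_alg (K := K) (MvPolynomial.X 2 - (MvPolynomial.X 0 + MvPolynomial.X 1) : MvPolynomial (Fin 3) K)
    simpa [sub_eq_zero] using this
  have hV : IsClosed V := by
    have := isClosed_alg (K := K) ((MvPolynomial.X 0 + MvPolynomial.X 1) - (MvPolynomial.X 2 + MvPolynomial.X 3) : MvPolynomial (Fin 4) K)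
    simpa [sub_eq_zero] using this
  have hGinj : ∀ x ∈ G, ∀ x' ∈ G, x ∘ (![0, 1] : Fin 2 → Fin 3) = x' ∘ (![0, 1] : Fin 2 → Fin 3) → x = x' := by
    intro x hx x' hx' h
    have h0 : x 0 = x' 0 := congrFun h 0
    have h1 : x 1 = x' 1 := congrFun h 1
    have h2 : x 2 = x' 2 := by rw [show x 2 = x 0 + x 1 from hx, show x' 2 = x' 0 + x' 1 from hx', h0, h1]
    funext k; fin_cases k <;> assumption
  have hVinj : ∀ x ∈ V, ∀ x' ∈ V, x ∘ (![0, 1, 2] : Fin 3 → Fin 4) = x' ∘ (![0, 1, 2] : Fin 3 → Fin 4) → x = x' := by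
    intro x hx x' hx' h
    have h0 : x 0 = x' 0 := congrFun h 0
    have h1 : x 1 = x' 1 := congrFun h 1
    have h2 : x 2 = x' 2 := congrFun h 2
    have h3 : x 3 = x' 3 := by
      have e1 : x 0 + x 1 = x 2 + x 3 := hx
      have e2 : x' 0 + x' 1 = x' 2 + x' 3 := hx'
      rw [h0, h1, h2, e2] at e1
      exact (add_left_cancel e1).symm
    funext k; fin_cases k <;> assumption
  obtain ⟨G1, hG1s, hG1c, hG1i, hG1d⟩ := exists_dom_comp hG (![0, 1] : Fin 2 → Fin 3)
    (fun y => ⟨![y 0, y 1, y 0 + y 1], by simp [G], by funext k; fin_cases k <;> rfl⟩)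
  obtain ⟨V1, hV1s, hV1c, hV1i, hV1d⟩ := exists_dom_comp hV (![0, 1, 2] : Fin 3 → Fin 4)
    (fun y => ⟨![y 0, y 1, y 2, y 0 + y 1 - y 2], by simp [V], by funext k; fin_cases k <;> rfl⟩)
  have hG1dim : 2 ≤ dim G1 := by simpa using hG1d.le_dim
  have hV1dim : 3 ≤ dim V1 := by simpa using hV1d.le_dim
  -- key criterion
  have crit : ∀ A : Set (Fin 4 → K), IsIrreducible A → A ⊆ V → 3 ≤ dim A → A ⊆ V1 := by
    intro A hAi hAV hAd
    have := uniq_comp _ hVinj isClosed_closure hAi.closure (closure_minimal hAV hV)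
      (by rw [dim_closure]; simpa using hAd) hV1c hV1i hV1s (by simpa using hV1dim)
    rw [← this]; exact subset_closure
  -- (a)
  have key : ∀ σ : Fin 4 → Fin 3 ⊕ Fin 3, (σ = ![Sum.inl 0, Sum.inl 1, Sum.inr 0, Sum.inr 1] ∨
      σ = ![Sum.inl 0, Sum.inl 1, Sum.inr 1, Sum.inr 0]) → ∀ z ∈ G1, (Sum.elim z z) ∘ σ ∈ V1 := by
    intro σ hσ z hz
    obtain ⟨T, hTs, hTc, hTi, hTp, hTe, hTd⟩ := z3_diag (pr_closed hG1c hG1c) (pr_irred hG1i hG1i)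
      (p := Sum.elim z z) (by simp [hz]) (Sum.inl 2) (Sum.inr 2) rfl
    rw [dim_pr hG1i.1 hG1i.1] at hTd
    have hT : ∀ x ∈ T, x (Sum.inl 2) = x (Sum.inl 0) + x (Sum.inl 1) ∧
        x (Sum.inr 2) = x (Sum.inr 0) + x (Sum.inr 1) ∧ x (Sum.inl 2) = x (Sum.inr 2) := by
      intro x hx
      exact ⟨hG1s (hTs hx).1, hG1s (hTs hx).2, hTe x hx⟩
    have hinj : ∀ x ∈ T, ∀ x' ∈ T, x ∘ σ = x' ∘ σ → x = x' := by
      intro x hx x' hx' h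
      obtain ⟨a1, a2, a3⟩ := hT x hx
      obtain ⟨b1, b2, b3⟩ := hT x' hx'
      have h0 := congrFun h 0
      have h1 := congrFun h 1
      have h2 := congrFun h 2
      have h3 := congrFun h 3
      rcases hσ with rfl | rfl
      · simp only [Function.comp] at h0 h1 h2 h3
        change x (Sum.inl 0) = x' (Sum.inl 0) at h0
        change x (Sum.inl 1) = x' (Sum.inl 1) at h1
        change x (Sum.inr 0) = x' (Sum.inr 0) at h2
        change x (Sum.inr 1) = x' (Sum.inr 1) at h3
        funext k
        rcases k with k | k <;> fin_cases k <;> simp [*]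
      · simp only [Function.comp] at h0 h1 h2 h3
        change x (Sum.inl 0) = x' (Sum.inl 0) at h0
        change x (Sum.inl 1) = x' (Sum.inl 1) at h1
        change x (Sum.inr 1) = x' (Sum.inr 1) at h2
        change x (Sum.inr 0) = x' (Sum.inr 0) at h3
        funext k
        rcases k with k | k <;> fin_cases k <;> simp [*]
    apply crit ((fun x => x ∘ σ) '' T) (hTi.image _ (continuous_re _).continuousOn)
    · rintro _ ⟨x, hx, rfl⟩
      obtain ⟨a1, a2, a3⟩ := hT x hx
      rcases hσ with rfl | rfl
      · change x (Sum.inl 0) + x (Sum.inl 1) = x (Sum.inr 0) + x (Sum.inr 1)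
        rw [← a1, ← a2, a3]
      · change x (Sum.inl 0) + x (Sum.inl 1) = x (Sum.inr 1) + x (Sum.inr 0)
        rw [← a1, add_comm (x (Sum.inr 1)), ← a2, a3]
    · rw [dim_re_inj hTc σ hinj]; omega
    · exact ⟨_, hTp, rfl⟩
  have key2 : ∀ x y : K, ![x, y, y, x] ∈ V1 := by
    obtain ⟨F, hF, hFn, hFi⟩ := hG1d.open hG1c
    have hc : Continuous (fun q : Fin 2 → K => ![q 0, q 1, q 1, q 0]) := by
      apply continuous_coord
      intro k; left
      fin_cases k
      · exact ⟨0, fun _ => rfl⟩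
      · exact ⟨1, fun _ => rfl⟩
      · exact ⟨1, fun _ => rfl⟩
      · exact ⟨0, fun _ => rfl⟩
    have := closed_all_of_generic hF hFn (hV1c.preimage hc) (by
      intro q hq
      obtain ⟨z, hz, hzq⟩ := hFi q hq
      have := key _ (Or.inr rfl) z hz
      change ![q 0, q 1, q 1, q 0] ∈ V1
      convert this using 1
      funext k
      rw [← hzq]
      fin_cases k <;> rfl)
    intro x y
    have h := this ▸ mem_univ ![x, y]
    simpa using h
  -- (b)
  have hb : ∀ x0 z0 : K, {u : K | ![x0, u, z0, x0 + u - z0] ∉ V1}.Finite := by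
    intro x0 z0
    obtain ⟨T, hTs, hTc, hTi, hTp, hTe, hTd⟩ := z3_const hV1c hV1i (key2 x0 z0) 0 x0 rfl
    obtain ⟨T', hTs', hTc', hTi', hTp', hTe', hTd'⟩ := z3_const hTc hTi hTp 2 z0 rfl
    have hinj : ∀ x ∈ T', ∀ x' ∈ T', x ∘ (fun _ : Unit => (1 : Fin 4)) = x' ∘ (fun _ : Unit => (1 : Fin 4)) → x = x' := by
      intro x hx x' hx' h
      apply hVinj x (hV1s (hTs (hTs' hx))) x' (hV1s (hTs (hTs' hx')))
      funext k
      fin_cases k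
      · exact (hTe x (hTs' hx)).trans (hTe x' (hTs' hx')).symm
      · exact congrFun h ()
      · exact (hTe' x hx).trans (hTe' x' hx').symm
    have hd : Dom (fun _ : Unit => (1 : Fin 4)) T' := dom_of_dim hTc' hTi'.1 _ hinj (by simp; omega)
    refine (dom_unit_cofinite hTc' _ hd).subset ?_
    rintro u hu ⟨x, hx, hxu⟩
    apply hu
    have hxV1 := hTs (hTs' hx)
    convert hxV1 using 1
    have e0 := hTe x (hTs' hx)
    have e2 := hTe' x hx
    have e3 : x 0 + x 1 = x 2 + x 3 := hV1s hxV1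
    funext k
    fin_cases k
    · exact e0.symm
    · exact hxu.symm
    · exact e2.symm
    · change x0 + u - z0 = x 3
      rw [← e0, ← hxu, e3, e2]; ring
  -- (c)
  have hVV : V ⊆ V1 := by
    intro q hq
    have hq' : q 0 + q 1 = q 2 + q 3 := hq
    have hf1 := hb (q 0) (q 2)
    have hf2 := (hb (q 1) (q 3)).image (fun v => q 1 + v - q 3)
    obtain ⟨u, hu⟩ := (hf1.union hf2).infinite_compl.nonempty
    rw [mem_compl_iff, mem_union, not_or] at hu
    obtain ⟨hu1, hu2⟩ := hu
    have hu1 : ![q 0, u, q 2, q 0 + u - q 2] ∈ V1 := by simpa using hu1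
    have hu2 : ![q 1, q 0 + u - q 2, q 3, u] ∈ V1 := by
      by_contra hc
      apply hu2
      refine ⟨q 0 + u - q 2, ?_, ?_⟩
      · simp only [mem_ofPred_eq]
        have e : q 1 + (q 0 + u - q 2) - q 3 = u := by linear_combination hq'
        rw [e]; exact hc
      · simp only
        linear_combination hq'
    obtain ⟨T, hTs, hTc, hTi, hTp, hTe, hTd⟩ := z3_diags
      [(Sum.inl 1, Sum.inr 3), (Sum.inl 3, Sum.inr 1)] (pr_closed hV1c hV1c) (pr_irred hV1i hV1i)
      (p := Sum.elim ![q 0, u, q 2, q 0 + u - q 2] ![q 1, q 0 + u - q 2, q 3, u])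
      (by simp [hu1, hu2]) (by simp)
    rw [dim_pr hV1i.1 hV1i.1] at hTd
    simp only [List.length_cons, List.length_nil] at hTd
    have hT : ∀ x ∈ T, x (Sum.inl 0) + x (Sum.inl 1) = x (Sum.inl 2) + x (Sum.inl 3) ∧
        x (Sum.inr 0) + x (Sum.inr 1) = x (Sum.inr 2) + x (Sum.inr 3) ∧
        x (Sum.inl 1) = x (Sum.inr 3) ∧ x (Sum.inl 3) = x (Sum.inr 1) := by
      intro x hx
      exact ⟨hV1s (hTs hx).1, hV1s (hTs hx).2, hTe (Sum.inl 1, Sum.inr 3) (by simp) x hx, hTe (Sum.inl 3, Sum.inr 1) (by simp) x hx⟩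
    let σ : Fin 4 → Fin 4 ⊕ Fin 4 := ![Sum.inl 0, Sum.inr 0, Sum.inl 2, Sum.inr 2]
    have hrem := dim_remove hTc σ (Sum.inl 1) (by
      intro x hx x' hx' h hu
      obtain ⟨a1, a2, a3, a4⟩ := hT x hx
      obtain ⟨b1, b2, b3, b4⟩ := hT x' hx'
      have h0 : x (Sum.inl 0) = x' (Sum.inl 0) := congrFun h 0
      have h1 : x (Sum.inr 0) = x' (Sum.inr 0) := congrFun h 1
      have h2 : x (Sum.inl 2) = x' (Sum.inl 2) := congrFun h 2
      have h3 : x (Sum.inr 2) = x' (Sum.inr 2) := congrFun h 3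
      have h4 : x (Sum.inl 3) = x' (Sum.inl 3) := by
        linear_combination b1 - a1 + h0 + hu - h2
      have h5 : x (Sum.inr 3) = x' (Sum.inr 3) := by rw [← a3, ← b3, hu]
      have h6 : x (Sum.inr 1) = x' (Sum.inr 1) := by rw [← a4, ← b4, h4]
      funext k
      rcases k with k | k <;> fin_cases k <;> assumption)
    have := crit ((fun x => x ∘ σ) '' T) (hTi.image _ (continuous_re _).continuousOn) (by
      rintro _ ⟨x, hx, rfl⟩
      obtain ⟨a1, a2, a3, a4⟩ := hT x hx
      change x (Sum.inl 0) + x (Sum.inr 0) = x (Sum.inl 2) + x (Sum.inr 2)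
      linear_combination a1 + a2 - a3 + a4) (by omega) ⟨_, hTp, rfl⟩
    convert this using 1
    funext k
    fin_cases k <;> rfl
  -- conclusion
  have hGG : G ⊆ G1 := by
    intro q hq
    have hq' : q 2 = q 0 + q 1 := hq
    have hp : ![q 0, q 1, q 2, 0] ∈ V1 := hVV (by simp [V, hq'])
    obtain ⟨T, hTs, hTc, hTi, hTp, hTe, hTd⟩ := z3_const hV1c hV1i hp 3 0 rfl
    have hinj : ∀ x ∈ T, ∀ x' ∈ T, x ∘ (![0, 1, 2] : Fin 3 → Fin 4) = x' ∘ (![0, 1, 2] : Fin 3 → Fin 4) → x = x' :=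
      fun x hx x' hx' => hVinj x (hV1s (hTs hx)) x' (hV1s (hTs hx'))
    have hsub : (fun x => x ∘ (![0, 1, 2] : Fin 3 → Fin 4)) '' T ⊆ G := by
      rintro _ ⟨x, hx, rfl⟩
      have e1 : x 0 + x 1 = x 2 + x 3 := hV1s (hTs hx)
      have e2 := hTe x hx
      change x 2 = x 0 + x 1
      rw [e1, e2, add_zero]
    have := uniq_comp _ hGinj isClosed_closure (cl_image_irred hTi (![0, 1, 2] : Fin 3 → Fin 4))
      (closure_minimal hsub hG) (by rw [dim_closure, dim_re_inj hTc _ hinj]; simp; omega)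
      hG1c hG1i hG1s (by simpa using hG1dim)
    rw [← this]
    apply subset_closure
    refine ⟨_, hTp, ?_⟩
    funext k
    fin_cases k <;> rfl
  rw [hG1s.antisymm hGG] at hG1i
  exact hG1i

end add

end ZG

set_option linter.all false
open Topology
namespace ZG
open Set

variable {K : Type*} [Field K] [ZG K]
variable {ι κ μ : Type} [Finite ι] [Finite κ] [Finite μ]

def graph {ι K : Type*} (f : (ι → K) → K) : Set (Option ι → K) := {z | z none = f (z ∘ some)}

lemma cont_graph_aux (f : (ι → K) → K) (hc : IsClosed (graph f)) (hi : IsIrreducible (graph f)) (e : ι → κ)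
    {D : Set (Option κ → K)} (hD : IsClosed D) (hDi : IsIrreducible D)
    (hDs : ∀ z ∈ D, z none = f (z ∘ some ∘ e)) : IsClosed ((fun z => z ∘ some) '' D) := by
  classical
  cases nonempty_fintype ι
  set B := closure ((fun z => z ∘ some) '' D) with hB
  have hBi : IsIrreducible B := cl_image_irred hDi _
  apply isClosed_of_closure_subset
  intro b hb
  let L : List ((κ ⊕ Option ι) × (κ ⊕ Option ι)) :=
    (Finset.univ : Finset ι).toList.map (fun i => (Sum.inl (e i), Sum.inr (some i)))
  obtain ⟨T, hTs, hTc, hTi, hTp, hTe, hTd⟩ := z3_diags L (pr_closed isClosed_closure hc)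
    (pr_irred hBi hi) (p := Sum.elim b (xc (b ∘ e) (f (b ∘ e)))) (by
      rw [elim_mem_pr]; exact ⟨hb, rfl⟩) (by
      simp [L])
  have hgd : Nat.card ι ≤ dim (graph f) := by
    have : Dom (some : ι → Option ι) (graph f) := by
      have : (fun x => x ∘ some) '' (graph f) = univ := by
        ext y; simp only [mem_univ, iff_true]
        exact ⟨xc y (f y), rfl, rfl⟩
      unfold Dom; rw [this]; exact dense_univ
    exact this.le_dim
  rw [dim_pr hBi.1 hi.1] at hTd
  have hLl : L.length = Nat.card ι := by simp [L]
  rw [hLl] at hTd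
  have hdBT : dim B ≤ dim T := by omega
  have hTe' : ∀ x ∈ T, ∀ i, x (Sum.inl (e i)) = x (Sum.inr (some i)) := by
    intro x hx i
    exact hTe (Sum.inl (e i), Sum.inr (some i)) (by simp [L]) x hx
  have hTn : ∀ x ∈ T, x (Sum.inr none) = f (x ∘ Sum.inl ∘ e) := by
    intro x hx
    have h1 := (hTs hx).2
    have : x (Sum.inr none) = f ((x ∘ Sum.inr) ∘ some) := h1
    rw [this]; congr 1; funext i; exact (hTe' x hx i).symm
  have hinj : ∀ x ∈ T, ∀ x' ∈ T, x ∘ (Sum.inl : κ → κ ⊕ Option ι) = x' ∘ Sum.inl → x = x' := by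
    intro x hx x' hx' h
    have h' : ∀ k, x (Sum.inl k) = x' (Sum.inl k) := fun k => congrFun h k
    funext k
    rcases k with k | _ | i
    · exact h' k
    · rw [hTn x hx, hTn x' hx']; congr 1; funext i; exact h' _
    · rw [← hTe' x hx, ← hTe' x' hx']; exact h' _
  have hdim := dim_re_inj hTc _ hinj
  have himB : (fun x => x ∘ Sum.inl) '' T ⊆ B := by
    rintro _ ⟨x, hx, rfl⟩; exact (hTs hx).1
  have hclT : closure ((fun x => x ∘ Sum.inl) '' T) = B := by
    apply eq_of_dim isClosed_closure (hTi.1.image _).closure isClosed_closure hBi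
      (closure_minimal himB isClosed_closure)
    rw [dim_closure ((fun x => x ∘ Sum.inl) '' T), hdim]; exact hdBT
  let r : Option κ → κ ⊕ Option ι := fun o => o.elim (Sum.inr none) Sum.inl
  set T' := T ∩ (fun z => z ∘ r) ⁻¹' D with hT'
  have hT'c : IsClosed T' := hTc.inter (hD.preimage (continuous_re r))
  obtain ⟨F, hF, hF1, hF2⟩ := Z1' (Sum.inl : κ → κ ⊕ Option ι) T hTc hTi.1
  obtain ⟨F', hF', hF1', hF2'⟩ := Z1' (some : κ → Option κ) D hD hDi.1
  rw [hclT] at hF1 hF2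
  have hcov : B ⊆ (F ∪ F') ∪ closure ((fun x => x ∘ Sum.inl) '' T') := by
    intro y hy
    by_cases h1 : y ∈ F
    · exact Or.inl (Or.inl h1)
    by_cases h2 : y ∈ F'
    · exact Or.inl (Or.inr h2)
    right
    obtain ⟨t, ht, hty⟩ := hF2 ⟨hy, h1⟩
    obtain ⟨d, hd, hdy⟩ := hF2' ⟨hy, h2⟩
    apply subset_closure
    refine ⟨t, ⟨ht, ?_⟩, hty⟩
    have : t ∘ r = d := by
      have hh : ∀ k, t (Sum.inl k) = d (some k) := fun k => congrFun (hty.trans hdy.symm) k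
      funext o
      rcases o with _ | k
      · change t (Sum.inr none) = d none
        rw [hTn t ht, hDs d hd]; congr 1; funext i; exact hh _
      · exact hh k
    change t ∘ r ∈ D
    rw [this]; exact hd
  have hBcl : B ⊆ closure ((fun x => x ∘ Sum.inl) '' T') := by
    rcases irred_sub_union hBi (hF.union hF') isClosed_closure hcov with h | h
    · exfalso
      rcases irred_sub_union hBi hF hF' h with h | h
      · exact hF1.2 h
      · exact hF1'.2 h
    · exact h
  have hne' : T'.Nonempty := by
    have : ((fun x => x ∘ Sum.inl) '' T').Nonempty := closure_nonempty_iff.1 ⟨b, hBcl hb⟩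
    exact this.of_image
  have : T' = T := by
    apply eq_of_dim hT'c hne' hTc hTi inter_subset_left
    calc dim T = _ := hdim.symm
      _ ≤ dim B := dim_mono himB
      _ ≤ _ := dim_mono hBcl
      _ = _ := dim_closure _
      _ ≤ _ := dim_re_le _ _
  have hp : Sum.elim b (xc (b ∘ e) (f (b ∘ e))) ∈ T' := by rw [this]; exact hTp
  exact ⟨_, hp.2, rfl⟩

lemma cont_graph (f : (ι → K) → K) (hc : IsClosed (graph f)) (hi : IsIrreducible (graph f)) (e : ι → κ) :
    Continuous (fun x : κ → K => xc x (f (x ∘ e))) := by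
  rw [continuous_iff_isClosed]
  intro D hD
  let r : Option ι → Option κ := Option.map e
  have hg : IsClosed ((fun z : Option κ → K => z ∘ r) ⁻¹' graph f) := hc.preimage (continuous_re r)
  obtain ⟨Fm, hFf, hFc, hFi, hFu⟩ := finite_decomp (hD.inter hg)
  have : (fun x : κ → K => xc x (f (x ∘ e))) ⁻¹' D = ⋃ A ∈ Fm, (fun z => z ∘ some) '' A := by
    ext x
    constructor
    · intro hx
      have h : xc x (f (x ∘ e)) ∈ D ∩ ((fun z : Option κ → K => z ∘ r) ⁻¹' graph f) := ⟨hx, rfl⟩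
      rw [hFu] at h
      obtain ⟨A, hA, hxA⟩ := h
      exact mem_biUnion hA ⟨_, hxA, rfl⟩
    · intro hx
      simp only [mem_iUnion] at hx
      obtain ⟨A, hA, z, hz, rfl⟩ := hx
      have h : z ∈ D ∩ ((fun z : Option κ → K => z ∘ r) ⁻¹' graph f) := hFu ▸ ⟨A, hA, hz⟩
      have h2 : z none = f ((z ∘ some) ∘ e) := h.2
      have : xc (z ∘ some) (f ((z ∘ some) ∘ e)) = z := by
        funext o; rcases o with _ | o
        · exact h2.symm
        · rfl
      change xc (z ∘ some) (f ((z ∘ some) ∘ e)) ∈ D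
      rw [this]; exact h.1
  rw [this]
  apply hFf.isClosed_biUnion
  intro A hA
  apply cont_graph_aux f hc hi e (hFc A hA) (hFi A hA)
  intro z hz
  have h : z ∈ D ∩ ((fun z : Option κ → K => z ∘ r) ⁻¹' graph f) := hFu ▸ ⟨A, hA, hz⟩
  exact h.2

/-- continuous functions to the line, in the strong (product) sense -/
def CF (f : (ι → K) → K) : Prop :=
  ∀ (κ : Type) [Finite κ] (e : ι → κ), Continuous (fun x : κ → K => xc x (f (x ∘ e)))

lemma CF.pair {μ : Type} [Finite μ] (κ : Type) [Finite κ] : ∀ (g : κ → (ι → K) → K) (hg : ∀ k, CF (g k)) (e : ι → μ),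
    Continuous (fun x : μ → K => (Sum.elim x (fun k => g k (x ∘ e)) : μ ⊕ κ → K)) := by
  refine Finite.induction_empty_option (P := fun κ => ∀ [Finite κ] (g : κ → (ι → K) → K) (hg : ∀ k, CF (g k)) (e : ι → μ),
    Continuous (fun x : μ → K => (Sum.elim x (fun k => g k (x ∘ e)) : μ ⊕ κ → K))) ?_ ?_ ?_ κ
  · intro α β E ih _ g hg e
    have : Finite α := Finite.of_equiv β E.symm
    have h1 := ih (fun a => g (E a)) (fun a => hg _) e
    have h2 := (continuous_re (K := K) (Sum.map id E.symm : μ ⊕ β → μ ⊕ α)).comp h1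
    convert h2 using 1
    funext x k
    rcases k with k | k <;> simp
  · intro _ g hg e
    apply continuous_coord
    rintro (k | k)
    · exact Or.inl ⟨k, fun _ => rfl⟩
    · exact k.elim
  · intro α _ ih _ g hg e
    have h1 := ih (fun a => g (some a)) (fun a => hg _) e
    have h2 := hg none (μ ⊕ α) (Sum.inl ∘ e)
    have h3 := (continuous_re (K := K) (Sum.elim (fun m => some (Sum.inl m)) (fun o => o.elim none (fun a => some (Sum.inr a))) :
      μ ⊕ Option α → Option (μ ⊕ α))).comp (h2.comp h1)
    convert h3 using 1
    funext x k
    rcases k with k | _ | k <;> rfl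

lemma CF.cont {g : κ → (ι → K) → K} (hg : ∀ k, CF (g k)) :
    Continuous (fun x : ι → K => (fun k => g k x)) := by
  have := (continuous_re (K := K) (Sum.inr : κ → ι ⊕ κ)).comp (CF.pair κ g hg (id : ι → ι))
  exact this

lemma CF.comp {f : (κ → K) → K} (hf : CF f) {g : κ → (ι → K) → K} (hg : ∀ k, CF (g k)) :
    CF (fun x => f (fun k => g k x)) := by
  intro μ _ e
  have h1 := CF.pair κ g hg e
  have h2 := hf (μ ⊕ κ) Sum.inr
  have h3 := (continuous_re (K := K) (Option.map Sum.inl : Option μ → Option (μ ⊕ κ))).comp (h2.comp h1)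
  convert h3 using 1
  funext x o
  rcases o with _ | o <;> rfl

lemma CF.coord (i : ι) : CF (fun x : ι → K => x i) := by
  intro κ _ e
  apply continuous_coord
  rintro (_ | k)
  · exact Or.inl ⟨e i, fun _ => rfl⟩
  · exact Or.inl ⟨k, fun _ => rfl⟩

lemma CF.const (c : K) : CF (fun _ : ι → K => c) := by
  intro κ _ e
  apply continuous_coord
  rintro (_ | k)
  · exact Or.inr ⟨c, fun _ => rfl⟩
  · exact Or.inl ⟨k, fun _ => rfl⟩

lemma CF_of_op (op : K → K → K) (hc : IsClosed {x : Fin 3 → K | x 2 = op (x 0) (x 1)})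
    (hi : IsIrreducible {x : Fin 3 → K | x 2 = op (x 0) (x 1)}) :
    CF (fun x : Fin 2 → K => op (x 0) (x 1)) := by
  intro κ _ e
  refine cont_graph (fun x : Fin 2 → K => op (x 0) (x 1)) ?_ ?_ e
  · exact hc.preimage (continuous_re (![some 0, some 1, none] : Fin 3 → Option (Fin 2)))
  · have := hi.image (fun x => x ∘ (fun o => o.elim 2 (fun k => ![0, 1] k) : Option (Fin 2) → Fin 3))
      (continuous_re _).continuousOn
    convert this using 1
    ext z
    constructor
    · intro hz
      refine ⟨![z (some 0), z (some 1), z none], hz, ?_⟩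
      funext o
      rcases o with _ | o
      · rfl
      · fin_cases o <;> rfl
    · rintro ⟨x, hx, rfl⟩
      exact hx

section
variable [IsAlgClosed K]

lemma add_closed : IsClosed {x : Fin 3 → K | x 2 = x 0 + x 1} := by
  have := isClosed_alg (K := K) (MvPolynomial.X 2 - (MvPolynomial.X 0 + MvPolynomial.X 1) : MvPolynomial (Fin 3) K)
  simpa [sub_eq_zero] using this

lemma mul_closed : IsClosed {x : Fin 3 → K | x 2 = x 0 * x 1} := by
  have := isClosed_alg (K := K) (MvPolynomial.X 2 - (MvPolynomial.X 0 * MvPolynomial.X 1) : MvPolynomial (Fin 3) K)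
  simpa [sub_eq_zero] using this

lemma CF.add {f g : (ι → K) → K} (hf : CF f) (hg : CF g) : CF (fun x => f x + g x) :=
  (CF_of_op (· + ·) add_closed add_graph_irred).comp (g := ![f, g]) (by intro k; fin_cases k <;> assumption)

lemma mul_graph_irred : IsIrreducible {x : Fin 3 → K | x 2 = x 0 * x 1} := by
  set G : Set (Fin 3 → K) := {x | x 2 = x 0 * x 1} with hGdef
  have hG : IsClosed G := mul_closed
  have hGinj : ∀ x ∈ G, ∀ x' ∈ G, x ∘ (![0, 1] : Fin 2 → Fin 3) = x' ∘ (![0, 1] : Fin 2 → Fin 3) → x = x' := by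
    intro x hx x' hx' h
    have h0 : x 0 = x' 0 := congrFun h 0
    have h1 : x 1 = x' 1 := congrFun h 1
    have h2 : x 2 = x' 2 := by rw [show x 2 = x 0 * x 1 from hx, show x' 2 = x' 0 * x' 1 from hx', h0, h1]
    funext k; fin_cases k <;> assumption
  obtain ⟨G1, hG1s, hG1c, hG1i, hG1d⟩ := exists_dom_comp hG (![0, 1] : Fin 2 → Fin 3)
    (fun y => ⟨![y 0, y 1, y 0 * y 1], by simp [G], by funext k; fin_cases k <;> rfl⟩)
  have hG1dim : 2 ≤ dim G1 := by simpa using hG1d.le_dim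
  have crit : ∀ A : Set (Fin 3 → K), IsIrreducible A → A ⊆ G → 2 ≤ dim A → A ⊆ G1 := by
    intro A hAi hAV hAd
    have := uniq_comp _ hGinj isClosed_closure hAi.closure (closure_minimal hAV hG)
      (by rw [dim_closure]; simpa using hAd) hG1c hG1i hG1s (by simpa using hG1dim)
    rw [← this]; exact subset_closure
  have swap : ∀ x y, ![x, y, x * y] ∈ G1 → ![y, x, y * x] ∈ G1 := by
    intro x y h
    apply crit ((fun z => z ∘ ![1, 0, 2]) '' G1) (hG1i.image _ (continuous_re _).continuousOn)
    · rintro _ ⟨z, hz, rfl⟩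
      have : z 2 = z 0 * z 1 := hG1s hz
      change z 2 = z 1 * z 0
      rw [this, mul_comm]
    · rw [dim_re_inj hG1c]
      · exact hG1dim
      · intro x hx x' hx' h
        have h0 : x 1 = x' 1 := congrFun h 0
        have h1 : x 0 = x' 0 := congrFun h 1
        have h2 : x 2 = x' 2 := congrFun h 2
        funext k; fin_cases k <;> assumption
    · refine ⟨_, h, ?_⟩
      funext k; fin_cases k
      · rfl
      · rfl
      · exact mul_comm x y
  have hmem : ∀ z ∈ G1, z = ![z 0, z 1, z 0 * z 1] := by
    intro z hz
    funext k; fin_cases k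
    · rfl
    · rfl
    · exact hG1s hz
  have cof : ∀ z ∈ G1, {y : K | ![z 0, y, z 0 * y] ∉ G1}.Finite := by
    intro z hz
    obtain ⟨T, hTs, hTc, hTi, hTp, hTe, hTd⟩ := z3_const hG1c hG1i hz 0 (z 0) rfl
    have hd : Dom (fun _ : Unit => (1 : Fin 3)) T := by
      apply dom_of_dim hTc hTi.1
      · intro x hx x' hx' h
        apply hGinj x (hG1s (hTs hx)) x' (hG1s (hTs hx'))
        funext k; fin_cases k
        · exact (hTe x hx).trans (hTe x' hx').symm
        · exact congrFun h ()
      · simp; omega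
    refine (dom_unit_cofinite hTc _ hd).subset ?_
    rintro y hy ⟨x, hx, hxy⟩
    apply hy
    have := hmem x (hTs hx)
    rw [hTe x hx, hxy] at this
    rw [← this]; exact hTs hx
  have full : ∀ z ∈ G1, ∀ y0, ![z 0, y0, z 0 * y0] ∈ G1 := by
    intro z hz y0
    have hf := cof z hz
    obtain ⟨y, hy⟩ := (hf.union (hf.image (fun v => y0 - v))).infinite_compl.nonempty
    rw [mem_compl_iff, mem_union, not_or] at hy
    obtain ⟨hy1, hy2⟩ := hy
    have hy1 : ![z 0, y, z 0 * y] ∈ G1 := by simpa using hy1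
    have hy2 : ![z 0, y0 - y, z 0 * (y0 - y)] ∈ G1 := by
      by_contra hc
      exact hy2 ⟨y0 - y, hc, by ring⟩
    obtain ⟨T, hTs, hTc, hTi, hTp, hTe, hTd⟩ := z3_diag (pr_closed hG1c hG1c) (pr_irred hG1i hG1i)
      (p := Sum.elim ![z 0, y, z 0 * y] ![z 0, y0 - y, z 0 * (y0 - y)]) (by simp [hy1, hy2]) (Sum.inl 0) (Sum.inr 0) rfl
    rw [dim_pr hG1i.1 hG1i.1] at hTd
    let σ : Fin 3 → Fin 3 ⊕ Fin 3 := ![Sum.inl 0, Sum.inl 1, Sum.inr 1]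
    have hT : ∀ x ∈ T, x (Sum.inl 2) = x (Sum.inl 0) * x (Sum.inl 1) ∧
        x (Sum.inr 2) = x (Sum.inr 0) * x (Sum.inr 1) ∧ x (Sum.inl 0) = x (Sum.inr 0) := by
      intro x hx
      exact ⟨hG1s (hTs hx).1, hG1s (hTs hx).2, hTe x hx⟩
    have hdom : Dom σ T := by
      apply dom_of_dim hTc hTi.1
      · intro x hx x' hx' h
        obtain ⟨a1, a2, a3⟩ := hT x hx
        obtain ⟨b1, b2, b3⟩ := hT x' hx'
        have h0 : x (Sum.inl 0) = x' (Sum.inl 0) := congrFun h 0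
        have h1 : x (Sum.inl 1) = x' (Sum.inl 1) := congrFun h 1
        have h2 : x (Sum.inr 1) = x' (Sum.inr 1) := congrFun h 2
        have h3 : x (Sum.inr 0) = x' (Sum.inr 0) := by rw [← a3, ← b3, h0]
        funext k
        rcases k with k | k <;> fin_cases k
        · exact h0
        · exact h1
        · change x (Sum.inl 2) = x' (Sum.inl 2); rw [a1, b1, h0, h1]
        · exact h3
        · exact h2
        · change x (Sum.inr 2) = x' (Sum.inr 2); rw [a2, b2, h3, h2]
      · simp; omega
    let φ : (Fin 3 ⊕ Fin 3 → K) → (Fin 3 → K) := fun x k =>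
      (![fun x => x (Sum.inl 0), fun x => x (Sum.inl 1) + x (Sum.inr 1), fun x => x (Sum.inl 2) + x (Sum.inr 2)] : Fin 3 → (Fin 3 ⊕ Fin 3 → K) → K) k x
    have hφ : Continuous φ := by
      apply CF.cont
      intro k; fin_cases k
      · exact CF.coord _
      · exact (CF.coord _).add (CF.coord _)
      · exact (CF.coord _).add (CF.coord _)
    have := crit (φ '' T) (hTi.image _ hφ.continuousOn) (by
      rintro _ ⟨x, hx, rfl⟩
      obtain ⟨a1, a2, a3⟩ := hT x hx
      change x (Sum.inl 2) + x (Sum.inr 2) = x (Sum.inl 0) * (x (Sum.inl 1) + x (Sum.inr 1))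
      rw [a1, a2, a3]; ring) (by
      have hd2 : Dom (![0, 1] : Fin 2 → Fin 3) (φ '' T) := by
        unfold Dom
        let ψ : (Fin 3 → K) → (Fin 2 → K) := fun x k => (![fun x => x 0, fun x => x 1 + x 2] : Fin 2 → (Fin 3 → K) → K) k x
        have hψ : Continuous ψ := by
          apply CF.cont
          intro k; fin_cases k
          · exact CF.coord _
          · exact (CF.coord _).add (CF.coord _)
        have hs : Function.Surjective ψ := by
          intro q
          refine ⟨![q 0, q 1, 0], ?_⟩
          funext k; fin_cases k
          · rfl
          · exact add_zero (q 1)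
        have := hs.denseRange.dense_image hψ hdom
        convert this using 1
        rw [← image_comp, ← image_comp]
        apply image_congr
        intro x hx
        funext k; fin_cases k <;> rfl
      simpa using hd2.le_dim) ⟨_, hTp, rfl⟩
    convert this using 1
    funext k; fin_cases k
    · rfl
    · change y0 = y + (y0 - y); ring
    · change z 0 * y0 = z 0 * y + z 0 * (y0 - y); ring
  obtain ⟨z, hz⟩ := hG1i.1
  have hall : ∀ x y, ![x, y, x * y] ∈ G1 := by
    intro x y
    have h1 := swap _ _ (full z hz x)
    exact full _ h1 y
  have hGG : G ⊆ G1 := by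
    intro q hq
    have := hall (q 0) (q 1)
    convert this using 1
    funext k; fin_cases k
    · rfl
    · rfl
    · exact hq
  rw [hG1s.antisymm hGG] at hG1i
  exact hG1i

lemma CF.mul {f g : (ι → K) → K} (hf : CF f) (hg : CF g) : CF (fun x => f x * g x) :=
  (CF_of_op (· * ·) mul_closed mul_graph_irred).comp (g := ![f, g]) (by intro k; fin_cases k <;> assumption)

lemma CF.poly (p : MvPolynomial ι K) : CF (fun x => MvPolynomial.eval x p) := by
  induction p using MvPolynomial.induction_on with
  | C a => simpa using CF.const a
  | add p q hp hq => simpa using hp.add hq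
  | mul_X p i hp => simpa using hp.mul (CF.coord i)

/-- Polynomial functions -/
def PF {ι K : Type*} [CommSemiring K] (f : (ι → K) → K) : Prop :=
  ∃ p : MvPolynomial ι K, ∀ x, f x = MvPolynomial.eval x p

lemma PF.cf {f : (ι → K) → K} (h : PF f) : CF f := by
  obtain ⟨p, hp⟩ := h
  rw [show f = _ from funext hp]; exact CF.poly p

end

section PF
variable {F : Type*} [Field F] {σ ρ : Type*}
lemma PF.poly (p : MvPolynomial σ F) : PF (fun x => MvPolynomial.eval x p) := ⟨p, fun _ => rfl⟩
lemma PF.coord (i : σ) : PF (fun x : σ → F => x i) := ⟨MvPolynomial.X i, fun _ => by simp⟩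
lemma PF.const (c : F) : PF (fun _ : σ → F => c) := ⟨MvPolynomial.C c, fun _ => by simp⟩
lemma PF.add {f g : (σ → F) → F} (hf : PF f) (hg : PF g) : PF (fun x => f x + g x) := by
  obtain ⟨p, hp⟩ := hf; obtain ⟨q, hq⟩ := hg; exact ⟨p + q, fun x => by simp [hp, hq]⟩
lemma PF.sub {f g : (σ → F) → F} (hf : PF f) (hg : PF g) : PF (fun x => f x - g x) := by
  obtain ⟨p, hp⟩ := hf; obtain ⟨q, hq⟩ := hg; exact ⟨p - q, fun x => by simp [hp, hq]⟩
lemma PF.mul {f g : (σ → F) → F} (hf : PF f) (hg : PF g) : PF (fun x => f x * g x) := by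
  obtain ⟨p, hp⟩ := hf; obtain ⟨q, hq⟩ := hg; exact ⟨p * q, fun x => by simp [hp, hq]⟩
lemma PF.pow {f : (σ → F) → F} (hf : PF f) (n : ℕ) : PF (fun x => f x ^ n) := by
  obtain ⟨p, hp⟩ := hf; exact ⟨p ^ n, fun x => by simp [hp]⟩
lemma PF.sum {α : Type*} (s : Finset α) {f : α → (σ → F) → F} (hf : ∀ a ∈ s, PF (f a)) : PF (fun x => ∑ a ∈ s, f a x) := by
  classical
  induction s using Finset.induction_on with
  | empty => simpa using PF.const 0
  | insert a s ha ih =>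
    simp only [Finset.sum_insert ha]
    exact (hf a (by simp)).add (ih fun b hb => hf b (by simp [hb]))
lemma PF.prod {α : Type*} (s : Finset α) {f : α → (σ → F) → F} (hf : ∀ a ∈ s, PF (f a)) : PF (fun x => ∏ a ∈ s, f a x) := by
  classical
  induction s using Finset.induction_on with
  | empty => simpa using PF.const 1
  | insert a s ha ih =>
    simp only [Finset.prod_insert ha]
    exact (hf a (by simp)).mul (ih fun b hb => hf b (by simp [hb]))
lemma PF.comp {f : (ρ → F) → F} (hf : PF f) {g : ρ → (σ → F) → F} (hg : ∀ k, PF (g k)) :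
    PF (fun x => f (fun k => g k x)) := by
  obtain ⟨p, hp⟩ := hf
  choose q hq using hg
  refine ⟨MvPolynomial.bind₁ q p, fun x => ?_⟩
  show f (fun k => g k x) = _
  simp only [hp, hq, MvPolynomial.eval, MvPolynomial.eval₂Hom_bind₁]
end PF

end ZG

set_option linter.all false
open Topology
namespace ZG
open Set

variable {K : Type*} [Field K] [ZG K] [IsAlgClosed K]
variable {ι κ μ : Type} [Finite ι] [Finite κ] [Finite μ]

lemma PF.cont {g : κ → (ι → K) → K} (hg : ∀ k, PF (g k)) : Continuous (fun x : ι → K => (fun k => g k x)) :=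
  CF.cont (fun k => (hg k).cf)

lemma isClosed_pf {f : (ι → K) → K} (hf : PF f) : IsClosed {x | f x = 0} := by
  obtain ⟨p, hp⟩ := hf
  simp only [hp]; exact isClosed_alg p

lemma isClosed_pf_eq {f g : (ι → K) → K} (hf : PF f) (hg : PF g) : IsClosed {x | f x = g x} := by
  have := isClosed_pf (hf.sub hg)
  simpa [sub_eq_zero] using this

lemma z3_poly {T : Set (ι → K)} (hT : IsClosed T) (hTi : IsIrreducible T) {p : ι → K} (hp : p ∈ T)
    {f : (ι → K) → K} (hf : PF f) (hfp : f p = 0) : ∃ T' ⊆ T, IsClosed T' ∧ IsIrreducible T' ∧ p ∈ T' ∧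
      (∀ x ∈ T', f x = 0) ∧ dim T ≤ dim T' + 1 := by
  have hc : Continuous (fun x : ι → K => xc x (f x)) := hf.cf ι id
  set U : Set (Option ι → K) := (fun x : ι → K => xc x (f x)) '' T
  have hUeq : U = (fun z => z ∘ some) ⁻¹' T ∩ {z | z none = f (z ∘ some)} := by
    ext z
    constructor
    · rintro ⟨x, hx, rfl⟩; exact ⟨hx, rfl⟩
    · rintro ⟨h1, h2⟩
      refine ⟨_, h1, ?_⟩
      funext o; rcases o with _ | o
      · exact h2.symm
      · rfl
  have hU : IsClosed U := by
    rw [hUeq]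
    refine (hT.preimage (continuous_re _)).inter ?_
    exact isClosed_pf_eq (PF.coord _) (hf.comp (fun k => PF.coord (some k)))
  have hUi : IsIrreducible U := hTi.image _ hc.continuousOn
  have hUinj : ∀ x ∈ U, ∀ x' ∈ U, x ∘ some = x' ∘ some → x = x' := by
    rintro _ ⟨x, hx, rfl⟩ _ ⟨x', hx', rfl⟩ h
    have : x = x' := h
    rw [this]
  obtain ⟨T1, h1, h2, h3, h4, h5, h6⟩ := z3_const hU hUi (p := xc p (f p)) ⟨p, hp, rfl⟩ none 0 hfp
  have hT1 : ∀ z ∈ T1, z ∘ some ∈ T ∧ z = xc (z ∘ some) (f (z ∘ some)) := by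
    intro z hz
    obtain ⟨x, hx, rfl⟩ := h1 hz
    exact ⟨hx, rfl⟩
  have himg : (fun z => z ∘ some) '' T1 = (fun x : ι → K => xc x (f x)) ⁻¹' T1 := by
    ext x
    constructor
    · rintro ⟨z, hz, rfl⟩
      change xc _ _ ∈ T1
      rw [← (hT1 z hz).2]; exact hz
    · intro hx; exact ⟨_, hx, rfl⟩
  refine ⟨(fun z => z ∘ some) '' T1, ?_, ?_, h3.image _ (continuous_re _).continuousOn, ⟨_, h4, rfl⟩, ?_, ?_⟩
  · rintro _ ⟨z, hz, rfl⟩; exact (hT1 z hz).1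
  · rw [himg]; exact h2.preimage hc
  · rintro _ ⟨z, hz, rfl⟩
    have := congrFun (hT1 z hz).2 none
    exact this.symm.trans (h5 z hz)
  · rw [dim_re_inj h2 some (fun x hx x' hx' => hUinj x (h1 hx) x' (h1 hx'))]
    have : dim U = dim T := by
      rw [← dim_re_inj hU some hUinj]
      congr 1
      rw [← image_comp]; exact image_id T
    omega

lemma z3_list (L : List ((ι → K) → K)) : ∀ (hL : ∀ f ∈ L, PF f) {T : Set (ι → K)} (hT : IsClosed T) (hTi : IsIrreducible T)
    {p : ι → K} (hp : p ∈ T) (hij : ∀ f ∈ L, f p = 0),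
    ∃ T' ⊆ T, IsClosed T' ∧ IsIrreducible T' ∧ p ∈ T' ∧
      (∀ f ∈ L, ∀ x ∈ T', f x = 0) ∧ dim T ≤ dim T' + L.length := by
  induction L with
  | nil => intro _ T hT hTi p hp _; exact ⟨T, Subset.rfl, hT, hTi, hp, by simp, by simp⟩
  | cons q L ih =>
    intro hL T hT hTi p hp h
    obtain ⟨T1, h1, h2, h3, h4, h5, h6⟩ := z3_poly hT hTi hp (hL q (by simp)) (h q (by simp))
    obtain ⟨T2, g1, g2, g3, g4, g5, g6⟩ := ih (fun f hf => hL f (by simp [hf])) h2 h3 h4 (fun q hq => h q (by simp [hq]))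
    refine ⟨T2, g1.trans h1, g2, g3, g4, ?_, ?_⟩
    · intro q' hq' x hx
      rcases List.mem_cons.1 hq' with rfl | hq'
      · exact h5 x (g1 hx)
      · exact g5 q' hq' x hx
    · simp only [List.length_cons]; omega

lemma z3_fam {α : Type*} [Finite α] (f : α → (ι → K) → K) (hL : ∀ a, PF (f a)) {T : Set (ι → K)} (hT : IsClosed T)
    (hTi : IsIrreducible T) {p : ι → K} (hp : p ∈ T) (hij : ∀ a, f a p = 0) :
    ∃ T' ⊆ T, IsClosed T' ∧ IsIrreducible T' ∧ p ∈ T' ∧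
      (∀ a, ∀ x ∈ T', f a x = 0) ∧ dim T ≤ dim T' + Nat.card α := by
  classical
  cases nonempty_fintype α
  obtain ⟨T', h1, h2, h3, h4, h5, h6⟩ := z3_list ((Finset.univ : Finset α).toList.map f)
    (by simpa using hL) hT hTi hp (by simpa using hij)
  exact ⟨T', h1, h2, h3, h4, by simpa using h5, by simpa using h6⟩

/-- graph over a closed set of a polynomial map -/
def gr {ι κ K : Type*} (φ : (ι → K) → (κ → K)) (A : Set (ι → K)) : Set (ι ⊕ κ → K) :=
  {z | z ∘ Sum.inl ∈ A ∧ ∀ k, z (Sum.inr k) = φ (z ∘ Sum.inl) k}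

lemma gr_closed {φ : (ι → K) → (κ → K)} (hφ : ∀ k, PF (fun x => φ x k)) {A : Set (ι → K)} (hA : IsClosed A) :
    IsClosed (gr φ A) := by
  refine (hA.preimage (continuous_re _)).inter ?_
  have : {z : ι ⊕ κ → K | ∀ k, z (Sum.inr k) = φ (z ∘ Sum.inl) k} =
    ⋂ k, {z : ι ⊕ κ → K | z (Sum.inr k) = φ (z ∘ Sum.inl) k} := by ext; simp
  rw [show (fun z : ι ⊕ κ → K => ∀ k, z (Sum.inr k) = φ (z ∘ Sum.inl) k) = _ from this]
  exact isClosed_iInter fun k => isClosed_pf_eq (PF.coord _) ((hφ k).comp (fun k => PF.coord (Sum.inl k)))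

lemma gr_inl (φ : (ι → K) → (κ → K)) (A : Set (ι → K)) : (fun z => z ∘ Sum.inl) '' gr φ A = A := by
  ext x
  constructor
  · rintro ⟨z, hz, rfl⟩; exact hz.1
  · intro hx; exact ⟨Sum.elim x (φ x), ⟨by simpa using hx, by simp⟩, by simp⟩

lemma gr_inr (φ : (ι → K) → (κ → K)) (A : Set (ι → K)) : (fun z => z ∘ Sum.inr) '' gr φ A = φ '' A := by
  ext x
  constructor
  · rintro ⟨z, hz, rfl⟩; exact ⟨_, hz.1, by funext k; exact (hz.2 k).symm⟩
  · rintro ⟨x, hx, rfl⟩; exact ⟨Sum.elim x (φ x), ⟨by simpa using hx, by simp⟩, by simp⟩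

lemma gr_ext {φ : (ι → K) → (κ → K)} {A : Set (ι → K)} {x x' : ι ⊕ κ → K} (hx : x ∈ gr φ A) (hx' : x' ∈ gr φ A)
    (h : x ∘ Sum.inl = x' ∘ Sum.inl) : x = x' := by
  funext k
  rcases k with k | k
  · exact congrFun h k
  · rw [hx.2, hx'.2, h]

lemma gr_dim {φ : (ι → K) → (κ → K)} (hφ : ∀ k, PF (fun x => φ x k)) {A : Set (ι → K)} (hA : IsClosed A) :
    dim (gr φ A) = dim A := by
  rw [← dim_re_inj (gr_closed hφ hA) Sum.inl (fun x hx x' hx' h => gr_ext hx hx' h), gr_inl]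

lemma dim_poly_le {φ : (ι → K) → (κ → K)} (hφ : ∀ k, PF (fun x => φ x k)) (A : Set (ι → K)) :
    dim (φ '' A) ≤ dim A := by
  calc dim (φ '' A) ≤ dim (φ '' closure A) := dim_mono (image_mono subset_closure)
    _ = dim ((fun z => z ∘ Sum.inr) '' gr φ (closure A)) := by rw [gr_inr]
    _ ≤ dim (gr φ (closure A)) := dim_re_le _ _
    _ = dim (closure A) := gr_dim hφ isClosed_closure
    _ = dim A := dim_closure A

lemma dim_poly_fib {φ : (ι → K) → (κ → K)} (hφ : ∀ k, PF (fun x => φ x k)) {A : Set (ι → K)} (hA : IsClosed A)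
    (hf : ∀ y, (A ∩ {x | φ x = y}).Finite) : dim A ≤ dim (φ '' A) := by
  rw [← gr_dim hφ hA, ← gr_inr]
  apply dim_fib (gr_closed hφ hA)
  intro y
  refine Set.Finite.of_finite_image ((hf y).subset ?_) (f := fun z => z ∘ Sum.inl) ?_
  · rintro _ ⟨z, ⟨hz, hzy⟩, rfl⟩
    refine ⟨hz.1, ?_⟩
    rw [← show z ∘ Sum.inr = y from hzy]
    funext k; exact (hz.2 k).symm
  · intro x hx x' hx' h
    exact gr_ext hx.1 hx'.1 h

lemma dom_poly_open {φ : (ι → K) → (κ → K)} (hφ : ∀ k, PF (fun x => φ x k)) {A : Set (ι → K)} (hA : IsClosed A)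
    (hd : Dense (φ '' A)) : ∃ F : Set (κ → K), IsClosed F ∧ F ≠ univ ∧ ∀ y, y ∉ F → ∃ x ∈ A, φ x = y := by
  rw [← gr_inr] at hd
  have hd : Dom Sum.inr (gr φ A) := hd
  obtain ⟨F, h1, h2, h3⟩ := hd.open (gr_closed hφ hA)
  refine ⟨F, h1, h2, fun y hy => ?_⟩
  obtain ⟨z, hz, rfl⟩ := h3 y hy
  exact ⟨_, hz.1, by funext k; exact (hz.2 k).symm⟩

/-- Rabinowitsch set -/
def rab {ι K : Type*} [Field K] (h : (ι → K) → K) (A : Set (ι → K)) : Set (Option ι → K) :=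
  {z | z ∘ some ∈ A ∧ z none * h (z ∘ some) = 1}

lemma rab_closed {h : (ι → K) → K} (hh : PF h) {A : Set (ι → K)} (hA : IsClosed A) : IsClosed (rab h A) :=
  (hA.preimage (continuous_re _)).inter
    (isClosed_pf_eq ((PF.coord _).mul (hh.comp (fun k => PF.coord (some k)))) (PF.const 1))

lemma rab_image (h : (ι → K) → K) (A : Set (ι → K)) :
    (fun z => z ∘ some) '' rab h A = {x ∈ A | h x ≠ 0} := by
  ext x
  constructor
  · rintro ⟨z, hz, rfl⟩
    refine ⟨hz.1, fun h0 => ?_⟩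
    have := hz.2
    simp only at h0
    rw [h0] at this; simp at this
  · rintro ⟨hx, hx0⟩
    exact ⟨xc x (h x)⁻¹, ⟨hx, inv_mul_cancel₀ hx0⟩, rfl⟩

lemma rab_ext {h : (ι → K) → K} {A : Set (ι → K)} {x x' : Option ι → K} (hx : x ∈ rab h A) (hx' : x' ∈ rab h A)
    (hh : x ∘ some = x' ∘ some) : x = x' := by
  funext o
  rcases o with _ | o
  · have h1 := hx.2
    have h2 := hx'.2
    rw [← hh] at h2
    have h0 : h (x ∘ some) ≠ 0 := by intro h0; rw [h0] at h1; simp at h1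
    exact mul_right_cancel₀ h0 (h1.trans h2.symm)
  · exact congrFun hh o

lemma dense_lc_open {φ : (ι → K) → (κ → K)} (hφ : ∀ k, PF (fun x => φ x k)) {A : Set (ι → K)} (hA : IsClosed A)
    {h : (ι → K) → K} (hh : PF h) (hd : Dense (φ '' {x ∈ A | h x ≠ 0})) :
    ∃ F : Set (κ → K), IsClosed F ∧ F ≠ univ ∧ ∀ y, y ∉ F → ∃ x ∈ A, h x ≠ 0 ∧ φ x = y := by
  rw [← rab_image, ← image_comp] at hd
  obtain ⟨F, h1, h2, h3⟩ := dom_poly_open (φ := φ ∘ (fun z => z ∘ some))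
    (fun k => (hφ k).comp (fun i => PF.coord (some i))) (rab_closed hh hA) hd
  refine ⟨F, h1, h2, fun y hy => ?_⟩
  obtain ⟨z, hz, rfl⟩ := h3 y hy
  have : z ∘ some ∈ {x ∈ A | h x ≠ 0} := by rw [← rab_image]; exact ⟨z, hz, rfl⟩
  exact ⟨_, this.1, this.2, rfl⟩

lemma dim_lc_fib {φ : (ι → K) → (κ → K)} (hφ : ∀ k, PF (fun x => φ x k)) {A : Set (ι → K)} (hA : IsClosed A)
    {h : (ι → K) → K} (hh : PF h) (hf : ∀ y, {x ∈ A | h x ≠ 0 ∧ φ x = y}.Finite) :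
    dim {x ∈ A | h x ≠ 0} ≤ dim (φ '' {x ∈ A | h x ≠ 0}) := by
  have h1 := dim_poly_fib (φ := φ ∘ (fun z => z ∘ some))
    (fun k => (hφ k).comp (fun i => PF.coord (some i))) (rab_closed hh hA) (by
      intro y
      refine Set.Finite.of_finite_image ((hf y).subset ?_) (f := fun z => z ∘ some) ?_
      · rintro _ ⟨z, ⟨hz, hzy⟩, rfl⟩
        have : z ∘ some ∈ {x ∈ A | h x ≠ 0} := by rw [← rab_image]; exact ⟨z, hz, rfl⟩
        exact ⟨this.1, this.2, hzy⟩
      · intro x hx x' hx' h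
        exact rab_ext hx.1 hx'.1 h)
  rw [image_comp, rab_image] at h1
  refine le_trans ?_ h1
  rw [← rab_image]
  exact dim_re_le _ _

lemma dim_open_irred {A : Set (ι → K)} (hA : IsClosed A) (hAi : IsIrreducible A) {N : Set (ι → K)} (hN : IsClosed N)
    (h : ¬ A ⊆ N) : dim (A \ N) = dim A ∧ closure (A \ N) = A := by
  have h1 : closure (A \ N) = A := by
    apply (closure_minimal diff_subset hA).antisymm
    have : A ⊆ N ∪ closure (A \ N) := by
      intro x hx
      by_cases hx2 : x ∈ N
      · exact Or.inl hx2
      · exact Or.inr (subset_closure ⟨hx, hx2⟩)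
    rcases irred_sub_union hAi hN isClosed_closure this with h' | h'
    · exact absurd h' h
    · exact h'
  exact ⟨by rw [← dim_closure, h1], h1⟩

lemma zero_ne_univ {f : MvPolynomial ι K} (hf : f ≠ 0) : {x : ι → K | MvPolynomial.eval x f = 0} ≠ univ := by
  intro h
  apply hf
  apply MvPolynomial.funext
  intro x
  have : x ∈ {x : ι → K | MvPolynomial.eval x f = 0} := h ▸ mem_univ x
  simpa using this

lemma dim_lt_card {A : Set (ι → K)} (hA : IsClosed A) (h : A ≠ univ) (hne : A.Nonempty) : dim A < Nat.card ι := by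
  refine lt_of_le_of_ne (dim_le_card A) (fun he => h ?_)
  have := dense_iff_closure_eq.1 (dense_of_dim hne he)
  rwa [hA.closure_eq] at this

lemma zero_comp {f : MvPolynomial ι K} {p : ι → K} (hp : MvPolynomial.eval p f = 0) :
    ∃ T, IsClosed T ∧ IsIrreducible T ∧ p ∈ T ∧ (∀ x ∈ T, MvPolynomial.eval x f = 0) ∧ Nat.card ι ≤ dim T + 1 := by
  obtain ⟨T, h1, h2, h3, h4, h5, h6⟩ := z3_poly (T := (univ : Set (ι → K))) isClosed_univ
    (IrreducibleSpace.isIrreducible_univ _) (mem_univ p) (PF.poly f) hp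
  exact ⟨T, h2, h3, h4, h5, by rwa [dim_univ] at h6⟩

lemma null_dvd {Q g : MvPolynomial ι K} (hQ : Irreducible Q) (h : ∀ x, MvPolynomial.eval x Q = 0 → MvPolynomial.eval x g = 0) :
    Q ∣ g := by
  have h1 : g ∈ MvPolynomial.vanishingIdeal K (MvPolynomial.zeroLocus K (Ideal.span {Q})) := by
    rw [MvPolynomial.mem_vanishingIdeal_iff]
    intro x hx
    rw [MvPolynomial.mem_zeroLocus_iff] at hx
    have := h x (by simpa [MvPolynomial.aeval_eq_eval] using hx Q (Ideal.mem_span_singleton_self Q))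
    simpa [MvPolynomial.aeval_eq_eval] using this
  rw [MvPolynomial.vanishingIdeal_zeroLocus_eq_radical] at h1
  have hp : (Ideal.span {Q}).IsPrime := (Ideal.span_singleton_prime hQ.ne_zero).2 hQ.prime
  rw [hp.radical] at h1
  exact Ideal.mem_span_singleton.1 h1

/-- an irreducible closed set in a zero set is in zero set of an irreducible factor -/
lemma exists_irred_factor {T : Set (ι → K)} (hTi : IsIrreducible T) : ∀ {f : MvPolynomial ι K} (hf : f ≠ 0)
    (h : ∀ x ∈ T, MvPolynomial.eval x f = 0), ∃ Q, Irreducible Q ∧ Q ∣ f ∧ ∀ x ∈ T, MvPolynomial.eval x Q = 0 := by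
  intro f
  induction f using WfDvdMonoid.induction_on_irreducible with
  | zero => intro h; exact absurd rfl h
  | unit u hu =>
    intro _ h
    exfalso
    obtain ⟨x, hx⟩ := hTi.1
    have := (hu.map (MvPolynomial.eval x)).ne_zero
    exact this (h x hx)
  | mul a i ha hi ih =>
    intro hf h
    have hs : T ⊆ {x | MvPolynomial.eval x i = 0} ∪ {x | MvPolynomial.eval x a = 0} := by
      intro x hx
      have := h x hx
      rw [map_mul, mul_eq_zero] at this
      exact this
    rcases irred_sub_union hTi (isClosed_alg i) (isClosed_alg a) hs with h' | h'
    · exact ⟨i, hi, dvd_mul_right _ _, h'⟩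
    · obtain ⟨Q, h1, h2, h3⟩ := ih ha h'
      exact ⟨Q, h1, h2.mul_left _, h3⟩

end ZG

set_option linter.all false
open Topology
namespace ZG
open Set

variable {K : Type*} [Field K] [ZG K] [IsAlgClosed K]
variable {ι κ μ : Type} [Finite ι] [Finite κ] [Finite μ]

lemma exists_roots {F : Type*} [Field F] [IsAlgClosed F] (P : Polynomial F) (hP : P.Monic) {e : ℕ} (he : P.natDegree = e) :
    ∃ z : Fin e → F, P = ∏ i, (Polynomial.X - Polynomial.C (z i)) := by
  have hs := IsAlgClosed.splits P
  have h1 := hs.eq_prod_roots_of_monic hP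
  have h2 := hs.natDegree_eq_card_roots
  obtain ⟨l, hl⟩ : ∃ l : List F, (l : Multiset F) = P.roots := ⟨_, Multiset.coe_toList _⟩
  rw [← hl] at h1 h2
  rw [he] at h2
  simp only [Multiset.coe_card] at h2
  subst h2
  refine ⟨fun i => l[i], ?_⟩
  rw [h1]
  simp only [Multiset.map_coe, Multiset.prod_coe]
  exact (Fin.prod_univ_fun_getElem l (fun a => Polynomial.X - Polynomial.C a)).symm

lemma eq_prod_of_eval {F : Type*} [Field F] (P : Polynomial F) (hP : P.Monic) {e : ℕ} (he : P.natDegree = e)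
    (t : Fin e → F) (ht : Function.Injective t) (z : Fin e → F)
    (h : ∀ k, P.eval (t k) = ∏ i, (t k - z i)) : P = ∏ i, (Polynomial.X - Polynomial.C (z i)) := by
  classical
  apply Polynomial.eq_of_degree_sub_lt_of_eval_index_eq (Finset.univ : Finset (Fin e)) ht.injOn
  · have hm : (∏ i, (Polynomial.X - Polynomial.C (z i))).Monic := Polynomial.monic_prod_of_monic _ _ (fun i _ => Polynomial.monic_X_sub_C _)
    have hd : (∏ i, (Polynomial.X - Polynomial.C (z i))).degree = (e : WithBot ℕ) := by
      rw [Polynomial.degree_prod]; simp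
    have : P.degree = (e : WithBot ℕ) := by rw [Polynomial.degree_eq_natDegree hP.ne_zero, he]
    have := Polynomial.degree_sub_lt (this.trans hd.symm) hP.ne_zero (by rw [hP.leadingCoeff, hm.leadingCoeff])
    rw [Polynomial.degree_eq_natDegree hP.ne_zero, he] at this
    simpa using this
  · intro k _
    rw [h k, Polynomial.eval_prod]; simp

lemma closed_map_aux {e : ℕ} (P : (ι → K) → Polynomial K) (hm : ∀ b, (P b).Monic) (hd : ∀ b, (P b).natDegree = e)
    (hpf : ∀ t, PF (fun b => (P b).eval t)) {D : Set (Option ι → K)} (hD : IsClosed D) (hDi : IsIrreducible D)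
    (hDP : ∀ z ∈ D, (P (z ∘ some)).eval (z none) = 0) : IsClosed ((fun z => z ∘ some) '' D) := by
  classical
  apply isClosed_of_closure_subset
  set B := closure ((fun z => z ∘ some) '' D) with hB
  have hBc : IsClosed B := isClosed_closure
  have hBi : IsIrreducible B := cl_image_irred hDi _
  intro b hb
  obtain ⟨z0, hz0⟩ := exists_roots (P b) (hm b) (hd b)
  obtain ⟨t, ht⟩ : ∃ t : Fin e → K, Function.Injective t := by
    have : Infinite K := IsAlgClosed.instInfinite
    exact ⟨fun i => Infinite.natEmbedding K i, fun i j h => Fin.ext ((Infinite.natEmbedding K).injective h)⟩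
  let f : Fin e → (ι ⊕ Fin e → K) → K := fun k x => (P (x ∘ Sum.inl)).eval (t k) - ∏ i, (t k - x (Sum.inr i))
  have hf : ∀ k, PF (f k) := fun k => ((hpf (t k)).comp (fun i => PF.coord (Sum.inl i))).sub
    (PF.prod _ (fun i _ => (PF.const _).sub (PF.coord _)))
  obtain ⟨T, hTs, hTc, hTi, hTp, hTe, hTd⟩ := z3_fam f hf (pr_closed hBc isClosed_univ)
    (pr_irred hBi (IrreducibleSpace.isIrreducible_univ (Fin e → K))) (p := Sum.elim b z0) (by simp [hb]) (by
      intro k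
      simp [f, hz0, Polynomial.eval_prod])
  rw [dim_pr hBi.1 ⟨0, mem_univ _⟩, dim_univ] at hTd
  have hdT : dim B ≤ dim T := by omega
  have hTP : ∀ x ∈ T, P (x ∘ Sum.inl) = ∏ i, (Polynomial.X - Polynomial.C (x (Sum.inr i))) := by
    intro x hx
    exact eq_prod_of_eval _ (hm _) (hd _) t ht _ (fun k => sub_eq_zero.1 (hTe k x hx))
  have hfin : ∀ y, (T ∩ {x | x ∘ Sum.inl = y}).Finite := by
    intro y
    have hR : (((P y).roots.toFinset : Set K)).Finite := Finset.finite_toSet _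
    have hpi : (Set.pi univ (fun _ : Fin e => ((P y).roots.toFinset : Set K))).Finite := Set.Finite.pi' (fun _ => hR) |>.subset (by
      intro x hx i; exact hx i (mem_univ i))
    refine Set.Finite.of_finite_image (f := fun x => x ∘ Sum.inr) (hpi.subset ?_) ?_
    · rintro _ ⟨x, ⟨hx, hxy⟩, rfl⟩ i _
      simp only [Finset.mem_coe, Multiset.mem_toFinset, Polynomial.mem_roots (hm y).ne_zero]
      have hxy : x ∘ Sum.inl = y := hxy
      rw [← hxy, hTP x hx, Polynomial.IsRoot, Polynomial.eval_prod]
      apply Finset.prod_eq_zero (Finset.mem_univ i); simp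
    · rintro x ⟨_, hx⟩ x' ⟨_, hx'⟩ h
      have h1 : x ∘ Sum.inl = x' ∘ Sum.inl := Eq.trans hx (Eq.symm hx')
      funext k
      rcases k with k | k
      · exact congrFun h1 k
      · exact congrFun h k
  have hdim : dim T ≤ dim ((fun x => x ∘ Sum.inl) '' T) := dim_fib hTc _ hfin
  have himB : (fun x => x ∘ Sum.inl) '' T ⊆ B := by
    rintro _ ⟨x, hx, rfl⟩; exact (hTs hx).1
  have hclT : closure ((fun x => x ∘ Sum.inl) '' T) = B := by
    apply eq_of_dim isClosed_closure (hTi.1.image _).closure hBc hBi (closure_minimal himB hBc)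
    rw [dim_closure ((fun x => x ∘ Sum.inl) '' T)]; exact hdT.trans hdim
  let r : Fin e → Option ι → ι ⊕ Fin e := fun j o => o.elim (Sum.inr j) Sum.inl
  set T' := T ∩ ⋃ j, (fun z => z ∘ r j) ⁻¹' D with hT'
  have hT'c : IsClosed T' := hTc.inter (isClosed_iUnion_of_finite fun j => hD.preimage (continuous_re (r j)))
  obtain ⟨F, hF, hF1, hF2⟩ := Z1' (Sum.inl : ι → ι ⊕ Fin e) T hTc hTi.1
  obtain ⟨F', hF', hF1', hF2'⟩ := Z1' (some : ι → Option ι) D hD hDi.1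
  rw [hclT] at hF1 hF2
  have hcov : B ⊆ (F ∪ F') ∪ closure ((fun x => x ∘ Sum.inl) '' T') := by
    intro y hy
    by_cases h1 : y ∈ F
    · exact Or.inl (Or.inl h1)
    by_cases h2 : y ∈ F'
    · exact Or.inl (Or.inr h2)
    right
    obtain ⟨t, ht, hty⟩ := hF2 ⟨hy, h1⟩
    obtain ⟨d, hd, hdy⟩ := hF2' ⟨hy, h2⟩
    apply subset_closure
    refine ⟨t, ⟨ht, ?_⟩, hty⟩
    have e1 : t ∘ Sum.inl = d ∘ some := hty.trans hdy.symm
    have h3 := hDP d hd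
    rw [← e1, hTP t ht, Polynomial.eval_prod, Finset.prod_eq_zero_iff] at h3
    obtain ⟨j, _, hj⟩ := h3
    simp only [Polynomial.eval_sub, Polynomial.eval_X, Polynomial.eval_C, sub_eq_zero] at hj
    refine mem_iUnion.2 ⟨j, ?_⟩
    have : t ∘ r j = d := by
      funext o
      rcases o with _ | k
      · exact hj.symm
      · exact congrFun e1 k
    change t ∘ r j ∈ D
    rw [this]; exact hd
  have hBcl : B ⊆ closure ((fun x => x ∘ Sum.inl) '' T') := by
    rcases irred_sub_union hBi (hF.union hF') isClosed_closure hcov with h | h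
    · exfalso
      rcases irred_sub_union hBi hF hF' h with h | h
      · exact hF1.2 h
      · exact hF1'.2 h
    · exact h
  have hne' : T'.Nonempty := by
    have : ((fun x => x ∘ Sum.inl) '' T').Nonempty := closure_nonempty_iff.1 ⟨b, hBcl hb⟩
    exact this.of_image
  have : T' = T := by
    apply eq_of_dim hT'c hne' hTc hTi inter_subset_left
    calc dim T ≤ _ := hdim
      _ ≤ dim B := dim_mono himB
      _ ≤ _ := dim_mono hBcl
      _ = _ := dim_closure _
      _ ≤ _ := dim_re_le _ _
  have hp : Sum.elim b z0 ∈ T' := by rw [this]; exact hTp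
  obtain ⟨j, hj⟩ := mem_iUnion.1 hp.2
  exact ⟨_, hj, rfl⟩

lemma closed_map {e : ℕ} (P : (ι → K) → Polynomial K) (hm : ∀ b, (P b).Monic) (hd : ∀ b, (P b).natDegree = e)
    (hpf : ∀ t, PF (fun b => (P b).eval t)) {D : Set (Option ι → K)} (hD : IsClosed D)
    (hDP : ∀ z ∈ D, (P (z ∘ some)).eval (z none) = 0) : IsClosed ((fun z => z ∘ some) '' D) := by
  obtain ⟨Fm, hFf, hFc, hFi, rfl⟩ := finite_decomp hD
  rw [sUnion_eq_biUnion, image_iUnion₂]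
  apply hFf.isClosed_biUnion
  intro A hA
  exact closed_map_aux P hm hd hpf (hFc A hA) (hFi A hA) (fun z hz => hDP z ⟨A, hA, hz⟩)

end ZG

set_option linter.all false
open Topology
namespace ZG
open Set

section Bezout
open MvPolynomial
variable {F : Type*} [Field F]

noncomputable abbrev VV (F : Type*) [Field F] (M : ℕ) := restrictTotalDegree (Fin 2) F M

def expSet (M : ℕ) : Set (Fin 2 →₀ ℕ) := {n | n.degree ≤ M}

noncomputable def expEquiv (M : ℕ) : (expSet M) ≃ (Σ i : Fin (M+1), Fin (M + 1 - i)) where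
  toFun n := ⟨⟨n.1 0, by have := n.2; simp [expSet, Finsupp.degree_eq_sum] at this; omega⟩,
    ⟨n.1 1, by have := n.2; simp [expSet, Finsupp.degree_eq_sum] at this; simp; omega⟩⟩
  invFun q := ⟨Finsupp.equivFunOnFinite.symm ![(q.1 : ℕ), (q.2 : ℕ)], by
    have h1 := q.1.2
    have h2 := q.2.2
    simp [expSet, Finsupp.degree_eq_sum]; omega⟩
  left_inv n := by
    apply Subtype.ext
    ext k; fin_cases k <;> simp
  right_inv q := by
    rcases q with ⟨⟨i, hi⟩, ⟨j, hj⟩⟩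
    simp

instance (M : ℕ) : Finite (expSet M) := Finite.of_equiv _ (expEquiv M).symm

lemma card_expSet (M : ℕ) : 2 * Nat.card (expSet M) = (M + 1) * (M + 2) := by
  rw [Nat.card_congr (expEquiv M)]
  simp only [Nat.card_eq_fintype_card, Fintype.card_sigma, Fintype.card_fin]
  rw [Fin.sum_univ_eq_sum_range (fun i => M + 1 - i) (M + 1), ← Finset.sum_range_reflect]
  have : ∀ j ∈ Finset.range (M + 1), M + 1 - (M + 1 - 1 - j) = j + 1 := by
    intro j hj; rw [Finset.mem_range] at hj; omega
  rw [Finset.sum_congr rfl this]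
  clear this
  induction M with
  | zero => simp
  | succ n ih => rw [Finset.sum_range_succ, mul_add, ih]; ring

instance (M : ℕ) : Module.Finite F (VV F M) := by
  have b := MvPolynomial.basisRestrictSupport F (expSet M)
  exact Module.Finite.of_basis b

lemma finrank_VV (M : ℕ) : 2 * Module.finrank F (VV F M) = (M + 1) * (M + 2) := by
  rw [← card_expSet]
  have b := MvPolynomial.basisRestrictSupport F (expSet M)
  have := Module.finrank_eq_nat_card_basis b
  rw [← this]; rfl

lemma interp (P : Finset (Fin 2 → F)) (p : Fin 2 → F) :
    ∃ g : MvPolynomial (Fin 2) F, g.totalDegree ≤ P.card ∧ eval p g = 1 ∧ ∀ q ∈ P, q ≠ p → eval q g = 0 := by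
  classical
  have hk : ∀ q : Fin 2 → F, ∃ k : Fin 2, q ≠ p → p k ≠ q k := by
    intro q
    by_cases h : q = p
    · exact ⟨0, fun h' => absurd h h'⟩
    · obtain ⟨k, hk⟩ := Function.ne_iff.1 h
      exact ⟨k, fun _ => hk.symm⟩
  choose k hk using hk
  refine ⟨∏ q ∈ P.erase p, (C (p (k q) - q (k q))⁻¹ * (X (k q) - C (q (k q)))), ?_, ?_, ?_⟩
  · refine (totalDegree_finset_prod _ _).trans ?_
    calc _ ≤ ∑ q ∈ P.erase p, 1 := by
          apply Finset.sum_le_sum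
          intro q _
          refine (totalDegree_mul _ _).trans ?_
          rw [totalDegree_C, zero_add]
          refine (totalDegree_sub _ _).trans ?_
          simp
      _ ≤ P.card := by simp; exact Finset.card_erase_le
  · rw [map_prod]
    apply Finset.prod_eq_one
    intro q hq
    have := hk q (Finset.ne_of_mem_erase hq)
    simp [sub_ne_zero.2 this]
  · intro q hq hqp
    rw [map_prod]
    apply Finset.prod_eq_zero (Finset.mem_erase.2 ⟨hqp, hq⟩)
    simp

lemma bezout {G f : MvPolynomial (Fin 2) F} (hG : Irreducible G) (hf : ¬ G ∣ f) (P : Finset (Fin 2 → F))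
    (hP : ∀ p ∈ P, eval p G = 0 ∧ eval p f = 0) : P.card ≤ G.totalDegree * f.totalDegree := by
  classical
  have hf0 : f ≠ 0 := fun h => hf (h ▸ dvd_zero _)
  set d := G.totalDegree with hd
  set m := f.totalDegree with hm
  set N := P.card
  set M := d + m + N with hM
  -- evaluation
  let ev : VV F M →ₗ[F] (P → F) := LinearMap.pi (fun p => (MvPolynomial.aeval (R := F) (p : Fin 2 → F)).toLinearMap ∘ₗ (VV F M).subtype)
  have hev : ∀ g p, ev g p = eval (p : Fin 2 → F) (g : MvPolynomial (Fin 2) F) := fun g p => by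
    simp [ev, MvPolynomial.aeval_eq_eval]
  have hsurj : Function.Surjective ev := by
    intro c
    choose g hg1 hg2 hg3 using interp P
    have hmem : ∑ p : P, C (c p) * g p ∈ VV F M := by
      apply Submodule.sum_mem
      intro p _
      rw [mem_restrictTotalDegree]
      refine (totalDegree_mul _ _).trans ?_
      rw [totalDegree_C, zero_add]
      refine (hg1 _).trans ?_
      omega
    refine ⟨⟨_, hmem⟩, ?_⟩
    funext q
    rw [hev]
    simp only [map_sum, map_mul, eval_C]
    rw [Finset.sum_eq_single q]
    · rw [hg2, mul_one]
    · intro p _ hpq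
      rw [hg3 _ _ q.2, mul_zero]
      intro h; exact hpq (Subtype.ext h.symm)
    · simp
  let α : (VV F (M - d)) × (VV F (M - m)) →ₗ[F] VV F M :=
    LinearMap.codRestrict _ (LinearMap.coprod ((LinearMap.mulLeft F G) ∘ₗ Submodule.subtype _)
      ((LinearMap.mulLeft F f) ∘ₗ Submodule.subtype _)) (by
      rintro ⟨a, b⟩
      have ha := (mem_restrictTotalDegree _ _ _).1 a.2
      have hb := (mem_restrictTotalDegree _ _ _).1 b.2
      rw [mem_restrictTotalDegree]
      refine (totalDegree_add _ _).trans (max_le ?_ ?_)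
      · refine (totalDegree_mul _ _).trans ?_
        simp only [Submodule.subtype_apply, LinearMap.fst_apply, LinearMap.snd_apply]; omega
      · refine (totalDegree_mul _ _).trans ?_
        simp only [Submodule.subtype_apply, LinearMap.fst_apply, LinearMap.snd_apply]; omega)
  have hα : ∀ a b, (α (a, b) : MvPolynomial (Fin 2) F) = G * a + f * b := fun a b => rfl
  let β : VV F (M - d - m) →ₗ[F] (VV F (M - d)) × (VV F (M - m)) :=
    LinearMap.prod (LinearMap.codRestrict _ (-(LinearMap.mulLeft F f) ∘ₗ Submodule.subtype _) (by
      intro c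
      have hc := (mem_restrictTotalDegree _ _ _).1 c.2
      rw [mem_restrictTotalDegree]
      simp only [LinearMap.neg_apply, LinearMap.coe_comp, Function.comp, Submodule.subtype_apply, LinearMap.mulLeft_apply, totalDegree_neg]
      refine (totalDegree_mul _ _).trans ?_
      omega)) (LinearMap.codRestrict _ ((LinearMap.mulLeft F G) ∘ₗ Submodule.subtype _) (by
      intro c
      have hc := (mem_restrictTotalDegree _ _ _).1 c.2
      rw [mem_restrictTotalDegree]
      simp only [LinearMap.coe_comp, Function.comp, Submodule.subtype_apply, LinearMap.mulLeft_apply]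
      refine (totalDegree_mul _ _).trans ?_
      omega))
  have hker : LinearMap.ker α ≤ LinearMap.range β := by
    rintro ⟨a, b⟩ hab
    have h : G * (a : MvPolynomial (Fin 2) F) + f * b = 0 := by
      rw [← hα, LinearMap.mem_ker.1 hab]; rfl
    have h1 : G ∣ f * b := ⟨-a, by linear_combination h⟩
    rcases hG.prime.dvd_or_dvd h1 with h1 | ⟨c, hc⟩
    · exact absurd h1 hf
    have ha : (a : MvPolynomial (Fin 2) F) = -(f * c) := by
      apply mul_left_cancel₀ hG.ne_zero
      rw [hc] at h
      linear_combination h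
    have hcd : c ∈ VV F (M - d - m) := by
      rw [mem_restrictTotalDegree]
      by_cases hc0 : c = 0
      · simp [hc0]
      have hb := (mem_restrictTotalDegree _ _ _).1 b.2
      rw [hc, totalDegree_mul_of_isDomain hG.ne_zero hc0] at hb
      omega
    refine ⟨⟨c, hcd⟩, ?_⟩
    apply Prod.ext
    · apply Subtype.ext; rw [ha]; simp [β]
    · apply Subtype.ext; rw [hc]; rfl
  have hrange : LinearMap.range α ≤ LinearMap.ker ev := by
    rintro _ ⟨⟨a, b⟩, rfl⟩
    rw [LinearMap.mem_ker]
    funext p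
    rw [hev, hα]
    simp [(hP p p.2).1, (hP p p.2).2]
  have e1 := LinearMap.finrank_range_add_finrank_ker ev
  rw [LinearMap.range_eq_top.2 hsurj, finrank_top] at e1
  simp only [Module.finrank_fintype_fun_eq_card, Fintype.card_coe] at e1
  have e2 := LinearMap.finrank_range_add_finrank_ker α
  rw [Module.finrank_prod] at e2
  have e3 := Submodule.finrank_mono hrange
  have e4 := Submodule.finrank_mono hker
  have e5 := LinearMap.finrank_range_le β
  have f1 := finrank_VV (F := F) M
  have f2 := finrank_VV (F := F) (M - d)
  have f3 := finrank_VV (F := F) (M - m)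
  have f4 := finrank_VV (F := F) (M - d - m)
  have g1 : M - d = m + N := by omega
  have g2 : M - m = d + N := by omega
  have g3 : M - d - m = N := by omega
  have f1' : 2 * Module.finrank F (VV F M) = (d + m + N + 1) * (d + m + N + 2) := by rw [f1]
  have f2' : 2 * Module.finrank F (VV F (M - d)) = (m + N + 1) * (m + N + 2) := by rw [f2, g1]
  have f3' : 2 * Module.finrank F (VV F (M - m)) = (d + N + 1) * (d + N + 2) := by rw [f3, g2]
  have f4' : 2 * Module.finrank F (VV F (M - d - m)) = (N + 1) * (N + 2) := by rw [f4, g3]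
  have : 2 * N ≤ 2 * (d * m) := by
    have h2 : 2 * N + (m + N + 1) * (m + N + 2) + (d + N + 1) * (d + N + 2) ≤
      (d + m + N + 1) * (d + m + N + 2) + (N + 1) * (N + 2) := by
      rw [← f1', ← f2', ← f3', ← f4']; omega
    nlinarith
  omega

end Bezout
end ZG

set_option linter.all false
open Topology
namespace ZG
open Set
open MvPolynomial
variable {K : Type*} [Field K] [ZG K] [IsAlgClosed K] {ι κ μ : Type} [Finite ι] [Finite κ] [Finite μ]

lemma inf_of_dim {A : Set (ι → K)} (h : dim A ≠ 0) : A.Infinite := fun hf => h (dim_finite hf)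

lemma exists_inj_pts {α : Type*} {A : Set α} (h : A.Infinite) (r : ℕ) :
    ∃ p : Fin r → α, Function.Injective p ∧ ∀ i, p i ∈ A := by
  haveI := h.to_subtype
  let e := Infinite.natEmbedding A
  refine ⟨fun i => (e i : α), ?_, fun i => (e i).2⟩
  intro i j hij
  exact Fin.ext (e.injective (Subtype.ext hij))

lemma C1 {S : Type} [Fintype S] (b : S → MvPolynomial (Fin 2) K) {F : MvPolynomial (Fin 2) K} {r : ℕ}
    (hS : Nat.card S = r + 1)
    (hB : ∀ v : S → K, v ≠ 0 → {p : Fin 2 → K | eval p F = 0 ∧ ∑ n, v n * eval p (b n) = 0}.Finite)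
    {C C' : Set (Fin 2 → K)} (hC : IsClosed C) (hCi : IsIrreducible C) (hCd : dim C = 1)
    (hC' : IsClosed C') (hF : {p | eval p F = 0} = C ∪ C') (hCC : ¬ C ⊆ C') :
    ∃ N : Set (S → K), IsClosed N ∧ N ≠ univ ∧ ∀ v, v ∉ N → ∃ P : Finset (Fin 2 → K), P.card = r ∧
      ∀ p ∈ P, p ∈ C ∧ ∑ n, v n * eval p (b n) = 0 := by
  classical
  have hinf : (C \ C').Infinite := inf_of_dim (by
    rw [(dim_open_irred hC hCi hC' hCC).1, hCd]; exact one_ne_zero)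
  obtain ⟨p, hpi, hp⟩ := exists_inj_pts hinf r
  obtain ⟨v0, hv0, hv0n⟩ : ∃ v0 : S → K, (∀ i, ∑ n, v0 n * eval (p i) (b n) = 0) ∧ v0 ≠ 0 := by
    let L : (S → K) →ₗ[K] (Fin r → K) := 
      { toFun := fun v i => ∑ n, v n * eval (p i) (b n)
        map_add' := by intro v w; funext i; simp [add_mul, Finset.sum_add_distrib]
        map_smul' := by intro c v; funext i; simp [Finset.mul_sum, mul_assoc] }
    have : LinearMap.ker L ≠ ⊥ := LinearMap.ker_ne_bot_of_finrank_lt (by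
      simp only [Module.finrank_fintype_fun_eq_card, Fintype.card_fin]
      rw [← Nat.card_eq_fintype_card, hS]; omega)
    obtain ⟨v, hv, hvn⟩ := (Submodule.ne_bot_iff _).1 this
    exact ⟨v, fun i => congrFun (LinearMap.mem_ker.1 hv) i, hvn⟩
  obtain ⟨n0, hn0⟩ := Function.ne_iff.1 hv0n
  let f : (Fin r × Bool) → ((Fin r × Fin 2) ⊕ S → K) → K := fun q x =>
    if q.2 then eval (fun k => x (Sum.inl (q.1, k))) F else
      ∑ n, x (Sum.inr n) * eval (fun k => x (Sum.inl (q.1, k))) (b n)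
  have hpf : ∀ q, PF (f q) := by
    rintro ⟨i, c⟩
    cases c
    · simp only [f, Bool.false_eq_true, if_false]
      exact PF.sum _ (fun n _ => (PF.coord _).mul ((PF.poly (b n)).comp (fun k => PF.coord _)))
    · simp only [f, if_true]
      exact (PF.poly F).comp (fun k => PF.coord _)
  let z0 : (Fin r × Fin 2) ⊕ S → K := Sum.elim (fun q => p q.1 q.2) v0
  obtain ⟨T, -, hT, hTi, hzT, hT0, hTd⟩ := z3_fam f hpf (T := univ) isClosed_univ
    (IrreducibleSpace.isIrreducible_univ _) (p := z0) (mem_univ _) (by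
      rintro ⟨i, c⟩
      cases c
      · simp only [f, Bool.false_eq_true, if_false]; exact hv0 i
      · simp only [f, if_true]
        have : p i ∈ {p | eval p F = 0} := by rw [hF]; exact Or.inl (hp i).1
        exact this)
  have hTd' : r + 1 ≤ dim T := by
    rw [dim_univ, Nat.card_sum, hS, Nat.card_prod, Nat.card_prod] at hTd
    simp at hTd
    omega
  -- points in C
  have hTF : ∀ i, ∀ x ∈ T, eval (fun k => x (Sum.inl (i, k))) F = 0 := fun i x hx => by
    simpa [f] using hT0 (i, true) x hx
  have hTf : ∀ i, ∀ x ∈ T, ∑ n, x (Sum.inr n) * eval (fun k => x (Sum.inl (i, k))) (b n) = 0 := fun i x hx => by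
    simpa [f] using hT0 (i, false) x hx
  have hTC : ∀ i, ∀ x ∈ T, (fun k => x (Sum.inl (i, k))) ∈ C := by
    intro i
    let g : Fin 2 → (Fin r × Fin 2) ⊕ S := fun k => Sum.inl (i, k)
    have h1 := cl_image_irred hTi g
    have h2 : closure ((fun x => x ∘ g) '' T) ⊆ C ∪ C' := by
      apply closure_minimal _ (hC.union hC')
      rw [← hF]
      rintro _ ⟨x, hx, rfl⟩
      exact hTF i x hx
    rcases irred_sub_union h1 hC hC' h2 with h3 | h3
    · intro x hx
      exact h3 (subset_closure ⟨x, hx, rfl⟩)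
    · exact absurd (h3 (subset_closure ⟨z0, hzT, rfl⟩)) (hp i).2
  have hk : ∀ i j, ∃ k : Fin 2, i ≠ j → p i k ≠ p j k := by
    intro i j
    by_cases h : i = j
    · exact ⟨0, fun h' => absurd h h'⟩
    · obtain ⟨k, hk⟩ := Function.ne_iff.1 (fun h' => h (hpi h'))
      exact ⟨k, fun _ => hk⟩
  choose k hk using hk
  let h : ((Fin r × Fin 2) ⊕ S → K) → K := fun x => x (Sum.inr n0) *
    ∏ i : Fin r, ∏ j ∈ Finset.univ.erase i, (x (Sum.inl (i, k i j)) - x (Sum.inl (j, k i j)))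
  have hh : PF h := (PF.coord _).mul (PF.prod _ (fun i _ => PF.prod _ (fun j _ => (PF.coord _).sub (PF.coord _))))
  have hz0 : h z0 ≠ 0 := by
    refine mul_ne_zero hn0 ?_
    rw [Finset.prod_ne_zero_iff]
    intro i _
    rw [Finset.prod_ne_zero_iff]
    intro j hj
    exact sub_ne_zero.2 (hk i j (Finset.ne_of_mem_erase hj).symm)
  have hsets : {x ∈ T | h x ≠ 0} = T \ {x | h x = 0} := by ext; simp
  have hdim : dim {x ∈ T | h x ≠ 0} = dim T := by
    rw [hsets]
    exact (dim_open_irred hT hTi (isClosed_pf hh) (fun hs => hz0 (hs hzT))).1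
  let φ : ((Fin r × Fin 2) ⊕ S → K) → (S → K) := fun x n => x (Sum.inr n)
  have hφ : ∀ n, PF (fun x => φ x n) := fun n => PF.coord _
  have hfin : ∀ y, {x ∈ T | h x ≠ 0 ∧ φ x = y}.Finite := by
    intro y
    by_cases hy : y = 0
    · convert Set.finite_empty
      rw [Set.eq_empty_iff_forall_notMem]
      rintro x ⟨hx, hx0, hxy⟩
      apply hx0
      have : x (Sum.inr n0) = 0 := by
        have := congrFun hxy n0
        rw [hy] at this; exact this
      simp only [h, this, zero_mul]
    · have hf := Set.Finite.pi' (ι := Fin r) (fun _ => hB y hy)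
      refine (hf.image (fun w => (Sum.elim (fun q => w q.1 q.2) y : (Fin r × Fin 2) ⊕ S → K))).subset ?_
      rintro x ⟨hx, -, hxy⟩
      refine ⟨fun i k => x (Sum.inl (i, k)), ?_, ?_⟩
      · intro i
        refine ⟨hTF i x hx, ?_⟩
        rw [← hxy]; exact hTf i x hx
      · funext q
        rcases q with q | q
        · rfl
        · exact (congrFun hxy q).symm
  have hd := dim_lc_fib hφ hT hh hfin
  rw [hdim] at hd
  have hdense : Dense (φ '' {x ∈ T | h x ≠ 0}) := by
    have hne : {x ∈ T | h x ≠ 0}.Nonempty := ⟨z0, hzT, hz0⟩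
    apply dense_of_dim (hne.image φ)
    apply le_antisymm (dim_le_card _)
    omega
  obtain ⟨N, hN, hNn, hNv⟩ := dense_lc_open hφ hT hh hdense
  refine ⟨N, hN, hNn, fun v hv => ?_⟩
  obtain ⟨x, hx, hxh, hxv⟩ := hNv v hv
  have hinj : Function.Injective (fun i : Fin r => (fun k => x (Sum.inl (i, k)) : Fin 2 → K)) := by
    intro i j hij
    by_contra hne
    have h1 := right_ne_zero_of_mul hxh
    rw [Finset.prod_ne_zero_iff] at h1
    have h2 := h1 i (Finset.mem_univ _)
    rw [Finset.prod_ne_zero_iff] at h2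
    exact h2 j (Finset.mem_erase.2 ⟨fun h => hne h.symm, Finset.mem_univ _⟩) (sub_eq_zero.2 (congrFun hij _))
  refine ⟨Finset.univ.map ⟨_, hinj⟩, by simp, ?_⟩
  intro q hq
  rw [Finset.mem_map] at hq
  obtain ⟨i, -, rfl⟩ := hq
  refine ⟨hTC i x hx, ?_⟩
  rw [← hxv]; exact hTf i x hx


lemma split_comp {Z C : Set (ι → K)} (hZ : IsClosed Z) (hZn : Z ≠ univ) (hC : IsClosed C) (hCi : IsIrreducible C)
    (hCd : dim C + 1 = Nat.card ι) (hCZ : C ⊆ Z) : ∃ C', IsClosed C' ∧ Z = C ∪ C' ∧ ¬ C ⊆ C' := by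
  obtain ⟨Fm, hf, hc, hi, hu⟩ := finite_decomp hZ
  have key : ∀ A ∈ Fm, C ⊆ A → C = A := by
    intro A hA hCA
    apply eq_of_dim hC hCi.nonempty (hc A hA) (hi A hA) hCA
    have h1 : dim A ≤ dim Z := dim_mono (by rw [hu]; exact subset_sUnion_of_mem hA)
    have h2 := dim_lt_card hZ hZn (hCi.nonempty.mono hCZ)
    omega
  obtain ⟨A, hA, hCA⟩ := irred_sub hCi Fm hf hc (hu ▸ hCZ)
  have := key A hA hCA
  subst this
  have hc' : ∀ B ∈ Fm \ {C}, IsClosed B := fun B hB => hc B hB.1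
  refine ⟨⋃₀ (Fm \ {C}), (by rw [sUnion_eq_biUnion]; exact (hf.subset diff_subset).isClosed_biUnion hc'), ?_, ?_⟩
  · conv_lhs => rw [hu]
    rw [← sUnion_insert]
    congr 1
    rw [insert_diff_singleton, insert_eq_of_mem hA]
  · intro h
    obtain ⟨B, hB, hCB⟩ := irred_sub hCi _ (hf.subset diff_subset) hc' h
    exact hB.2 (key B hB.1 hCB).symm

def HP (K : Type*) [Field K] [ZG K] (ι : Type) [Finite ι] : Prop :=
  ∀ D : Set (ι → K), IsClosed D → IsIrreducible D → dim D + 1 = Nat.card ι →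
    ∃ Q : MvPolynomial ι K, Irreducible Q ∧ D = {x | eval x Q = 0}

lemma not_const_of_irred {σ : Type*} {F : MvPolynomial σ K} (hF : Irreducible F) : F.totalDegree ≠ 0 := by
  intro h
  rw [totalDegree_eq_zero_iff_eq_C] at h
  have hc : F.coeff 0 ≠ 0 := fun h0 => hF.ne_zero (by rw [h, h0, C_0])
  exact hF.not_isUnit (by rw [h]; exact (IsUnit.mk0 _ hc).map C)

lemma curve_unique {F : MvPolynomial (Fin 2) K} (hF : Irreducible F) {C₁ C₂ : Set (Fin 2 → K)}
    (h1 : IsClosed C₁) (h1i : IsIrreducible C₁) (h1d : dim C₁ = 1) (h1F : C₁ ⊆ {x | eval x F = 0})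
    (h2 : IsClosed C₂) (h2i : IsIrreducible C₂) (h2d : dim C₂ = 1) (h2F : C₂ ⊆ {x | eval x F = 0}) :
    C₁ = C₂ := by
  classical
  by_contra hne
  set d := F.totalDegree with hd
  have hd0 : d ≠ 0 := not_const_of_irred hF
  obtain ⟨s, hs, hs0⟩ : ∃ s ∈ F.support, s ≠ 0 := by
    by_contra hcon
    push Not at hcon
    apply hd0
    rw [hd, totalDegree_eq_zero_iff_eq_C]
    ext n
    rw [coeff_C]
    split_ifs with hn
    · rw [hn]
    · by_contra h
      exact hn (hcon n (mem_support_iff.2 h)).symm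
  have hsd : s ∈ expSet d := by
    have := le_totalDegree hs
    simpa [expSet, Finsupp.degree_eq_sum, Finsupp.sum_fintype] using this
  let S := {n : expSet d // n ≠ ⟨s, hsd⟩}
  haveI : Fintype (expSet d) := Fintype.ofFinite _
  obtain ⟨r, hr⟩ : ∃ r, 2 * r = d * d + 3 * d - 2 ∧ Nat.card S = r + 1 := by
    have e1 := card_expSet d
    have e2 : Nat.card S + 1 = Nat.card (expSet d) := by
      simp only [S]
      rw [Nat.card_eq_fintype_card, Nat.card_eq_fintype_card]
      have := Fintype.card_subtype_compl (fun n : expSet d => n = ⟨s, hsd⟩)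
      rw [Fintype.card_subtype_eq] at this
      have h3 : 0 < Fintype.card (expSet d) := Fintype.card_pos_iff.2 ⟨⟨s, hsd⟩⟩
      rw [this]; omega
    have e3 : (d + 1) * (d + 2) = d * d + 3 * d + 2 := by ring
    refine ⟨Nat.card S - 1, ?_, ?_⟩
    · have : 1 ≤ d * d := Nat.one_le_iff_ne_zero.2 (by positivity)
      omega
    · have : 1 ≤ d * d := Nat.one_le_iff_ne_zero.2 (by positivity)
      omega
  obtain ⟨hr1, hr2⟩ := hr
  let b : S → MvPolynomial (Fin 2) K := fun n => monomial n.1.1 1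
  let fv : (S → K) → MvPolynomial (Fin 2) K := fun v => ∑ n, C (v n) * b n
  have hev : ∀ v p, eval p (fv v) = ∑ n, v n * eval p (b n) := by
    intro v p; simp only [fv, map_sum, map_mul, eval_C]
  have hco : ∀ v (m : Fin 2 →₀ ℕ), (fv v).coeff m = ∑ n : S, if n.1.1 = m then v n else 0 := by
    intro v m
    simp only [fv, coeff_sum, coeff_C_mul, b, coeff_monomial, mul_ite, mul_one, mul_zero]
  have hdeg : ∀ v, (fv v).totalDegree ≤ d := by
    intro v
    refine (totalDegree_finset_sum _ _).trans ?_
    apply Finset.sup_le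
    intro n _
    refine (totalDegree_mul _ _).trans ?_
    rw [totalDegree_C, zero_add]
    refine (totalDegree_monomial_le _ _).trans ?_
    have := n.1.2
    simpa [expSet, Finsupp.degree_eq_sum, Finsupp.sum_fintype] using this
  have hndvd : ∀ v, v ≠ 0 → ¬ F ∣ fv v := by
    rintro v hv ⟨g, hg⟩
    obtain ⟨n, hn⟩ := Function.ne_iff.1 hv
    have hfv : fv v ≠ 0 := by
      intro h0
      have := hco v n.1.1
      rw [h0, coeff_zero, Finset.sum_eq_single n] at this
      · simp at this; exact hn this.symm
      · intro m _ hmn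
        rw [if_neg]
        exact fun h => hmn (Subtype.ext (Subtype.ext h))
      · simp
    have hg0 : g ≠ 0 := by rintro rfl; simp at hg; exact hfv hg
    have h3 := hdeg v
    rw [hg, totalDegree_mul_of_isDomain hF.ne_zero hg0] at h3
    have h4 : g.totalDegree = 0 := by omega
    rw [totalDegree_eq_zero_iff_eq_C] at h4
    have h5 : (fv v).coeff s = 0 := by
      rw [hco]
      apply Finset.sum_eq_zero
      intro m _
      rw [if_neg]
      exact fun h => m.2 (Subtype.ext h)
    rw [hg, h4, mul_comm, coeff_C_mul] at h5
    rcases mul_eq_zero.1 h5 with h6 | h6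
    · exact hg0 (by rw [h4, h6, C_0])
    · exact (mem_support_iff.1 hs) h6
  have hbez : ∀ v : S → K, v ≠ 0 → ∀ P : Finset (Fin 2 → K), (∀ p ∈ P, eval p F = 0 ∧ ∑ n, v n * eval p (b n) = 0) →
      P.card ≤ d * d := by
    intro v hv P hP
    refine (bezout hF (hndvd v hv) P (fun p hp => ⟨(hP p hp).1, by rw [hev]; exact (hP p hp).2⟩)).trans ?_
    exact Nat.mul_le_mul_left _ (hdeg v)
  have hB : ∀ v : S → K, v ≠ 0 → {p : Fin 2 → K | eval p F = 0 ∧ ∑ n, v n * eval p (b n) = 0}.Finite := by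
    intro v hv
    by_contra hinf
    obtain ⟨P, hP, hPc⟩ := Set.Infinite.exists_subset_card_eq hinf (d * d + 1)
    have := hbez v hv P (fun p hp => hP hp)
    omega
  have hZc : IsClosed {x : Fin 2 → K | eval x F = 0} := isClosed_alg F
  have hZn := zero_ne_univ hF.ne_zero
  obtain ⟨C₁', h1', h1u, h1n⟩ := split_comp hZc hZn h1 h1i (by simp [h1d]) h1F
  obtain ⟨C₂', h2', h2u, h2n⟩ := split_comp hZc hZn h2 h2i (by simp [h2d]) h2F
  obtain ⟨N₁, hN1, hN1n, hN1v⟩ := C1 b hr2 hB h1 h1i h1d h1' h1u h1n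
  obtain ⟨N₂, hN2, hN2n, hN2v⟩ := C1 b hr2 hB h2 h2i h2d h2' h2u h2n
  have hfin : (C₁ ∩ C₂).Finite := by
    apply finite_of_dim_zero (h1.inter h2)
    by_cases hem : (C₁ ∩ C₂).Nonempty
    · by_contra hd0
      have e1 : C₁ ∩ C₂ = C₁ := eq_of_dim (h1.inter h2) hem h1 h1i inter_subset_left (by omega)
      have e2 : C₁ ∩ C₂ = C₂ := eq_of_dim (h1.inter h2) hem h2 h2i inter_subset_right (by omega)
      exact hne (e1.symm.trans e2)
    · rw [not_nonempty_iff_eq_empty.1 hem, dim_empty]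
  let n0 : S := ⟨⟨0, by simp [expSet]⟩, fun h => hs0 (by simpa using (congrArg Subtype.val h).symm)⟩
  haveI := hfin.to_subtype
  have hN3c : ∀ q : Fin 2 → K, IsClosed {v : S → K | ∑ n, v n * eval q (b n) = 0} := fun q =>
    isClosed_pf (PF.sum _ (fun n _ => (PF.coord n).mul (PF.const _)))
  have hN3n : ∀ q : Fin 2 → K, {v : S → K | ∑ n, v n * eval q (b n) = 0} ≠ univ := by
    intro q h
    have : (Pi.single n0 1 : S → K) ∈ {v : S → K | ∑ n, v n * eval q (b n) = 0} := by rw [h]; trivial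
    rw [mem_ofPred_eq, Finset.sum_eq_single n0] at this
    · simp [b, n0] at this
    · intro m _ hm; rw [Pi.single_eq_of_ne hm, zero_mul]
    · simp
  have hN3 := iunion_proper (fun q : ↥(C₁ ∩ C₂) => {v : S → K | ∑ n, v n * eval q.1 (b n) = 0})
    (fun q => hN3c _) (fun q => hN3n _)
  have hN3c' : IsClosed (⋃ q : ↥(C₁ ∩ C₂), {v : S → K | ∑ n, v n * eval q.1 (b n) = 0}) :=
    isClosed_iUnion_of_finite (fun q => hN3c _)
  have h4 := union_proper (hN1.union hN2) hN3c' (union_proper hN1 hN2 hN1n hN2n) hN3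
  have h5 := union_proper ((hN1.union hN2).union hN3c') (hN3c 0) h4 (hN3n 0)
  obtain ⟨v, hv⟩ := (Set.ne_univ_iff_exists_notMem _).1 h5
  simp only [mem_union, not_or, mem_iUnion, not_exists] at hv
  obtain ⟨⟨⟨v1, v2⟩, v3⟩, v4⟩ := hv
  have hv0 : v ≠ 0 := by rintro rfl; apply v4; simp
  obtain ⟨P₁, hP1c, hP1⟩ := hN1v v v1
  obtain ⟨P₂, hP2c, hP2⟩ := hN2v v v2
  have hdis : Disjoint P₁ P₂ := by
    rw [Finset.disjoint_left]
    intro q hq1 hq2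
    exact v3 ⟨q, (hP1 q hq1).1, (hP2 q hq2).1⟩ (hP1 q hq1).2
  have := hbez v hv0 (P₁ ∪ P₂) (by
    intro p hp
    rcases Finset.mem_union.1 hp with hp | hp
    · exact ⟨h1F (hP1 p hp).1, (hP1 p hp).2⟩
    · exact ⟨h2F (hP2 p hp).1, (hP2 p hp).2⟩)
  rw [Finset.card_union_of_disjoint hdis, hP1c, hP2c] at this
  omega

lemma HP_two (H : ∀ C : Set (Fin 2 → K), IsClosed C → IsIrreducible C → dim C = 1 →
    ∃ f : MvPolynomial (Fin 2) K, f ≠ 0 ∧ ∀ x ∈ C, eval x f = 0) : HP K (Fin 2) := by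
  intro D hD hDi hDd
  have hDd : dim D = 1 := by simpa using hDd
  obtain ⟨f, hf, hf0⟩ := H D hD hDi hDd
  obtain ⟨Q, hQ, -, hQ0⟩ := exists_irred_factor hDi hf hf0
  refine ⟨Q, hQ, Subset.antisymm hQ0 ?_⟩
  intro p hp
  obtain ⟨T, hT, hTi, hpT, hT0, hTd⟩ := zero_comp hp
  have hTu : T ≠ univ := fun h => zero_ne_univ hQ.ne_zero (by
    rw [eq_univ_iff_forall]; intro x; exact hT0 x (h ▸ mem_univ x))
  have h3 := dim_lt_card hT hTu hTi.nonempty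
  have h4 : dim T = 1 := by simp at hTd h3; omega
  rw [curve_unique hQ hD hDi hDd hQ0 hT hTi h4 hT0]
  exact hpT

end ZG

set_option linter.all false
open Topology
namespace ZG
open Set
open MvPolynomial

lemma exists_pderiv_ne {F : Type*} [Field F] [IsAlgClosed F] {ι : Type} {Q : MvPolynomial ι F} (hQ : Irreducible Q)
    (hQd : Q.totalDegree ≠ 0) :
    ∃ i, pderiv i Q ≠ 0 := by
  classical
  by_contra hcon
  push Not at hcon
  have hz : ∀ σ ∈ Q.support, ∀ i, ((σ i : ℕ) : F) = 0 := by
    intro σ hσ i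
    by_cases h0 : σ i = 0
    · simp [h0]
    have h1 := coeff_pderiv (i := i) Q (σ - Finsupp.single i 1)
    rw [hcon i, coeff_zero] at h1
    have h2 : σ - Finsupp.single i 1 + Finsupp.single i 1 = σ := by
      apply tsub_add_cancel_of_le
      rw [Finsupp.single_le_iff]; omega
    rw [h2] at h1
    rcases mul_eq_zero.1 h1.symm with h3 | h3
    · exact absurd h3 (mem_support_iff.1 hσ)
    · have h4 : (σ - Finsupp.single i 1 : ι →₀ ℕ) i + 1 = σ i := by
        rw [Finsupp.tsub_apply, Finsupp.single_eq_same]; omega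
      rw [← h4]; push_cast; exact_mod_cast h3
  obtain ⟨p, hp⟩ := CharP.exists F
  rcases CharP.char_is_prime_or_zero F p with hpp | hp0
  · haveI := Fact.mk hpp
    have hdiv : ∀ σ ∈ Q.support, ∃ σ' : ι →₀ ℕ, σ = p • σ' := by
      intro σ hσ
      refine ⟨σ.mapRange (fun n => n / p) (by simp), ?_⟩
      ext i
      simp only [Finsupp.smul_apply, Finsupp.mapRange_apply, smul_eq_mul]
      exact (Nat.mul_div_cancel' ((CharP.cast_eq_zero_iff F p _).1 (hz σ hσ i))).symm
    choose! σ' hσ' using hdiv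
    have hroot : ∀ c : F, ∃ z, z ^ p = c := fun c => IsAlgClosed.exists_pow_nat_eq c hpp.pos
    choose ro hro using hroot
    have : Q = (∑ σ ∈ Q.support, monomial (σ' σ) (ro (Q.coeff σ))) ^ p := by
      rw [sum_pow_char]
      conv_lhs => rw [Q.as_sum]
      apply Finset.sum_congr rfl
      intro σ hσ
      rw [monomial_pow, hro, ← hσ' σ hσ]
    rw [this] at hQ
    exact not_irreducible_pow hpp.ne_one hQ
  · subst hp0
    haveI := CharP.charP_to_charZero F
    apply hQd
    rw [totalDegree_eq_zero_iff]
    intro σ hσ i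
    exact_mod_cast hz σ hσ i


section line
variable {F : Type*} [Field F] {ι : Type} [Fintype ι]

noncomputable def lineP (Q : MvPolynomial ι F) (c v : ι → F) : Polynomial F :=
  aeval (fun i => Polynomial.C (c i) + Polynomial.C (v i) * Polynomial.X) Q

lemma lineP_eval (Q : MvPolynomial ι F) (c v : ι → F) (t : F) :
    (lineP Q c v).eval t = eval (fun i => c i + v i * t) Q := by
  have : (Polynomial.evalRingHom t).comp (aeval (R := F) (fun i => Polynomial.C (c i) + Polynomial.C (v i) * Polynomial.X)).toRingHom
      = eval (fun i => c i + v i * t) := by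
    apply MvPolynomial.ringHom_ext
    · intro a; simp
    · intro i; simp
  exact congrArg (fun φ => φ Q) this

lemma natDegree_prod_coeff {α : Type*} (s : Finset α) (f : α → Polynomial F) (n : α → ℕ) (h : ∀ a ∈ s, (f a).natDegree ≤ n a) :
    (∏ a ∈ s, f a).natDegree ≤ ∑ a ∈ s, n a ∧ (∏ a ∈ s, f a).coeff (∑ a ∈ s, n a) = ∏ a ∈ s, (f a).coeff (n a) := by
  classical
  induction s using Finset.induction with
  | empty => simp
  | insert a s ha ih =>
    have h1 := ih (fun b hb => h b (Finset.mem_insert_of_mem hb))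
    have h2 := h a (Finset.mem_insert_self a s)
    rw [Finset.prod_insert ha, Finset.sum_insert ha, Finset.prod_insert ha]
    refine ⟨Polynomial.natDegree_mul_le_of_le h2 h1.1, ?_⟩
    rw [Polynomial.coeff_mul_add_eq_of_natDegree_le h2 h1.1, h1.2]

lemma lineP_mono (s : ι →₀ ℕ) (a : F) (c v : ι → F) :
    (lineP (monomial s a) c v).natDegree ≤ s.degree ∧
      (lineP (monomial s a) c v).coeff s.degree = eval v (monomial s a) := by
  have e1 : lineP (monomial s a) c v = Polynomial.C a * ∏ i, (Polynomial.C (c i) + Polynomial.C (v i) * Polynomial.X) ^ (s i) := by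
    rw [lineP, aeval_monomial, Finsupp.prod_fintype _ _ (by simp)]; rfl
  have e2 : eval v (monomial s a) = a * ∏ i, v i ^ s i := by
    rw [eval_monomial, Finsupp.prod_fintype _ _ (by simp)]
  have hl : ∀ i, (Polynomial.C (c i) + Polynomial.C (v i) * Polynomial.X).natDegree ≤ 1 := by
    intro i; rw [add_comm]; exact Polynomial.natDegree_linear_le
  have h := natDegree_prod_coeff Finset.univ (fun i => (Polynomial.C (c i) + Polynomial.C (v i) * Polynomial.X) ^ (s i)) (fun i => s i)
    (fun i _ => by simpa using Polynomial.natDegree_pow_le_of_le (s i) (hl i))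
  rw [e1, e2, Finsupp.degree_eq_sum]
  refine ⟨(Polynomial.natDegree_C_mul_le _ _).trans h.1, ?_⟩
  rw [Polynomial.coeff_C_mul, h.2]
  congr 1
  apply Finset.prod_congr rfl
  intro i _
  have := Polynomial.coeff_pow_of_natDegree_le (m := s i) (hl i)
  rw [mul_one] at this
  rw [this]; simp

lemma lineP_deg (Q : MvPolynomial ι F) (c v : ι → F) (n : ℕ) (hn : Q.totalDegree ≤ n) :
    (lineP Q c v).natDegree ≤ n ∧ (lineP Q c v).coeff n = eval v (homogeneousComponent n Q) := by
  have e1 : lineP Q c v = ∑ s ∈ Q.support, lineP (monomial s (Q.coeff s)) c v := by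
    conv_lhs => rw [Q.as_sum]
    simp only [lineP, map_sum]
  have hs : ∀ s ∈ Q.support, s.degree ≤ n := fun s hs => by
    have := le_totalDegree hs
    simp only [Finsupp.degree_eq_sum]
    rw [Finsupp.sum_fintype _ _ (by simp)] at this
    omega
  rw [e1]
  constructor
  · exact Polynomial.natDegree_sum_le_of_forall_le _ _ (fun s h => (lineP_mono s _ c v).1.trans (hs s h))
  · rw [Polynomial.finset_sum_coeff, homogeneousComponent_apply, map_sum, Finset.sum_filter]
    apply Finset.sum_congr rfl
    intro s h
    split_ifs with hd
    · rw [← hd]; exact (lineP_mono s _ c v).2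
    · apply Polynomial.coeff_eq_zero_of_natDegree_lt
      exact lt_of_le_of_lt (lineP_mono s _ c v).1 (lt_of_le_of_ne (hs s h) hd)

lemma lineP_add (p q : MvPolynomial ι F) (c v : ι → F) : lineP (p + q) c v = lineP p c v + lineP q c v := by
  simp only [lineP, map_add]

lemma lineP_mul (p q : MvPolynomial ι F) (c v : ι → F) : lineP (p * q) c v = lineP p c v * lineP q c v := by
  simp only [lineP, map_mul]

lemma lineP_X (i : ι) (c v : ι → F) : lineP (X i) c v = Polynomial.C (c i) + Polynomial.C (v i) * Polynomial.X := by
  simp only [lineP, aeval_X]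

lemma lineP_zero (c v : ι → F) : lineP 0 c v = 0 := by
  simp only [lineP, map_zero]

lemma lineP_one (c v : ι → F) : lineP 1 c v = 1 := by
  simp only [lineP, map_one]

lemma lineP_C (a : F) (c v : ι → F) : lineP (C a) c v = Polynomial.C a := by
  simp only [lineP, aeval_C]; rfl

lemma lineP_derivative (Q : MvPolynomial ι F) (c v : ι → F) :
    Polynomial.derivative (lineP Q c v) = ∑ j, Polynomial.C (v j) * lineP (pderiv j Q) c v := by
  classical
  induction Q using MvPolynomial.induction_on with
  | C a => simp [lineP_C, lineP_zero]
  | add p q hp hq =>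
    rw [lineP_add, Polynomial.derivative_add, hp, hq, ← Finset.sum_add_distrib]
    apply Finset.sum_congr rfl
    intro j _
    rw [map_add, lineP_add, mul_add]
  | mul_X p i hp =>
    rw [lineP_mul, Polynomial.derivative_mul, hp]
    have h1 : ∀ j, Polynomial.C (v j) * lineP (pderiv j (p * X i)) c v =
        Polynomial.C (v j) * lineP (pderiv j p) c v * lineP (X i) c v + 
          Polynomial.C (v j) * (lineP p c v * lineP (pderiv j (X i)) c v) := by
      intro j
      rw [pderiv_mul, lineP_add, lineP_mul, lineP_mul, mul_add, mul_assoc]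
    rw [Finset.sum_congr rfl (fun j _ => h1 j), Finset.sum_add_distrib, ← Finset.sum_mul]
    congr 1
    rw [Finset.sum_eq_single i]
    · rw [pderiv_X_self, lineP_one, lineP_X]; simp; ring
    · intro j _ hj; rw [pderiv_X_of_ne hj.symm, lineP_zero]; simp
    · simp

lemma lineP_roots [IsAlgClosed F] (Q : MvPolynomial ι F) (c v : ι → F)
    (h1 : eval v (homogeneousComponent Q.totalDegree Q) ≠ 0)
    (h2 : ∀ t, eval (fun i => c i + v i * t) Q = 0 → ∑ j, v j * eval (fun i => c i + v i * t) (pderiv j Q) ≠ 0) :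
    {t | eval (fun i => c i + v i * t) Q = 0}.ncard = Q.totalDegree := by
  classical
  have hd := lineP_deg Q c v _ le_rfl
  rw [← hd.2] at h1
  have hne : lineP Q c v ≠ 0 := by intro h; rw [h] at h1; simp at h1
  have hdeg : (lineP Q c v).natDegree = Q.totalDegree := le_antisymm hd.1 (Polynomial.le_natDegree_of_ne_zero h1)
  have hset : {t | eval (fun i => c i + v i * t) Q = 0} = ((lineP Q c v).roots.toFinset : Set F) := by
    ext t
    simp [hne, Polynomial.IsRoot, lineP_eval]
  rw [hset, Set.ncard_coe_finset, Multiset.toFinset_card_of_nodup, ← hdeg,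
    (IsAlgClosed.splits (lineP Q c v)).natDegree_eq_card_roots]
  rw [Multiset.nodup_iff_count_le_one]
  intro t
  rw [Polynomial.count_roots]
  by_contra hlt
  push Not at hlt
  rw [Polynomial.one_lt_rootMultiplicity_iff_isRoot hne] at hlt
  obtain ⟨h4, h3⟩ := hlt
  rw [Polynomial.IsRoot, lineP_eval] at h4
  apply h2 t h4
  rw [Polynomial.IsRoot, lineP_derivative, Polynomial.eval_finset_sum] at h3
  simpa [lineP_eval] using h3

end line

end ZG

set_option linter.all false
open Topology
namespace ZG
open Set
open MvPolynomial

lemma not_dvd_pderiv {F : Type*} [Field F] {ι : Type} {Q : MvPolynomial ι F} {j : ι} (h : pderiv j Q ≠ 0) :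
    ¬ Q ∣ pderiv j Q := by
  classical
  rintro ⟨g, hg⟩
  have hg0 : g ≠ 0 := by rintro rfl; rw [mul_zero] at hg; exact h hg
  have hQ0 : Q ≠ 0 := by rintro rfl; simp at h
  have h1 := totalDegree_mul_of_isDomain hQ0 hg0
  rw [← hg] at h1
  have h2 : ∀ m ∈ (pderiv j Q).support, (m.sum fun _ e => e) + 1 ≤ Q.totalDegree := by
    intro m hm
    have hm' : m + Finsupp.single j 1 ∈ Q.support := by
      rw [mem_support_iff, coeff_pderiv] at hm
      exact mem_support_iff.2 (left_ne_zero_of_mul hm)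
    have := le_totalDegree hm'
    rw [Finsupp.sum_add_index' (by simp) (by simp), Finsupp.sum_single_index (by simp)] at this
    exact this
  obtain ⟨m, hm⟩ := (support_nonempty.2 h)
  have h3 := h2 m hm
  have h4 : (pderiv j Q).totalDegree < Q.totalDegree := by
    rw [totalDegree, Finset.sup_lt_iff (by rw [bot_eq_zero]; omega)]
    intro m hm; have := h2 m hm; omega
  omega

lemma top_ne_zero {F : Type*} [Field F] {ι : Type} {Q : MvPolynomial ι F} (h : Q ≠ 0) :
    homogeneousComponent Q.totalDegree Q ≠ 0 := by
  classical
  obtain ⟨s, hs, hd⟩ := Finset.exists_mem_eq_sup Q.support (support_nonempty.2 h) (fun s => s.sum fun _ e => e)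
  intro h0
  have := congrArg (coeff s) h0
  rw [coeff_homogeneousComponent, coeff_zero, if_pos] at this
  · exact (mem_support_iff.1 hs) this
  · rw [totalDegree, hd]; rfl

variable {K : Type*} [Field K] [ZG K] [IsAlgClosed K] {ι κ μ : Type} [Finite κ] [Finite μ]

lemma sub_univ_of_dim {A : Set (κ → K)} (h : dim A < Nat.card κ) : closure A ≠ univ := by
  intro h'
  have := dim_closure A
  rw [h', dim_univ] at this
  omega

lemma hyper_poly [Fintype ι] (H : HP K ι) {D : Set (ι → K)} (hD : IsClosed D) (hDn : D ≠ univ)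
    (hpure : ∀ p ∈ D, ∃ T ⊆ D, IsClosed T ∧ IsIrreducible T ∧ p ∈ T ∧ Nat.card ι ≤ dim T + 1) :
    ∃ F : MvPolynomial ι K, F ≠ 0 ∧ D = {x | eval x F = 0} ∧
      ∃ N : Set (ι ⊕ ι → K), IsClosed N ∧ N ≠ univ ∧ ∀ c v, Sum.elim c v ∉ N →
        eval v (homogeneousComponent F.totalDegree F) ≠ 0 ∧
        {t | eval (fun i => c i + v i * t) F = 0}.ncard = F.totalDegree := by
  classical
  obtain ⟨Fm, hf, hc, hi, hu⟩ := finite_decomp hD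
  have hdl : ∀ A ∈ Fm, dim A < Nat.card ι := by
    intro A hA
    apply dim_lt_card (hc A hA) _ (hi A hA).nonempty
    intro h; apply hDn; rw [hu, eq_univ_iff_forall]
    intro x; exact ⟨A, hA, h ▸ mem_univ x⟩
  let Fp : Set (Set (ι → K)) := {A ∈ Fm | dim A + 1 = Nat.card ι}
  have hfp : Fp.Finite := hf.subset (sep_subset _ _)
  have hDu : ∀ x, x ∈ D ↔ ∃ A ∈ Fp, x ∈ A := by
    intro x
    constructor
    · intro hx
      obtain ⟨T, hTD, hT, hTi, hxT, hTd⟩ := hpure x hx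
      obtain ⟨A, hA, hTA⟩ := irred_sub hTi Fm hf hc (hu ▸ hTD)
      refine ⟨A, ⟨hA, ?_⟩, hTA hxT⟩
      have := hdl A hA
      have := dim_mono hTA
      omega
    · rintro ⟨A, hA, hx⟩
      rw [hu]; exact ⟨A, hA.1, hx⟩
  have hQ : ∀ A ∈ Fp, ∃ Q : MvPolynomial ι K, Irreducible Q ∧ A = {x | eval x Q = 0} := fun A hA =>
    H A (hc A hA.1) (hi A hA.1) hA.2
  choose! Q hQi hQA using hQ
  let s := hfp.toFinset
  have hs : ∀ A, A ∈ s ↔ A ∈ Fp := fun A => hfp.mem_toFinset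
  let F := ∏ A ∈ s, Q A
  have hF0 : F ≠ 0 := Finset.prod_ne_zero_iff.2 (fun A hA => (hQi A ((hs A).1 hA)).ne_zero)
  have hDF : D = {x | eval x F = 0} := by
    ext x
    rw [hDu, mem_ofPred_eq, map_prod, Finset.prod_eq_zero_iff]
    constructor
    · rintro ⟨A, hA, hx⟩
      refine ⟨A, (hs A).2 hA, ?_⟩
      rw [hQA A hA] at hx; exact hx
    · rintro ⟨A, hA, hx⟩
      refine ⟨A, (hs A).1 hA, ?_⟩
      rw [hQA A ((hs A).1 hA)]; exact hx
  have hpt : ∀ A ∈ Fp, ∃ p ∈ A, ∃ j, eval p (pderiv j F) ≠ 0 := by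
    intro A hA
    obtain ⟨j, hj⟩ := exists_pderiv_ne (hQi A hA) (not_const_of_irred (hQi A hA))
    by_contra hcon
    push Not at hcon
    have h1 : Q A ∣ pderiv j F := null_dvd (hQi A hA) (fun x hx => hcon x (by rw [hQA A hA]; exact hx) j)
    have h2 : F = Q A * ∏ B ∈ s.erase A, Q B := (Finset.mul_prod_erase s Q ((hs A).2 hA)).symm
    rw [h2, pderiv_mul] at h1
    have h3 : Q A ∣ pderiv j (Q A) * ∏ B ∈ s.erase A, Q B :=
      (dvd_add_left (Dvd.intro _ rfl)).1 h1
    rcases (hQi A hA).prime.dvd_or_dvd h3 with h4 | h4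
    · exact not_dvd_pderiv hj h4
    · obtain ⟨B, hB, hAB⟩ := ((hQi A hA).prime.dvd_finset_prod_iff _).1 h4
      have hBp := (hs B).1 (Finset.mem_of_mem_erase hB)
      apply Finset.ne_of_mem_erase hB
      have hass := (hQi A hA).associated_of_dvd (hQi B hBp) hAB
      rw [hQA A hA, hQA B hBp]
      ext x
      have e1 : Q A ∣ Q B := hAB
      have e2 : Q B ∣ Q A := hass.symm.dvd
      constructor
      · intro hx; obtain ⟨g, hg⟩ := e2; rw [mem_ofPred_eq, hg, map_mul, hx, zero_mul]
      · intro hx; obtain ⟨g, hg⟩ := e1; rw [mem_ofPred_eq, hg, map_mul, hx, zero_mul]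
  refine ⟨F, hF0, hDF, ?_⟩
  let g : (ι ⊕ ι → K) → K := fun z => ∑ j, z (Sum.inr j) * eval (fun i => z (Sum.inl i)) (pderiv j F)
  have hg : PF g := PF.sum _ (fun j _ => (PF.coord _).mul ((PF.poly (pderiv j F)).comp (fun i => PF.coord _)))
  let φ : ((ι ⊕ ι) ⊕ Unit → K) → (ι ⊕ ι → K) := fun z => Sum.elim
    (fun i => z (Sum.inl (Sum.inl i)) - z (Sum.inl (Sum.inr i)) * z (Sum.inr ())) (fun i => z (Sum.inl (Sum.inr i)))
  have hφ : ∀ k, PF (fun z => φ z k) := by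
    rintro (k | k)
    · exact (PF.coord _).sub ((PF.coord _).mul (PF.coord _))
    · exact PF.coord _
  let B : Set (ι → K) → Set (ι ⊕ ι → K) := fun A => pr A univ ∩ {z | g z = 0}
  have hBd : ∀ A ∈ Fp, dim (B A) + 2 ≤ 2 * Nat.card ι := by
    intro A hA
    have hAc := hc A hA.1
    have hpc : IsClosed (pr A (univ : Set (ι → K))) := pr_closed hAc isClosed_univ
    have hpi : IsIrreducible (pr A (univ : Set (ι → K))) := pr_irred (hi A hA.1) (IrreducibleSpace.isIrreducible_univ _)
    have hpd : dim (pr A (univ : Set (ι → K))) = dim A + Nat.card ι := by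
      rw [dim_pr (hi A hA.1).nonempty univ_nonempty, dim_univ]
    have h1 := hA.2
    by_cases hne : (B A).Nonempty
    · have : B A ⊂ pr A univ := by
        refine ⟨inter_subset_left, fun hsub => ?_⟩
        obtain ⟨p, hp, j, hj⟩ := hpt A hA
        have hmem : (Sum.elim p (Pi.single j 1) : ι ⊕ ι → K) ∈ pr A univ := elim_mem_pr.2 ⟨hp, mem_univ _⟩
        have h2 := (hsub hmem).2
        rw [mem_ofPred_eq] at h2
        simp only [g, Sum.elim_inl, Sum.elim_inr] at h2
        rw [Finset.sum_eq_single j] at h2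
        · simp only [Pi.single_eq_same, one_mul] at h2; exact hj h2
        · intro k _ hk; rw [Pi.single_eq_of_ne hk, zero_mul]
        · simp
      have := dim_lt (hpc.inter (isClosed_pf hg)) hpc hpi this hne
      have h3 : dim (B A) < dim (pr A (univ : Set (ι → K))) := this
      omega
    · rw [not_nonempty_iff_eq_empty.1 hne, dim_empty]; omega
  have hNA : ∀ A : Fp, closure (φ '' pr (B A) univ) ≠ univ := by
    rintro ⟨A, hA⟩
    apply sub_univ_of_dim
    change dim (φ '' pr (B A) univ) < _
    have h1 := dim_poly_le hφ (pr (B A) univ)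
    have h2 := dim_pr_le (B A) (univ : Set (Unit → K))
    rw [dim_univ] at h2
    have h3 := hBd A hA
    rw [Nat.card_sum]
    simp at h2
    omega
  haveI := hfp.to_subtype
  have hN1 := iunion_proper (fun A : Fp => closure (φ '' pr (B A) univ)) (fun A => isClosed_closure) hNA
  have hN1c : IsClosed (⋃ A : Fp, closure (φ '' pr (B A) univ)) := isClosed_iUnion_of_finite (fun A => isClosed_closure)
  have htop : PF (fun z : ι ⊕ ι → K => eval (fun i => z (Sum.inr i)) (homogeneousComponent F.totalDegree F)) :=
    (PF.poly _).comp (fun i => PF.coord _)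
  have hN2 : {z : ι ⊕ ι → K | eval (fun i => z (Sum.inr i)) (homogeneousComponent F.totalDegree F) = 0} ≠ univ := by
    intro h
    apply zero_ne_univ (top_ne_zero hF0)
    rw [eq_univ_iff_forall] at h ⊢
    intro x
    exact h (Sum.elim x x)
  refine ⟨_, hN1c.union (isClosed_pf htop), union_proper hN1c (isClosed_pf htop) hN1 hN2, ?_⟩
  intro c v hcv
  simp only [mem_union, not_or, mem_iUnion, not_exists] at hcv
  obtain ⟨h1, h2⟩ := hcv
  have h2' : eval v (homogeneousComponent F.totalDegree F) ≠ 0 := h2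
  refine ⟨h2', lineP_roots F c v h2' ?_⟩
  intro t ht hder
  have hx : (fun i => c i + v i * t) ∈ D := by rw [hDF]; exact ht
  obtain ⟨A, hA, hxA⟩ := (hDu _).1 hx
  apply h1 ⟨A, hA⟩
  apply subset_closure
  refine ⟨Sum.elim (Sum.elim (fun i => c i + v i * t) v) (fun _ => t), ?_, ?_⟩
  · refine elim_mem_pr.2 ⟨⟨elim_mem_pr.2 ⟨hxA, mem_univ _⟩, hder⟩, mem_univ _⟩
  · funext k
    rcases k with k | k
    · simp [φ]
    · simp [φ]

end ZG

set_option linter.all false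
open Topology
namespace ZG
open Set
open MvPolynomial

variable {K : Type*} [Field K] [ZG K] [IsAlgClosed K] {ι κ μ : Type} [Finite ι] [Finite κ] [Finite μ]

/-- discriminant function -/
def disc {K : Type*} [Field K] {κ : Type} (d : ℕ) (z : κ ⊕ Fin d → K) : K :=
  ∏ i : Fin d, ∏ j ∈ Finset.univ.filter (fun j => j ≠ i), (z (Sum.inr i) - z (Sum.inr j))

lemma disc_pf (d : ℕ) : PF (disc (K := K) (κ := κ) d) :=
  PF.prod _ (fun i _ => PF.prod _ (fun j _ => (PF.coord _).sub (PF.coord _)))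

lemma disc_ne {d : ℕ} {z : κ ⊕ Fin d → K} : disc d z ≠ 0 ↔ Function.Injective (fun i => z (Sum.inr i)) := by
  unfold disc
  rw [Finset.prod_ne_zero_iff]
  constructor
  · intro h i j hij
    by_contra hne
    have := Finset.prod_ne_zero_iff.1 (h i (Finset.mem_univ _)) j (by simp; exact fun h => hne h.symm)
    exact this (sub_eq_zero.2 hij)
  · intro h i _
    rw [Finset.prod_ne_zero_iff]
    intro j hj h0
    simp at hj
    exact hj (h (sub_eq_zero.1 h0)).symm

lemma generic_count {L : Set (Option κ → K)} (hL : IsClosed L) (hLn : L ≠ univ) :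
    ∃ d : ℕ, ∃ M : Set (κ → K), IsClosed M ∧ M ≠ univ ∧ ∀ w, w ∉ M →
      {t : K | xc w t ∈ L}.Finite ∧ {t : K | xc w t ∈ L}.ncard = d := by
  classical
  let A : ∀ d : ℕ, Set (κ ⊕ Fin d → K) := fun d => {z | ∀ i, xc (z ∘ Sum.inl) (z (Sum.inr i)) ∈ L}
  have hA : ∀ d, IsClosed (A d) := by
    intro d
    have : A d = ⋂ i, {z : κ ⊕ Fin d → K | xc (z ∘ Sum.inl) (z (Sum.inr i)) ∈ L} := by ext; simp [A]
    rw [this]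
    refine isClosed_iInter fun i => hL.preimage (continuous_coord ?_)
    rintro (_ | k)
    · exact Or.inl ⟨Sum.inr i, fun _ => rfl⟩
    · exact Or.inl ⟨Sum.inl k, fun _ => rfl⟩
  let N : ∀ d : ℕ, Set (κ → K) := fun d => (fun z => z ∘ Sum.inl) '' {z ∈ A d | disc d z ≠ 0}
  have hN : ∀ d w, w ∈ N d ↔ ∃ t : Fin d → K, Function.Injective t ∧ ∀ i, xc w (t i) ∈ L := by
    intro d w
    constructor
    · rintro ⟨z, ⟨hz, hd⟩, rfl⟩
      exact ⟨_, disc_ne.1 hd, hz⟩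
    · rintro ⟨t, ht, hw⟩
      exact ⟨Sum.elim w t, ⟨hw, disc_ne.2 ht⟩, rfl⟩
  obtain ⟨B, hB⟩ := Z2' L hL
  have hncard : ∀ d w, w ∈ N d → {t : K | xc w t ∈ L}.Finite → d ≤ {t : K | xc w t ∈ L}.ncard := by
    intro d w hw hf
    obtain ⟨t, ht, hwt⟩ := (hN d w).1 hw
    have : (range t).ncard ≤ _ := ncard_le_ncard (range_subset_iff.2 hwt) hf
    rw [← image_univ, ncard_image_of_injective _ ht, ncard_univ, Nat.card_fin] at this
    exact this
  have hall := allfib_closed hL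
  have halln := allfib_proper hLn
  have hex : ∃ d, ¬ Dense (N d) := by
    refine ⟨B + 1, fun hd => halln ?_⟩
    have : N (B + 1) ⊆ {a : κ → K | ∀ b, xc a b ∈ L} := by
      intro w hw
      rcases hB w with h | ⟨h1, h2⟩
      · intro b; exact (Set.ext_iff.1 h b).2 (mem_univ b)
      · have := hncard _ w hw h1; omega
    exact eq_univ_of_univ_subset (hd.closure_eq ▸ closure_minimal this hall)
  have hspec := Nat.find_spec hex
  have hmin := @Nat.find_min _ _ hex
  set e := Nat.find hex
  have he : e ≠ 0 := by
    intro h0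
    apply hspec
    rw [h0]
    have : N 0 = univ := by
      ext w
      rw [hN]; simp
      exact fun i => i.elim0
    rw [this]; exact dense_univ
  obtain ⟨d, hd⟩ := Nat.exists_eq_succ_of_ne_zero he
  have hdd : Dense (N d) := by
    by_contra hcon; exact hmin (m := d) (by omega) hcon
  obtain ⟨F, hF, hFn, hFs⟩ := dense_lc_open (φ := fun z : κ ⊕ Fin d → K => z ∘ Sum.inl) (fun k => PF.coord _) (hA d) (disc_pf d) hdd
  have hcl : closure (N e) ≠ univ := fun h => hspec (dense_iff_closure_eq.2 h)
  refine ⟨d, (F ∪ closure (N e)) ∪ {a : κ → K | ∀ b, xc a b ∈ L}, (hF.union isClosed_closure).union hall,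
    union_proper (hF.union isClosed_closure) hall (union_proper hF isClosed_closure hFn hcl) halln, ?_⟩
  intro w hw
  simp only [mem_union, not_or] at hw
  obtain ⟨⟨h1, h2⟩, h3⟩ := hw
  have hfin : {t : K | xc w t ∈ L}.Finite := by
    rcases hB w with h | h
    · exfalso; apply h3; intro b; exact (Set.ext_iff.1 h b).2 (mem_univ b)
    · exact h.1
  refine ⟨hfin, ?_⟩
  obtain ⟨x, hx, hx1, hx2⟩ := hFs w h1
  have hge := hncard d w ⟨x, ⟨hx, hx1⟩, hx2⟩ hfin
  by_contra hne
  apply h2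
  apply subset_closure
  rw [hN]
  obtain ⟨s, hs1, hs2⟩ := Set.exists_subset_card_eq (s := {t : K | xc w t ∈ L}) (n := e) (by omega)
  have hsf : s.Finite := hfin.subset hs1
  have hcs : Nat.card s = e := hs2
  haveI := hsf.to_subtype
  let eq := (Finite.equivFinOfCardEq hcs).symm
  exact ⟨fun i => eq i, fun i j hij => eq.injective (Subtype.ext hij), fun i => hs1 (eq i).2⟩

/-- algebraic part of the rationality lemma -/
lemma rat_alg {F : Type*} [Field F] [IsAlgClosed F] (p : ℕ) [ExpChar F p] (R : MvPolynomial (Fin 2) F) (hR : R ≠ 0) (u : F → F)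
    (E : Set F) (hE : E.Finite) (h : ∀ a, a ∉ E → ∀ x, eval ![x, a] R = 0 ↔ x = u a) :
    ∃ e : ℕ, ∃ A B : Polynomial F, A ≠ 0 ∧ ∃ E' : Set F, E'.Finite ∧ ∀ a, a ∉ E' → A.eval a * u a ^ (p ^ e) = B.eval a := by
  classical
  haveI : Infinite F := IsAlgClosed.instInfinite
  obtain ⟨P, hP⟩ : ∃ P : Polynomial (Polynomial F), ∀ x a, (P.map (Polynomial.evalRingHom a)).eval x = eval ![x, a] R := by
    refine ⟨eval₂ (Polynomial.C.comp Polynomial.C) ![Polynomial.X, Polynomial.C Polynomial.X] R, fun x a => ?_⟩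
    have e1 : ∀ R : MvPolynomial (Fin 2) F, Polynomial.eval x ((eval₂ (Polynomial.C.comp Polynomial.C)
        ![Polynomial.X, Polynomial.C Polynomial.X] R : Polynomial (Polynomial F)).map (Polynomial.evalRingHom a)) = eval ![x, a] R := by
      intro R
      induction R using MvPolynomial.induction_on with
      | C c => simp
      | add f g hf hg =>
        simp only [eval₂_add, Polynomial.map_add, Polynomial.eval_add, map_add, hf, hg]
      | mul_X f i hf =>
        simp only [eval₂_mul, eval₂_X, Polynomial.map_mul, Polynomial.eval_mul, map_mul, hf, eval_X]
        congr 1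
        fin_cases i <;> simp
    exact e1 R
  have hP0 : P ≠ 0 := by
    rintro rfl
    apply hR
    apply MvPolynomial.funext
    intro x
    have := hP (x 0) (x 1)
    simp only [Polynomial.map_zero, Polynomial.eval_zero] at this
    rw [map_zero, this]
    congr 1
    congr 1
    funext i; fin_cases i <;> rfl
  set k := P.natDegree with hk
  set l := P.leadingCoeff with hl
  have hl0 : l ≠ 0 := Polynomial.leadingCoeff_ne_zero.2 hP0
  let E' : Set F := E ∪ {a | l.IsRoot a}
  have hE' : E'.Finite := hE.union (Polynomial.finite_setOf_isRoot hl0)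
  have hfac : ∀ a, a ∉ E' → P.map (Polynomial.evalRingHom a) = Polynomial.C (l.eval a) * (Polynomial.X - Polynomial.C (u a)) ^ k ∧ k ≠ 0 := by
    intro a ha
    simp only [E', mem_union, not_or] at ha
    have hla : l.eval a ≠ 0 := ha.2
    have hlead : Polynomial.evalRingHom a P.leadingCoeff ≠ 0 := hla
    have hnd : (P.map (Polynomial.evalRingHom a)).natDegree = k := Polynomial.natDegree_map_of_leadingCoeff_ne_zero _ hlead
    have hlc : (P.map (Polynomial.evalRingHom a)).leadingCoeff = l.eval a := Polynomial.leadingCoeff_map_of_leadingCoeff_ne_zero _ hlead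
    have hne : P.map (Polynomial.evalRingHom a) ≠ 0 := by
      intro h0; rw [h0] at hlc; simp at hlc; exact hla hlc.symm
    have hsp := IsAlgClosed.splits (P.map (Polynomial.evalRingHom a))
    have hr : (P.map (Polynomial.evalRingHom a)).roots = Multiset.replicate k (u a) := by
      rw [Multiset.eq_replicate]
      refine ⟨by rw [← hsp.natDegree_eq_card_roots, hnd], ?_⟩
      intro b hb
      have := (Polynomial.mem_roots hne).1 hb
      rw [Polynomial.IsRoot, hP] at this
      exact (h a ha.1 b).1 this
    refine ⟨?_, ?_⟩
    · conv_lhs => rw [hsp.eq_prod_roots]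
      rw [hr, hlc]; simp
    · intro hk0
      have h1 : u a ∈ (P.map (Polynomial.evalRingHom a)).roots := by
        rw [Polynomial.mem_roots hne, Polynomial.IsRoot, hP]; exact (h a ha.1 _).2 rfl
      rw [hr, hk0] at h1; simp at h1
  obtain ⟨a0, ha0⟩ := hE'.infinite_compl.nonempty
  have hk0 : k ≠ 0 := (hfac a0 ha0).2
  obtain ⟨e, k', hkk, hk'⟩ : ∃ e k' : ℕ, k = k' * p ^ e ∧ (k' : F) ≠ 0 := by
    rcases ‹ExpChar F p› with _ | ⟨hp⟩
    · exact ⟨0, k, by simp, by exact_mod_cast hk0⟩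
    · obtain ⟨e, k', h1, h2⟩ := Nat.exists_eq_pow_mul_and_not_dvd hk0 p hp.ne_one
      refine ⟨e, k', by rw [h2, mul_comm], ?_⟩
      rw [Ne, CharP.cast_eq_zero_iff F p]; exact h1
  refine ⟨e, - (k' : Polynomial F) * l, P.coeff ((k' - 1) * p ^ e), ?_, E', hE', ?_⟩
  · apply mul_ne_zero _ hl0
    rw [neg_ne_zero]
    intro h0
    apply hk'
    have := congrArg (Polynomial.eval 0) h0
    simpa using this
  intro a ha
  have h1 := (hfac a ha).1
  rw [hkk, mul_comm k', pow_mul, sub_pow_expChar_pow, ← Polynomial.C_pow] at h1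
  have h2 : (Polynomial.X ^ (p ^ e) - Polynomial.C (u a ^ (p ^ e))) ^ k' =
    Polynomial.expand F (p ^ e) ((Polynomial.X + Polynomial.C (- u a ^ (p ^ e))) ^ k') := by
    simp [sub_eq_add_neg]
  have h3 := congrArg (fun f => Polynomial.coeff f ((k' - 1) * p ^ e)) h1
  simp only [Polynomial.coeff_map] at h3
  have hk1 : k' ≠ 0 := by rintro rfl; simp at hk'
  rw [h2, Polynomial.coeff_C_mul, Polynomial.coeff_expand_mul (pow_pos (expChar_pos F p) e), Polynomial.coeff_X_add_C_pow] at h3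
  rw [show k' - (k' - 1) = 1 by omega, Nat.choose_symm_of_eq_add (show k' = (k' - 1) + 1 by omega), Nat.choose_one_right] at h3
  have h4 : (P.coeff ((k' - 1) * p ^ e)).eval a = _ := h3
  rw [h4]
  simp
  ring

end ZG

set_option linter.all false
open Topology
namespace ZG
open Set
open MvPolynomial

variable {K : Type*} [Field K] [ZG K] [IsAlgClosed K] {ι κ μ : Type} [Finite ι] [Finite κ] [Finite μ]

lemma exists_enum {α : Type*} {s : Set α} {d : ℕ} (hf : s.Finite) (hd : s.ncard = d) :
    ∃ t : Fin d → α, Function.Injective t ∧ (∀ i, t i ∈ s) ∧ ∀ x ∈ s, ∃ i, t i = x := by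
  haveI := hf.to_subtype
  have hcs : Nat.card s = d := hd
  let eq := (Finite.equivFinOfCardEq hcs).symm
  refine ⟨fun i => eq i, fun i j hij => eq.injective (Subtype.ext hij), fun i => (eq i).2, fun x hx => ⟨eq.symm ⟨x, hx⟩, by simp⟩⟩

lemma rat_geo (H2 : HP K (Fin 2)) (p : ℕ) [ExpChar K p] (s : K → K → Prop) (hs : IsClosed {z : Fin 2 → K | s (z 0) (z 1)})
    (d : ℕ) (E : Set K) (hE : E.Finite) (u : K → K)
    (hcard : ∀ a, a ∉ E → {t | s a t}.Finite ∧ {t | s a t}.ncard = d)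
    (hu : ∀ a, a ∉ E → ∀ t : Fin d → K, Function.Injective t → (∀ i, s a (t i)) → u a = ∏ i, (- t i)) :
    ∃ e : ℕ, ∃ A B : Polynomial K, A ≠ 0 ∧ ∃ E' : Set K, E'.Finite ∧ ∀ a, a ∉ E' → A.eval a * u a ^ (p ^ e) = B.eval a := by
  classical
  let Y : Set (Fin 2 ⊕ Fin d → K) := {z | (∀ i, s (z (Sum.inl 1)) (z (Sum.inr i))) ∧ z (Sum.inl 0) = ∏ i, (- z (Sum.inr i))}
  have hY : IsClosed Y := by
    apply IsClosed.inter
    · have : {z : Fin 2 ⊕ Fin d → K | ∀ i, s (z (Sum.inl 1)) (z (Sum.inr i))} =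
        ⋂ i, {z : Fin 2 ⊕ Fin d → K | s (z (Sum.inl 1)) (z (Sum.inr i))} := by ext; simp
      change IsClosed {z : Fin 2 ⊕ Fin d → K | ∀ i, s (z (Sum.inl 1)) (z (Sum.inr i))}
      rw [this]
      exact isClosed_iInter fun i => hs.preimage (continuous_re ![Sum.inl 1, Sum.inr i])
    · refine isClosed_pf_eq (PF.coord _) (PF.prod _ (fun i _ => ?_))
      have := (PF.const (σ := Fin 2 ⊕ Fin d) (0 : K)).sub (PF.coord (Sum.inr i))
      simpa using this
  let h : (Fin 2 ⊕ Fin d → K) → K := fun z => disc d z * ∏ e ∈ hE.toFinset, (z (Sum.inl 1) - e)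
  have hh : PF h := (disc_pf d).mul (PF.prod _ (fun e _ => (PF.coord _).sub (PF.const _)))
  have hh0 : ∀ z, h z ≠ 0 ↔ Function.Injective (fun i => z (Sum.inr i)) ∧ z (Sum.inl 1) ∉ E := by
    intro z
    rw [← disc_ne, mul_ne_zero_iff, Finset.prod_ne_zero_iff]
    apply and_congr_right; intro _
    constructor
    · intro h hz; exact h _ (hE.mem_toFinset.2 hz) (sub_self _)
    · intro hz e he h0; rw [sub_eq_zero.1 h0] at hz; exact hz (hE.mem_toFinset.1 he)
  have hR := rab_closed hh hY
  have hRz : ∀ z ∈ rab h Y, z ∘ some ∈ Y ∧ h (z ∘ some) ≠ 0 := by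
    intro z hz
    have : z ∘ some ∈ {x ∈ Y | h x ≠ 0} := by rw [← rab_image]; exact ⟨z, hz, rfl⟩
    exact this
  have hRu : ∀ z ∈ rab h Y, z (some (Sum.inl 1)) ∉ E ∧ z (some (Sum.inl 0)) = u (z (some (Sum.inl 1))) := by
    intro z hz
    obtain ⟨⟨h1, h2⟩, h3⟩ := hRz z hz
    obtain ⟨h4, h5⟩ := (hh0 _).1 h3
    exact ⟨h5, h2.trans (hu _ h5 _ h4 h1).symm⟩
  have hdom : Dom (fun _ : Unit => some (Sum.inl (1 : Fin 2))) (rab h Y) := by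
    have hEc : IsClosed {x : Unit → K | x () ∈ E} := by
      have : {x : Unit → K | x () ∈ E} = ⋃ e ∈ E, {x | x () = e} := by ext; simp
      rw [this]; exact hE.isClosed_biUnion fun e _ => isClosed_coord _ _
    refine dense_of_compl hEc ?_ ?_
    · intro h
      haveI : Infinite K := IsAlgClosed.instInfinite
      obtain ⟨a, ha⟩ := hE.infinite_compl.nonempty
      exact ha (eq_univ_iff_forall.1 h (fun _ => a))
    · intro x hx
      obtain ⟨h1, h2⟩ := hcard (x ()) hx
      obtain ⟨t, ht, hts, _⟩ := exists_enum h1 h2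
      have : (Sum.elim ![∏ i, (- t i), x ()] t : Fin 2 ⊕ Fin d → K) ∈ {x ∈ Y | h x ≠ 0} := by
        refine ⟨⟨hts, rfl⟩, (hh0 _).2 ⟨ht, hx⟩⟩
      rw [← rab_image] at this
      obtain ⟨z, hz, hzz⟩ := this
      refine ⟨z, hz, ?_⟩
      funext i
      exact congrFun hzz (Sum.inl 1)
  have hdimR : dim (rab h Y) ≤ 1 := by
    have h1 := dim_fib hR (fun _ : Unit => some (Sum.inl (1 : Fin 2))) (by
      intro y
      by_cases hy : y () ∈ E
      · convert Set.finite_empty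
        ext z; simp only [mem_inter_iff, mem_empty_iff_false, iff_false, not_and]
        intro hz hzy
        apply (hRu z hz).1
        have := congrFun hzy (); simp at this; rw [this]; exact hy
      · have hfin := (hcard _ hy).1
        have hpi : (Set.univ.pi (fun _ : Fin d => {t | s (y ()) t})).Finite := Set.Finite.pi (fun _ => hfin)
        apply Set.Finite.of_finite_image (f := fun z : Option (Fin 2 ⊕ Fin d) → K => fun i => z (some (Sum.inr i)))
        · apply hpi.subset
          rintro _ ⟨z, ⟨hz, hzy⟩, rfl⟩ i _
          have h2 := (hRz z hz).1.1 i
          have := congrFun hzy (); simp at this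
          simp only [Function.comp] at h2
          rw [this] at h2; exact h2
        · intro z hz z' hz' hzz
          apply rab_ext hz.1 hz'.1
          have e1 := congrFun hz.2 ()
          have e2 := congrFun hz'.2 ()
          simp at e1 e2
          have e3 := (hRu z hz.1).2
          have e4 := (hRu z' hz'.1).2
          funext k
          rcases k with k | k
          · fin_cases k
            · change z (some (Sum.inl 0)) = z' (some (Sum.inl 0))
              rw [e3, e4, e1, e2]
            · change z (some (Sum.inl 1)) = z' (some (Sum.inl 1))
              rw [e1, e2]
          · exact congrFun hzz k)
    refine h1.trans ((dim_le_card _).trans ?_)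
    simp
  obtain ⟨T, hTR, hT, hTi, hTd⟩ := exists_comp_dom hR hdom
  let g : Fin 2 → Option (Fin 2 ⊕ Fin d) := fun i => some (Sum.inl i)
  obtain ⟨F, hF, hFW, hFs⟩ := Z1' g T hT hTi.nonempty
  set W := closure ((fun x => x ∘ g) '' T) with hW
  have hWi : IsIrreducible W := cl_image_irred hTi g
  have hWdom : Dom (fun _ : Unit => (1 : Fin 2)) W := by
    rw [hW, dom_closure]
    unfold Dom at hTd ⊢
    rw [← image_comp]
    exact hTd
  have hWd : dim W = 1 := by
    apply le_antisymm
    · rw [hW, dim_closure]; exact (dim_re_le _ _).trans ((dim_mono hTR).trans hdimR)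
    · simpa using hWdom.le_dim
  have hFfin : F.Finite := by
    rcases F.eq_empty_or_nonempty with h0 | h0
    · rw [h0]; exact finite_empty
    · apply finite_of_dim_zero hF
      have : dim F < dim W := dim_lt hF isClosed_closure hWi hFW h0
      omega
  obtain ⟨R, hRi, hWR⟩ := H2 W isClosed_closure hWi (by rw [hWd]; simp)
  have hcof := dom_unit_cofinite isClosed_closure 1 hWdom
  refine rat_alg p R hRi.ne_zero u (E := ((fun x : Fin 2 → K => x 1) '' F) ∪ {a | ¬ ∃ x ∈ W, x 1 = a}) ((hFfin.image _).union hcof) ?_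
  intro a ha x
  simp only [mem_union, not_or, mem_ofPred_eq, not_not] at ha
  have key : ∀ y ∈ W, y 1 = a → y 0 = u a := by
    intro y hy hya
    have : y ∈ (fun x => x ∘ g) '' T := hFs ⟨hy, fun hyF => ha.1 ⟨y, hyF, hya⟩⟩
    obtain ⟨z, hz, rfl⟩ := this
    have := (hRu z (hTR hz)).2
    rw [← hya]; exact this
  constructor
  · intro hx
    have : ![x, a] ∈ W := by rw [hWR]; exact hx
    exact key _ this rfl
  · rintro rfl
    obtain ⟨y, hy, hya⟩ := ha.2
    have h0 := key y hy hya
    have : y = ![u a, a] := by funext i; fin_cases i; exacts [h0, hya]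
    rw [this, hWR] at hy
    exact hy

/-- finite evaluation sets -/
lemma exists_eval_set {F : Type*} [Field F] {σ : Type} [Finite σ] (d : ℕ) (S : Set (σ → F))
    (hS : ∀ f : MvPolynomial σ F, (∀ x ∈ S, eval x f = 0) → f = 0) :
    ∃ s : Finset (σ → F), (∀ x ∈ s, x ∈ S) ∧ ∃ l : (σ → F) → MvPolynomial σ F, ∀ f : MvPolynomial σ F, f.totalDegree ≤ d →
      f = ∑ c ∈ s, C (eval c f) * l c := by
  classical
  let V := restrictTotalDegree σ F d
  haveI : Module.Finite F V :=
    inferInstanceAs (Module.Finite F (restrictTotalDegree σ F d))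
  have key : ∀ n : ℕ, ∀ W : Submodule F V, Module.finrank F W ≤ n → ∃ s : Finset (σ → F), (∀ x ∈ s, x ∈ S) ∧
      ∀ f ∈ W, (∀ x ∈ s, eval x (f : MvPolynomial σ F) = 0) → f = 0 := by
    intro n
    induction n with
    | zero =>
      intro W hW
      refine ⟨∅, by simp, fun f hf _ => ?_⟩
      have : W = ⊥ := Submodule.finrank_eq_zero.1 (by omega)
      rw [this] at hf; exact hf
    | succ n ih =>
      intro W hW
      by_cases hbot : W = ⊥
      · refine ⟨∅, by simp, fun f hf _ => ?_⟩
        rw [hbot] at hf; exact hf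
      · obtain ⟨f, hf, hf0⟩ := Submodule.exists_mem_ne_zero_of_ne_bot hbot
        have : ∃ c ∈ S, eval c (f : MvPolynomial σ F) ≠ 0 := by
          by_contra hcon; push Not at hcon
          exact hf0 (Subtype.ext (hS _ hcon))
        obtain ⟨c, hc, hfc⟩ := this
        let ev : V →ₗ[F] F := (aeval (R := F) c).toLinearMap ∘ₗ V.subtype
        have hev : ∀ f : V, ev f = eval c (f : MvPolynomial σ F) := fun f => by simp [ev, aeval_eq_eval]
        have hlt : W ⊓ LinearMap.ker ev < W := by
          refine lt_of_le_of_ne inf_le_left fun h => ?_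
          have : f ∈ W ⊓ LinearMap.ker ev := by rw [h]; exact hf
          exact hfc ((hev f).symm.trans this.2)
        have := Submodule.finrank_lt_finrank_of_lt hlt
        obtain ⟨s, hs, hsf⟩ := ih (W ⊓ LinearMap.ker ev) (by omega)
        refine ⟨insert c s, ?_, ?_⟩
        · intro x hx; rcases Finset.mem_insert.1 hx with rfl | hx
          · exact hc
          · exact hs x hx
        · intro g hg hgs
          apply hsf g ⟨hg, _⟩ (fun x hx => hgs x (Finset.mem_insert_of_mem hx))
          exact (hev g).trans (hgs c (Finset.mem_insert_self _ _))
  obtain ⟨s, hs, hinj⟩ := key _ ⊤ le_rfl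
  let Ev : V →ₗ[F] (s → F) := LinearMap.pi (fun c => (aeval (R := F) (c : σ → F)).toLinearMap ∘ₗ V.subtype)
  have hEv : ∀ (f : V) c, Ev f c = eval (c : σ → F) (f : MvPolynomial σ F) := fun f c => by simp [Ev, aeval_eq_eval]
  have hker : LinearMap.ker Ev = ⊥ := by
    rw [LinearMap.ker_eq_bot']
    intro f hf
    apply hinj f trivial
    intro x hx
    rw [← hEv f ⟨x, hx⟩, hf]; rfl
  obtain ⟨G, hG⟩ := LinearMap.exists_leftInverse_of_injective Ev hker
  refine ⟨s, hs, fun c => if hc : c ∈ s then (G (Pi.single ⟨c, hc⟩ 1) : V) else 0, fun f hf => ?_⟩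
  have hfV : f ∈ V := (mem_restrictTotalDegree _ _ _).2 hf
  have h1 : G (Ev ⟨f, hfV⟩) = ⟨f, hfV⟩ := LinearMap.congr_fun hG ⟨f, hfV⟩
  have h2 : Ev ⟨f, hfV⟩ = ∑ c : s, (eval (c : σ → F) f) • (Pi.single c 1 : s → F) := by
    funext c
    rw [hEv, Finset.sum_apply, Finset.sum_eq_single c]
    · simp
    · intro b _ hb; simp [Pi.single_eq_of_ne hb.symm]
    · simp
  rw [h2, map_sum] at h1
  have h3 := congrArg (fun f : V => (f : MvPolynomial σ F)) h1
  simp only [map_smul, Submodule.coe_sum, Submodule.coe_smul] at h3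
  rw [← Finset.sum_coe_sort s]
  conv_lhs => rw [← h3]
  apply Finset.sum_congr rfl
  intro c _
  simp only [dif_pos c.2, C_mul']

end ZG

set_option linter.all false
open Topology
namespace ZG
open Set
open MvPolynomial

lemma count_top {F : Type*} [Field F] [Infinite F] (P : Polynomial F) (d : ℕ) (hd : P.natDegree ≤ d)
    (hf : {t | P.eval t = 0}.Finite) (hc : {t | P.eval t = 0}.ncard = d) :
    P.coeff d ≠ 0 ∧ ∀ t : Fin d → F, Function.Injective t → (∀ i, P.eval (t i) = 0) →
      P.eval 0 = P.coeff d * ∏ i, (- t i) := by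
  classical
  have hP0 : P ≠ 0 := by
    rintro rfl
    simp at hf
    exact Set.infinite_univ hf
  have hroots : ∀ t : Fin d → F, Function.Injective t → (∀ i, P.eval (t i) = 0) → Finset.univ.val.map t ≤ P.roots := by
    intro t ht htr
    rw [Multiset.le_iff_subset (Multiset.Nodup.map ht Finset.univ.nodup)]
    intro x hx
    obtain ⟨i, _, rfl⟩ := Multiset.mem_map.1 hx
    exact (Polynomial.mem_roots hP0).2 (htr i)
  have hcard : ∀ t : Fin d → F, Function.Injective t → (∀ i, P.eval (t i) = 0) → P.natDegree = d ∧ P.roots = Finset.univ.val.map t := by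
    intro t ht htr
    have h1 := hroots t ht htr
    have h2 := Multiset.card_le_card h1
    have h3 := P.card_roots'
    simp at h2
    refine ⟨by omega, (Multiset.eq_of_le_of_card_le h1 ?_).symm⟩
    simp; omega
  obtain ⟨t, ht, hts, _⟩ := exists_enum hf hc
  have hdeg := (hcard t ht hts).1
  refine ⟨?_, ?_⟩
  · rw [← hdeg]; exact Polynomial.leadingCoeff_ne_zero.2 hP0
  · intro t ht hts
    have h1 := (hcard t ht hts).2
    have h2 := Polynomial.C_leadingCoeff_mul_prod_multiset_X_sub_C (p := P) (by rw [h1, hdeg]; simp)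
    have h4 : (P.roots.map (fun a => Polynomial.X - Polynomial.C a)).prod = ∏ i, (Polynomial.X - Polynomial.C (t i)) := by
      rw [h1, Multiset.map_map]; rfl
    rw [h4] at h2
    have h3 := congrArg (Polynomial.eval 0) h2
    rw [← h3, Polynomial.leadingCoeff, hdeg, Polynomial.eval_mul, Polynomial.eval_C, Polynomial.eval_prod]
    simp

variable {K : Type*} [Field K] [ZG K] [IsAlgClosed K] {ι : Type}

lemma slice_poly [Fintype ι] (H : HP K ι) {D : Set (Option ι → K)} (hD : IsClosed D) (hDi : IsIrreducible D)
    (hd : dim D = Nat.card ι) (hB : ∀ a, ¬ ∀ z ∈ D, z none = a) (a : K) :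
    ∃ F : MvPolynomial ι K, F ≠ 0 ∧ (∀ y, xc y a ∈ D ↔ eval y F = 0) ∧
      ∃ N : Set (ι ⊕ ι → K), IsClosed N ∧ N ≠ univ ∧ ∀ c v, Sum.elim c v ∉ N →
        eval v (homogeneousComponent F.totalDegree F) ≠ 0 ∧
        {t | eval (fun i => c i + v i * t) F = 0}.ncard = F.totalDegree := by
  have himg : ∀ T : Set (Option ι → K), (∀ z ∈ T, z none = a) →
      (fun z => z ∘ some) '' T = (fun y : ι → K => xc y a) ⁻¹' T := by
    intro T hT
    ext y
    constructor
    · rintro ⟨z, hz, rfl⟩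
      have : xc (z ∘ some) a = z := by
        funext o; rcases o with _ | o
        · exact (hT z hz).symm
        · rfl
      change xc (z ∘ some) a ∈ T
      rw [this]; exact hz
    · intro hy; exact ⟨xc y a, hy, rfl⟩
  have hinj : ∀ T : Set (Option ι → K), (∀ z ∈ T, z none = a) → ∀ x ∈ T, ∀ x' ∈ T, x ∘ some = x' ∘ some → x = x' := by
    intro T hT x hx x' hx' h
    funext o; rcases o with _ | o
    · rw [hT x hx, hT x' hx']
    · exact congrFun h o
  obtain ⟨F, hF, hDF, hN⟩ := hyper_poly (D := (fun y : ι → K => xc y a) ⁻¹' D) H (hD.preimage (cont_xc a)) (by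
      intro huniv
      have hsub : {z : Option ι → K | z none = a} ⊆ D := by
        intro z hz
        have : xc (z ∘ some) a ∈ D := by
          have := mem_univ (z ∘ some); rw [← huniv] at this; exact this
        have h2 : xc (z ∘ some) a = z := by
          funext o; rcases o with _ | o
          · exact hz.symm
          · rfl
        rwa [h2] at this
      have hdim := dim_re_inj (isClosed_coord (K := K) (none : Option ι) a) some (hinj _ (fun z hz => hz))
      have h1 : (fun z : Option ι → K => z ∘ some) '' {z | z none = a} = univ := by
        rw [himg {z | z none = a} (fun z hz => hz), eq_univ_iff_forall]; intro y; rfl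
      rw [h1, dim_univ] at hdim
      have := eq_of_dim (isClosed_coord (K := K) (none : Option ι) a) ⟨xc 0 a, rfl⟩ hD hDi hsub (by omega)
      apply hB a
      rw [← this]; exact fun z hz => hz) (by
      intro y hy
      obtain ⟨T, hTD, hT, hTi, hyT, hTa, hTd⟩ := z3_const hD hDi hy none a rfl
      refine ⟨(fun z => z ∘ some) '' T, ?_, ?_, ?_, ⟨_, hyT, rfl⟩, ?_⟩
      · rw [himg T hTa]; exact preimage_mono hTD
      · rw [himg T hTa]; exact hT.preimage (cont_xc a)
      · exact hTi.image _ (continuous_re _).continuousOn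
      · rw [dim_re_inj hT some (hinj T hTa)]; omega)
  refine ⟨F, hF, fun y => ?_, hN⟩
  exact Set.ext_iff.1 hDF y

lemma PF.upoly {σ : Type*} (A : Polynomial K) (i : σ) : PF (fun z : σ → K => A.eval (z i)) :=
  ⟨Polynomial.aeval (X i) A, fun x => by
    rw [← coe_aeval_eq_eval, RingHom.coe_coe, ← Polynomial.aeval_algHom_apply, aeval_X, Polynomial.coe_aeval_eq_eval]⟩

lemma slice_rat [Fintype ι] (H : HP K ι) (H2 : HP K (Fin 2)) {D : Set (Option ι → K)} (hD : IsClosed D) (hDi : IsIrreducible D)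
    (hd : dim D = Nat.card ι) (hB : ∀ a, ¬ ∀ z ∈ D, z none = a) :
    ∃ R : MvPolynomial (Option ι) K, ∃ E : Set K, E.Finite ∧ ∀ a, a ∉ E → ∀ y, eval (xc y a) R = 0 ↔ xc y a ∈ D := by
  classical
  haveI : Infinite K := IsAlgClosed.instInfinite
  choose F hF0 hFD N hN hNn hNcv using slice_poly H hD hDi hd hB
  let ψ : (Option (Option (ι ⊕ ι)) → K) → (Option ι → K) := fun w =>
    xc (fun i => w (some (some (Sum.inl i))) + w (some (some (Sum.inr i))) * w none) (w (some none))
  have hψ : Continuous ψ := by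
    apply PF.cont (g := fun k w => ψ w k)
    rintro (_ | k)
    · exact PF.coord (some none)
    · exact (PF.coord _).add ((PF.coord _).mul (PF.coord _))
  have hψe : ∀ c v a t, ψ (xc (xc (Sum.elim c v) a) t) = xc (fun i => c i + v i * t) a := fun c v a t => rfl
  have hLc : IsClosed (ψ ⁻¹' D) := hD.preimage hψ
  have hDn : D ≠ univ := by
    rintro rfl
    rw [dim_univ, Nat.card_eq_fintype_card, Fintype.card_option, Nat.card_eq_fintype_card] at hd
    omega
  have hLn : ψ ⁻¹' D ≠ univ := by
    intro h
    apply hDn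
    rw [eq_univ_iff_forall] at h ⊢
    intro z
    obtain ⟨y, a, rfl⟩ := xc_surj z
    have := h (xc (xc (Sum.elim y 0) a) 0)
    rw [mem_preimage, hψe] at this
    simpa using this
  obtain ⟨d, M, hM, hMn, hMd⟩ := generic_count hLc hLn
  have hMd' : ∀ c v a, xc (Sum.elim c v) a ∉ M → {t | eval (fun i => c i + v i * t) (F a) = 0}.Finite ∧
      {t | eval (fun i => c i + v i * t) (F a) = 0}.ncard = d := by
    intro c v a h
    have h1 := hMd _ h
    have h2 : {t | xc (xc (Sum.elim c v) a) t ∈ ψ ⁻¹' D} = {t | eval (fun i => c i + v i * t) (F a) = 0} := by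
      ext t
      rw [mem_ofPred_eq, mem_ofPred_eq, mem_preimage, hψe, hFD]
    rw [h2] at h1; exact h1
  have hne : ∃ w, w ∉ M := by
    by_contra hcon; push Not at hcon; exact hMn (eq_univ_iff_forall.2 hcon)
  obtain ⟨w0, hw0⟩ := hne
  obtain ⟨cv, a0, rfl⟩ := xc_surj w0
  obtain ⟨c0, v0, rfl⟩ : ∃ c v, cv = Sum.elim c v := ⟨cv ∘ Sum.inl, cv ∘ Sum.inr, (Sum.elim_comp_inl_inr _).symm⟩
  have hfinE : ∀ c, (∃ a, xc (Sum.elim c v0) a ∉ M) → {a | xc (Sum.elim c v0) a ∈ M}.Finite := by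
    rintro c ⟨a, ha⟩
    rcases xc_fin_or_univ hM (Sum.elim c v0) with h | h
    · exact absurd ((Set.ext_iff.1 h a).2 (mem_univ _)) ha
    · exact h
  let E1 := {a | xc (Sum.elim c0 v0) a ∈ M}
  have hE1 : E1.Finite := hfinE c0 ⟨a0, hw0⟩
  have hdeg : ∀ a, a ∉ E1 → (F a).totalDegree = d := by
    intro a ha
    have h1 : (fun w => xc w a) ⁻¹' M ≠ univ := by
      intro h; exact ha ((Set.ext_iff.1 h _).2 (mem_univ _))
    have h2 := union_proper (hM.preimage (cont_xc a)) (hN a) h1 (hNn a)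
    have : ∃ w, w ∉ (fun w => xc w a) ⁻¹' M ∪ N a := by
      by_contra hcon; push Not at hcon; exact h2 (eq_univ_iff_forall.2 hcon)
    obtain ⟨w, hw⟩ := this
    obtain ⟨c, v, rfl⟩ : ∃ c v, w = Sum.elim c v := ⟨w ∘ Sum.inl, w ∘ Sum.inr, (Sum.elim_comp_inl_inr _).symm⟩
    simp only [mem_union, not_or] at hw
    rw [← (hNcv a c v hw.2).2, (hMd' c v a hw.1).2]
  let top : K → K := fun a => eval v0 (homogeneousComponent d (F a))
  have hline : ∀ c a, a ∉ E1 → xc (Sum.elim c v0) a ∉ M → top a ≠ 0 ∧ ∀ t : Fin d → K, Function.Injective t →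
      (∀ i, xc (fun j => c j + v0 j * t i) a ∈ D) → eval c (F a) = top a * ∏ i, (- t i) := by
    intro c a ha hca
    obtain ⟨h1, h2⟩ := hMd' c v0 a hca
    obtain ⟨h3, h4⟩ := lineP_deg (F a) c v0 d (hdeg a ha).le
    have h5 := count_top (lineP (F a) c v0) d h3 (by simpa only [lineP_eval] using h1) (by simpa only [lineP_eval] using h2)
    rw [h4] at h5
    refine ⟨h5.1, fun t ht hti => ?_⟩
    have h6 := h5.2 t ht (fun i => by rw [lineP_eval]; exact (hFD a _).1 (hti i))
    rw [lineP_eval] at h6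
    simpa using h6
  have htop : ∀ a, a ∉ E1 → top a ≠ 0 := fun a ha => (hline c0 a ha ha).1
  let S : Set (ι → K) := {c | ∃ a, xc (Sum.elim c v0) a ∉ M}
  have hS : ∀ f : MvPolynomial ι K, (∀ x ∈ S, eval x f = 0) → f = 0 := by
    intro f hf
    by_contra hf0
    have hMv : IsClosed {z : Option ι → K | xc (Sum.elim (z ∘ some) v0) (z none) ∈ M} := by
      refine hM.preimage (continuous_coord ?_)
      rintro (_ | (k | k))
      · exact Or.inl ⟨none, fun _ => rfl⟩
      · exact Or.inl ⟨some k, fun _ => rfl⟩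
      · exact Or.inr ⟨v0 k, fun _ => rfl⟩
    have h1 := allfib_closed hMv
    have h2 := union_proper (isClosed_alg f) h1 (zero_ne_univ hf0) (by
      intro h; exact hw0 ((Set.ext_iff.1 h c0).2 (mem_univ _) a0))
    apply h2
    rw [eq_univ_iff_forall]
    intro c
    by_cases hc : c ∈ S
    · exact Or.inl (hf c hc)
    · right
      intro a
      by_contra h; exact hc ⟨a, h⟩
  obtain ⟨s, hs, l, hl⟩ := exists_eval_set d S hS
  let p := ringExpChar K
  haveI : ExpChar K p := inferInstance
  have hrat : ∀ c ∈ s, ∃ e : ℕ, ∃ A B : Polynomial K, A ≠ 0 ∧ ∃ E' : Set K, E'.Finite ∧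
      ∀ a, a ∉ E' → A.eval a * (eval c (F a) / top a) ^ (p ^ e) = B.eval a := by
    intro c hc
    refine rat_geo H2 p (fun a t => xc (fun j => c j + v0 j * t) a ∈ D) ?_ d (E1 ∪ {a | xc (Sum.elim c v0) a ∈ M})
      (hE1.union (hfinE c (hs c hc))) (fun a => eval c (F a) / top a) ?_ ?_
    · refine hD.preimage (PF.cont (g := fun k (z : Fin 2 → K) => xc (fun j => c j + v0 j * z 1) (z 0) k) ?_)
      rintro (_ | k)
      · exact PF.coord 0
      · exact (PF.const _).add ((PF.const _).mul (PF.coord _))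
    · intro a ha
      simp only [mem_union, not_or] at ha
      have := hMd' c v0 a ha.2
      simpa only [hFD] using this
    · intro a ha t ht hti
      simp only [mem_union, not_or] at ha
      have := (hline c a ha.1 ha.2).2 t ht hti
      have h0 := htop a ha.1
      rw [this]; field_simp
  choose! e A B hA0 E' hE' hAB using hrat
  let eT := ∑ c ∈ s, e c
  have heT : ∀ c ∈ s, e c ≤ eT := fun c hc => Finset.single_le_sum (fun _ _ => Nat.zero_le _) hc
  let q := p ^ eT
  let A' : (ι → K) → Polynomial K := fun c => A c ^ (p ^ (eT - e c))
  let B' : (ι → K) → Polynomial K := fun c => B c ^ (p ^ (eT - e c))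
  have hA'0 : ∀ c ∈ s, A' c ≠ 0 := fun c hc => pow_ne_zero _ (hA0 c hc)
  have hAB' : ∀ c ∈ s, ∀ a, a ∉ E' c → (A' c).eval a * (eval c (F a) / top a) ^ q = (B' c).eval a := by
    intro c hc a ha
    have h1 := hAB c hc a ha
    simp only [A', B', q, Polynomial.eval_pow]
    rw [← h1, mul_pow, ← pow_mul (eval c (F a) / top a), ← pow_add, Nat.add_sub_cancel' (heT c hc)]
  have hq0 : q ≠ 0 := pow_ne_zero _ (expChar_pos K p).ne'
  have hRpf : PF (fun z : Option ι → K => ∑ c ∈ s, ((∏ c' ∈ s.erase c, (A' c').eval (z none)) * (B' c).eval (z none)) *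
      (eval (fun i => z (some i)) (l c)) ^ q) :=
    PF.sum _ (fun c _ => ((PF.prod _ (fun c' _ => PF.upoly _ _)).mul (PF.upoly _ _)).mul
      (((PF.poly (l c)).comp (fun i => PF.coord (some i))).pow q))
  obtain ⟨R, hR⟩ := hRpf
  refine ⟨R, E1 ∪ ⋃ c ∈ s, (E' c ∪ {a | (A' c).IsRoot a}), hE1.union (s.finite_toSet.biUnion fun c hc =>
    (hE' c hc).union (Polynomial.finite_setOf_isRoot (hA'0 c hc))), ?_⟩
  intro a ha y
  simp only [mem_union, not_or, mem_iUnion, not_exists] at ha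
  obtain ⟨ha1, ha2⟩ := ha
  have hval : eval (xc y a) R = (∏ c ∈ s, (A' c).eval a) * (eval y (F a) / top a) ^ q := by
    rw [← hR]
    have h1 : eval y (F a) / top a = ∑ c ∈ s, (eval c (F a) / top a) * eval y (l c) := by
      conv_lhs => rw [hl (F a) (hdeg a ha1).le]
      rw [map_sum, Finset.sum_div]
      apply Finset.sum_congr rfl
      intro c _
      rw [map_mul, eval_C]; ring
    have hsum : ∀ g : (ι → K) → K, (∑ c ∈ s, g c) ^ q = ∑ c ∈ s, g c ^ q := by
      intro g
      have := map_sum (iterateFrobenius K p eT) g s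
      simpa only [iterateFrobenius_def] using this
    rw [h1, hsum, Finset.mul_sum]
    apply Finset.sum_congr rfl
    intro c hc
    have h2 := hAB' c hc a (ha2 c hc).1
    simp only [xc_none, xc_some]
    rw [← h2, ← Finset.prod_erase_mul s _ hc, mul_pow]
    ring
  rw [hval, hFD, mul_eq_zero, pow_eq_zero_iff hq0, div_eq_zero_iff]
  have h1 : ∏ c ∈ s, (A' c).eval a ≠ 0 := Finset.prod_ne_zero_iff.2 (fun c hc => (ha2 c hc).2)
  have h2 := htop a ha1
  tauto

end ZG

set_option linter.all false
open Topology
namespace ZG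
open Set
open MvPolynomial

variable {K : Type*} [Field K] [ZG K] [IsAlgClosed K] {ι κ : Type}

lemma xc_eta {z : Option ι → K} {a : K} (h : z none = a) : xc (z ∘ some) a = z := by
  funext o; rcases o with _ | o
  · exact h.symm
  · rfl

lemma coord_hyper [Finite ι] (a : K) : IsIrreducible {z : Option ι → K | z none = a} ∧ dim {z : Option ι → K | z none = a} = Nat.card ι := by
  constructor
  · have : {z : Option ι → K | z none = a} = (fun y => xc y a) '' univ := by
      ext z; constructor
      · intro hz; exact ⟨z ∘ some, mem_univ _, xc_eta hz⟩
      · rintro ⟨y, _, rfl⟩; rfl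
    rw [this]
    exact (IrreducibleSpace.isIrreducible_univ _).image _ (cont_xc a).continuousOn
  · have hdim := dim_re_inj (isClosed_coord (K := K) (none : Option ι) a) some (by
      intro x hx x' hx' h
      rw [← xc_eta hx, ← xc_eta hx', h])
    have h1 : (fun z : Option ι → K => z ∘ some) '' {z | z none = a} = univ := by
      rw [eq_univ_iff_forall]; intro y; exact ⟨xc y a, rfl, rfl⟩
    rw [h1, dim_univ] at hdim
    exact hdim.symm

lemma irr_X_sub_C {σ : Type*} (i : σ) (a : K) : Irreducible (X i - C a : MvPolynomial σ K) := by
  classical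
  have hc : coeff (Finsupp.single i 1) (X i - C a : MvPolynomial σ K) = 1 := by
    have h0 : (0 : σ →₀ ℕ) ≠ Finsupp.single i 1 := by
      intro h
      have := DFunLike.congr_fun h i
      simp at this
    rw [coeff_sub, coeff_X, coeff_C, if_neg h0, sub_zero, if_pos rfl]
  apply MvPolynomial.irreducible_of_totalDegree_eq_one
  · apply le_antisymm
    · refine (totalDegree_sub _ _).trans ?_
      simp
    · have := le_totalDegree (p := (X i - C a : MvPolynomial σ K)) (s := Finsupp.single i 1)
        (by rw [mem_support_iff, hc]; exact one_ne_zero)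
      simpa using this
  · intro x hx
    have := hx (Finsupp.single i 1)
    rw [hc] at this
    exact isUnit_of_dvd_one this

lemma HP_step [Fintype ι] (H : HP K ι) (H2 : HP K (Fin 2)) : HP K (Option ι) := by
  intro D hD hDi hd
  have hco : Nat.card (Option ι) = Nat.card ι + 1 := Finite.card_option
  rw [hco] at hd
  have hd' : dim D = Nat.card ι := by omega
  by_cases hA : ∃ a, ∀ z ∈ D, z none = a
  · obtain ⟨a, ha⟩ := hA
    refine ⟨X none - C a, irr_X_sub_C _ _, ?_⟩
    rw [eq_of_dim hD hDi.nonempty (isClosed_coord none a) (coord_hyper a).1 ha (by rw [(coord_hyper a).2, hd'])]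
    ext z; simp [sub_eq_zero]
  · push Not at hA
    have hB : ∀ a, ¬ ∀ z ∈ D, z none = a := by
      intro a h; obtain ⟨z, hz, hza⟩ := hA a; exact hza (h z hz)
    obtain ⟨R, E, hE, hR⟩ := slice_rat H H2 hD hDi hd' hB
    have hRz : ∀ z : Option ι → K, z none ∉ E → (eval z R = 0 ↔ z ∈ D) := by
      intro z hz
      have := hR _ hz (z ∘ some)
      rwa [xc_eta rfl] at this
    let NE : Set (Option ι → K) := {z | z none ∈ E}
    have hNE : IsClosed NE := by
      have : NE = ⋃ e ∈ E, {x : Option ι → K | x none = e} := by ext; simp [NE]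
      rw [this]; exact hE.isClosed_biUnion fun e _ => isClosed_coord _ _
    have hirr : ∀ T : Set (Option ι → K), IsIrreducible T → T ⊆ NE → ∃ e, ∀ z ∈ T, z none = e := by
      intro T hT hTN
      obtain ⟨A, ⟨e, he, rfl⟩, hTA⟩ := irred_sub hT ((fun e => {x : Option ι → K | x none = e}) '' E) (hE.image _)
        (by rintro _ ⟨e, _, rfl⟩; exact isClosed_coord _ _) (by
          intro z hz; exact ⟨_, ⟨z none, hTN hz, rfl⟩, rfl⟩)
      exact ⟨e, hTA⟩
    have hDN : ¬ D ⊆ NE := by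
      intro h; obtain ⟨e, he⟩ := hirr D hDi h; exact hB e he
    have hDcl := (dim_open_irred hD hDi hNE hDN).2
    have hDR : ∀ z ∈ D, eval z R = 0 := by
      have : D ⊆ {z | eval z R = 0} := by
        rw [← hDcl]
        exact closure_minimal (fun z hz => (hRz z hz.2).2 hz.1) (isClosed_alg R)
      exact this
    have hR0 : R ≠ 0 := by
      rintro rfl
      haveI : Infinite K := IsAlgClosed.instInfinite
      obtain ⟨a, ha⟩ := hE.infinite_compl.nonempty
      have hsub : {z : Option ι → K | z none = a} ⊆ D := by
        intro z hz
        have hz' : z none = a := hz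
        exact (hRz z (by rw [hz']; exact ha)).1 (by simp)
      have := eq_of_dim (isClosed_coord (K := K) (none : Option ι) a) ⟨xc 0 a, rfl⟩ hD hDi hsub (by rw [(coord_hyper a).2, hd'])
      exact hB a (by rw [← this]; exact fun z hz => hz)
    obtain ⟨Q, hQ, hQR, hQD⟩ := exists_irred_factor hDi hR0 hDR
    refine ⟨Q, hQ, Subset.antisymm hQD ?_⟩
    intro z hz
    obtain ⟨T, hT, hTi, hzT, hTQ, hTd⟩ := zero_comp hz
    rw [hco] at hTd
    by_cases hTN : T ⊆ NE
    · exfalso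
      obtain ⟨e, he⟩ := hirr T hTi hTN
      have hTe := eq_of_dim hT hTi.nonempty (isClosed_coord none e) (coord_hyper e).1 he (by rw [(coord_hyper e).2]; omega)
      have hdvd : (X none - C e : MvPolynomial (Option ι) K) ∣ Q := by
        apply null_dvd (irr_X_sub_C _ _)
        intro x hx
        apply hTQ
        rw [hTe]
        simpa [sub_eq_zero] using hx
      have hdvd' := ((irr_X_sub_C none e).associated_of_dvd hQ hdvd).symm.dvd
      apply hB e
      intro x hx
      obtain ⟨g, hg⟩ := hdvd'
      have : eval x (X none - C e : MvPolynomial (Option ι) K) = 0 := by rw [hg, map_mul, hQD x hx, zero_mul]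
      simpa [sub_eq_zero] using this
    · have hcl := (dim_open_irred hT hTi hNE hTN).2
      have : T ⊆ D := by
        rw [← hcl]
        refine closure_minimal ?_ hD
        intro x hx
        refine (hRz x hx.2).1 ?_
        obtain ⟨g, hg⟩ := hQR
        rw [hg, map_mul, hTQ x hx.1, zero_mul]
      exact this hzT

def Sep (K : Type*) [Field K] [ZG K] (ι : Type) [Finite ι] : Prop :=
  ∀ D : Set (ι → K), IsClosed D → ∀ p, p ∉ D → ∃ f : MvPolynomial ι K, (∀ x ∈ D, eval x f = 0) ∧ eval p f ≠ 0

lemma sep_transport [Finite ι] [Finite κ] (e : ι ≃ κ) (h : Sep K ι) : Sep K κ := by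
  intro D hD p hp
  obtain ⟨f, hf, hfp⟩ := h ((fun x => x ∘ e.symm) ⁻¹' D) (hD.preimage (continuous_re _)) (p ∘ e) (by
    intro h
    apply hp
    have : (p ∘ e) ∘ e.symm = p := by ext; simp
    rw [← this]; exact h)
  refine ⟨rename e f, ?_, ?_⟩
  · intro x hx
    rw [eval_rename]
    apply hf
    have : (x ∘ e) ∘ e.symm = x := by ext; simp
    change (x ∘ e) ∘ e.symm ∈ D
    rw [this]; exact hx
  · rw [eval_rename]; exact hfp

lemma HP_transport [Finite ι] [Finite κ] (e : ι ≃ κ) (h : HP K ι) : HP K κ := by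
  intro D hD hDi hd
  have himg : (fun x => x ∘ e) '' D = (fun x => x ∘ e.symm) ⁻¹' D := by
    ext y
    constructor
    · rintro ⟨x, hx, rfl⟩
      have : (x ∘ e) ∘ e.symm = x := by ext; simp
      change (x ∘ e) ∘ e.symm ∈ D
      rw [this]; exact hx
    · intro hy
      exact ⟨_, hy, by ext; simp⟩
  obtain ⟨Q, hQ, hDQ⟩ := h ((fun x => x ∘ e) '' D) (by rw [himg]; exact hD.preimage (continuous_re _))
    (hDi.image _ (continuous_re _).continuousOn) (by
      rw [dim_re_inj hD e (by intro x _ x' _ h; exact e.surjective.injective_comp_right h), hd, Nat.card_congr e])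
  refine ⟨rename e Q, ?_, ?_⟩
  · have := (MulEquiv.irreducible_iff (renameEquiv K e)).2 hQ
    simpa using this
  · ext x
    rw [mem_ofPred_eq, eval_rename]
    have := Set.ext_iff.1 hDQ (x ∘ e)
    rw [mem_ofPred_eq] at this
    rw [← this]
    constructor
    · intro hx; exact ⟨x, hx, rfl⟩
    · rintro ⟨x', hx', h⟩
      rw [← e.surjective.injective_comp_right h]; exact hx'

lemma sep_of_irred [Finite ι] (h : ∀ D : Set (ι → K), IsClosed D → IsIrreducible D → ∀ p, p ∉ D →
    ∃ f : MvPolynomial ι K, (∀ x ∈ D, eval x f = 0) ∧ eval p f ≠ 0) : Sep K ι := by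
  classical
  intro D hD p hp
  obtain ⟨Fm, hf, hc, hi, hu⟩ := finite_decomp hD
  have : ∀ A ∈ Fm, ∃ f : MvPolynomial ι K, (∀ x ∈ A, eval x f = 0) ∧ eval p f ≠ 0 := by
    intro A hA
    apply h A (hc A hA) (hi A hA)
    intro hpA; apply hp; rw [hu]; exact ⟨A, hA, hpA⟩
  choose! f hf1 hf2 using this
  refine ⟨∏ A ∈ hf.toFinset, f A, ?_, ?_⟩
  · intro x hx
    rw [hu] at hx
    obtain ⟨A, hA, hxA⟩ := hx
    rw [map_prod]
    exact Finset.prod_eq_zero (hf.mem_toFinset.2 hA) (hf1 A hA x hxA)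
  · rw [map_prod]
    exact Finset.prod_ne_zero_iff.2 (fun A hA => hf2 A (hf.mem_toFinset.1 hA))

lemma sep_step [Fintype ι] (H : HP K (Option ι)) (hS : Sep K ι) : Sep K (Option ι) := by
  apply sep_of_irred
  intro D hD hDi p hp
  have hco : Nat.card (Option ι) = Nat.card ι + 1 := Finite.card_option
  have hlt : dim D < Nat.card (Option ι) := dim_lt_card hD (by rintro rfl; exact hp (mem_univ _)) hDi.nonempty
  by_cases hdm : dim D + 1 = Nat.card (Option ι)
  · obtain ⟨Q, _, hQ⟩ := H D hD hDi hdm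
    rw [hQ] at hp ⊢
    exact ⟨Q, fun x hx => hx, hp⟩
  have hdm' : dim D < Nat.card ι := by omega
  -- a nonzero polynomial vanishing on the projection
  have hpr : closure ((fun z : Option ι → K => z ∘ some) '' D) ≠ univ :=
    sub_univ_of_dim ((dim_re_le D some).trans_lt hdm')
  obtain ⟨q, hq⟩ : ∃ q, q ∉ closure ((fun z : Option ι → K => z ∘ some) '' D) := by
    by_contra hcon; push Not at hcon; exact hpr (eq_univ_iff_forall.2 hcon)
  obtain ⟨F, hFD, hFq⟩ := hS _ isClosed_closure q hq
  have hF0 : F ≠ 0 := by rintro rfl; simp at hFq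
  -- bad directions
  let Bd : Set (Option ι ⊕ ι → K) := {w | w ∘ Sum.inl ∈ D ∧ ∀ i, w (Sum.inl (some i)) - p (some i) =
    w (Sum.inr i) * (w (Sum.inl none) - p none)}
  have hBd : IsClosed Bd := by
    apply IsClosed.inter
    · exact hD.preimage (continuous_re _)
    · have : {w : Option ι ⊕ ι → K | ∀ i, w (Sum.inl (some i)) - p (some i) = w (Sum.inr i) * (w (Sum.inl none) - p none)} =
        ⋂ i, {w : Option ι ⊕ ι → K | w (Sum.inl (some i)) - p (some i) = w (Sum.inr i) * (w (Sum.inl none) - p none)} := by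
        ext; simp
      change IsClosed {w : Option ι ⊕ ι → K | ∀ i, w (Sum.inl (some i)) - p (some i) = w (Sum.inr i) * (w (Sum.inl none) - p none)}
      rw [this]
      exact isClosed_iInter fun i => isClosed_pf_eq ((PF.coord _).sub (PF.const _)) ((PF.coord _).mul ((PF.coord _).sub (PF.const _)))
  have hBz : ∀ w ∈ Bd, w (Sum.inl none) - p none ≠ 0 := by
    intro w hw h0
    apply hp
    have : w ∘ Sum.inl = p := by
      funext o; rcases o with _ | i
      · exact sub_eq_zero.1 h0
      · have := hw.2 i
        rw [h0, mul_zero] at this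
        exact sub_eq_zero.1 this
    rw [← this]; exact hw.1
  have hBdim : dim Bd ≤ dim D := by
    rw [← dim_re_inj hBd Sum.inl (by
      intro w hw w' hw' h
      funext k
      rcases k with k | i
      · exact congrFun h k
      · have h1 := hw.2 i
        have h2 := hw'.2 i
        have h3 := hBz w hw
        have e1 : w (Sum.inl (some i)) = w' (Sum.inl (some i)) := congrFun h _
        have e2 : w (Sum.inl none) = w' (Sum.inl none) := congrFun h _
        rw [← e1, ← e2, h1] at h2
        exact mul_right_cancel₀ h3 h2)]
    apply dim_mono
    rintro _ ⟨w, hw, rfl⟩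
    exact hw.1
  have hbad : closure ((fun w : Option ι ⊕ ι → K => w ∘ Sum.inr) '' Bd) ≠ univ :=
    sub_univ_of_dim ((dim_re_le Bd Sum.inr).trans_lt (hBdim.trans_lt hdm'))
  have hun := union_proper isClosed_closure (isClosed_alg (homogeneousComponent F.totalDegree F)) hbad (zero_ne_univ (top_ne_zero hF0))
  obtain ⟨v, hv⟩ : ∃ v, v ∉ closure ((fun w : Option ι ⊕ ι → K => w ∘ Sum.inr) '' Bd) ∪
      {x | eval x (homogeneousComponent F.totalDegree F) = 0} := by
    by_contra hcon; push Not at hcon; exact hun (eq_univ_iff_forall.2 hcon)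
  simp only [mem_union, not_or] at hv
  obtain ⟨hv1, hv2⟩ := hv
  have hv2' : eval v (homogeneousComponent F.totalDegree F) ≠ 0 := hv2
  -- shear
  let D' : Set (Option ι → K) := {z | xc (fun i => z (some i) + v i * z none) (z none) ∈ D}
  have hD' : IsClosed D' := by
    refine hD.preimage (PF.cont (g := fun k (z : Option ι → K) => xc (fun i => z (some i) + v i * z none) (z none) k) ?_)
    rintro (_ | k)
    · exact PF.coord none
    · exact (PF.coord _).add ((PF.const _).mul (PF.coord _))
  set c := eval v (homogeneousComponent F.totalDegree F) with hc
  have hldeg : ∀ b, (lineP F b v).natDegree = F.totalDegree ∧ (lineP F b v).leadingCoeff = c := by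
    intro b
    obtain ⟨h1, h2⟩ := lineP_deg F b v F.totalDegree le_rfl
    have h3 : (lineP F b v).natDegree = F.totalDegree :=
      le_antisymm h1 (Polynomial.le_natDegree_of_ne_zero (by rw [h2]; exact hv2'))
    exact ⟨h3, by rw [Polynomial.leadingCoeff, h3, h2]⟩
  have himc := closed_map (e := F.totalDegree) (fun b => Polynomial.C c⁻¹ * lineP F b v) (by
      intro b
      apply Polynomial.monic_C_mul_of_mul_leadingCoeff_eq_one
      rw [(hldeg b).2]; exact inv_mul_cancel₀ hv2') (by
      intro b
      rw [Polynomial.natDegree_C_mul (inv_ne_zero hv2'), (hldeg b).1]) (by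
      intro t
      simp only [Polynomial.eval_mul, Polynomial.eval_C, lineP_eval]
      exact (PF.const _).mul ((PF.poly F).comp (fun i => (PF.coord _).add (PF.const _)))) hD' (by
      intro z hz
      rw [Polynomial.eval_mul, lineP_eval]
      have : eval (fun i => z (some i) + v i * z none) F = 0 := hFD _ (subset_closure ⟨_, hz, rfl⟩)
      change _ * eval (fun i => z (some i) + v i * z none) F = 0
      rw [this, mul_zero])
  obtain ⟨g, hg, hgp⟩ := hS _ himc (fun i => p (some i) - v i * p none) (by
    rintro ⟨z, hz, hzp⟩
    apply hv1
    apply subset_closure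
    have hzi : ∀ i, z (some i) = p (some i) - v i * p none := fun i => congrFun hzp i
    refine ⟨Sum.elim (xc (fun i => z (some i) + v i * z none) (z none)) v, ⟨hz, ?_⟩, rfl⟩
    intro i
    simp only [Sum.elim_inl, Sum.elim_inr, xc_some, xc_none, hzi]
    ring)
  have hpf : PF (fun z : Option ι → K => eval (fun i => z (some i) - v i * z none) g) :=
    (PF.poly g).comp (fun i => (PF.coord _).sub ((PF.const _).mul (PF.coord _)))
  obtain ⟨f, hf⟩ := hpf
  refine ⟨f, ?_, ?_⟩
  · intro x hx
    rw [← hf]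
    apply hg
    refine ⟨xc (fun i => x (some i) - v i * x none) (x none), ?_, rfl⟩
    change xc (fun i => (x (some i) - v i * x none) + v i * x none) (x none) ∈ D
    simp only [sub_add_cancel]
    have := xc_eta (z := x) rfl
    change xc (x ∘ some) (x none) ∈ D
    rw [this]; exact hx
  · rw [← hf]; exact hgp

lemma sep_all (H2 : HP K (Fin 2)) (α : Type) [Finite α] : Sep K α := by
  have key : ∀ (α : Type) [Finite α], HP K α ∧ Sep K α := by
    intro α _
    have h : ∀ _ : Finite α, HP K α ∧ Sep K α := by
      apply Finite.induction_empty_option (P := fun α => ∀ _ : Finite α, HP K α ∧ Sep K α) _ _ _ α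
      · intro α β e h hβ
        haveI := Finite.of_equiv β e.symm
        obtain ⟨h1, h2⟩ := h inferInstance
        exact ⟨HP_transport e h1, sep_transport e h2⟩
      · intro _
        constructor
        · intro D _ _ hd; simp at hd
        · intro D _ p hp
          refine ⟨1, fun x hx => ?_, by simp⟩
          rw [Subsingleton.elim x p] at hx; exact absurd hx hp
      · intro α _ h hO
        obtain ⟨h1, h2⟩ := h inferInstance
        have h3 := HP_step h1 H2
        exact ⟨h3, sep_step h3 h2⟩
    exact h inferInstance
  exact (key α).2

end ZG

/-- Reduction step of Theorem 3: if a Zariski geometry on an algebraically closed field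
refines the Zariski topology and for some `n` has a closed set that is not
Zariski-closed, then there is a plane curve of the geometry (a `τ_2`-closed irreducible
subset of `K²` of dimension 1) not contained in the zero set of any nonzero polynomial
in `K[X,Y]`. -/
theorem exists_plane_curve_not_algebraic_of_ne
    {K : Type*} [Field K] [IsAlgClosed K] (Z : ZariskiGeometry K)
    (hrefine : ∀ (n : ℕ) (C : Set (Fin n → K)), ZariskiClosedSet K C → IsClosed[Z.τ n] C)
    (hne : ∃ (n : ℕ) (D : Set (Fin n → K)), IsClosed[Z.τ n] D ∧ ¬ ZariskiClosedSet K D) :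
    ∃ C : Set (Fin 2 → K), IsClosed[Z.τ 2] C ∧ @IsIrreducible _ (Z.τ 2) C ∧
      setKrullDim (Z.τ 2) C = 1 ∧
      ∀ f : MvPolynomial (Fin 2) K, f ≠ 0 →
        ¬ C ⊆ {p : Fin 2 → K | MvPolynomial.eval p f = 0} := by
  by_contra hcon
  push Not at hcon
  letI : ZG K := ⟨Z, hrefine⟩
  have e2 : ZG.zgTop (K := K) (Fin 2) = Z.τ 2 := ZG.zgTop_fin' (K := K) 2
  have H2 : ZG.HP K (Fin 2) := by
    apply ZG.HP_two
    intro C hC hi hd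
    have hk := ZG.kd_eq_dim hC hi
    rw [hd] at hk
    have hk' : setKrullDim (ZG.zgTop (K := K) (Fin 2)) C = 1 := by
      have hk2 : ZG.kd C = 1 := by simpa using hk
      exact hk2
    rw [← e2] at hcon
    obtain ⟨f, hf, hs⟩ := hcon C hC hi hk'
    exact ⟨f, hf, fun x hx => hs hx⟩
  obtain ⟨n, D, hD, hDn⟩ := hne
  have en : ZG.zgTop (K := K) (Fin n) = Z.τ n := ZG.zgTop_fin' (K := K) n
  rw [← en] at hD
  apply hDn
  refine ⟨{f | ∀ x ∈ D, MvPolynomial.eval x f = 0}, ?_⟩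
  ext p
  constructor
  · intro hp f hf
    exact hf p hp
  · intro hp
    by_contra hpD
    obtain ⟨f, hf, hfp⟩ := ZG.sep_all H2 (Fin n) D hD p hpD
    exact hfp (hp f hf)
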